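/- arXiv:2309.00826 — 7 statements merged into one kernel-verified Lean document; each statement's English description precedes it below -/
import Mathlib

section
/- Let d ≥ 1 be an integer, Φ : ℕ → [2, ∞) a function, and suppose liminf_{n→∞} (log Φ(n))/n = log B with 1 < B < ∞. Then the sequence (λ_d(B, n))_{n≥1} converges as n → ∞, and the Hausdorff dimension of Λ_d(Φ) equals lim_{n→∞} λ_d(B, n). -/
open MeasureTheory Filter Set

/-- The Gauss map `T(x) = 1/x - ⌊1/x⌋` (with `T(0) = 0`). -/
noncomputable def gaussMap (x : ℝ) : ℝ := if x = 0 then 0 else 1 / x - (⌊1 / x⌋ : ℝ)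

/-- The `n`-th partial quotient `a_n(x) = ⌊1 / T^{n-1}(x)⌋` (for `n ≥ 1`). -/
noncomputable def pq (n : ℕ) (x : ℝ) : ℕ := ⌊1 / (gaussMap^[n - 1] x)⌋₊

/-- `Λ_d(Φ)`: irrational `x ∈ [0,1)` with `a_n(x) a_{2n}(x) ⋯ a_{dn}(x) ≥ Φ(n)`
for infinitely many `n`. -/
def Lambda (d : ℕ) (Φ : ℕ → ℝ) : Set ℝ :=
  {x | x ∈ Set.Ico (0 : ℝ) 1 ∧ Irrational x ∧
    ∃ᶠ n in Filter.atTop, Φ n ≤ ∏ i ∈ Finset.Icc 1 d, (pq (i * n) x : ℝ)}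

/-- `g_n(s)`: `g_1(s) = s`, `g_n(s) = s g_{n-1}(s) / (1 - s + n g_{n-1}(s))` for `n ≥ 2`. -/
noncomputable def gFun : ℕ → ℝ → ℝ
  | 0, s => s
  | 1, s => s
  | n + 2, s => s * gFun (n + 1) s / (1 - s + ((n : ℝ) + 2) * gFun (n + 1) s)

/-- Continuants: `q_0 = 1`, `q_1 = a_1`, `q_k = a_k q_{k-1} + q_{k-2}` (here `a` is 1-indexed). -/
def contQ (a : ℕ → ℕ) : ℕ → ℕ
  | 0 => 1
  | 1 => a 1
  | k + 2 => a (k + 2) * contQ a (k + 1) + contQ a k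

/-- Extend a tuple `(a_1, …, a_n)` of positive integers to a 1-indexed sequence `ℕ → ℕ`. -/
def extendTuple {n : ℕ} (v : Fin n → ℕ+) : ℕ → ℕ :=
  fun i => if h : i - 1 < n ∧ 1 ≤ i then (v ⟨i - 1, h.1⟩ : ℕ) else 1

/-- `λ_d(B, n) = inf { s ≥ 0 : ∑_{(a_1,…,a_n) ∈ ℕ_{>0}^n} q_n^{-2s} B^{-g_d(s) n} ≤ 1 }`. -/
noncomputable def lambdaBn (d : ℕ) (B : ℝ) (n : ℕ) : ℝ :=
  sInf {s : ℝ | 0 ≤ s ∧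
    (∑' v : Fin n → ℕ+,
      ENNReal.ofReal ((contQ (extendTuple v) n : ℝ) ^ (-(2 * s)) * B ^ (-(gFun d s) * (n : ℝ)))) ≤ 1}

/-! ### Continued fraction basics -/

def prevQ (a : ℕ → ℕ) : ℕ → ℕ
  | 0 => 0
  | n + 1 => contQ a n

lemma contQ_succ (a : ℕ → ℕ) (n : ℕ) :
    contQ a (n + 1) = a (n + 1) * contQ a n + prevQ a n := by
  cases n with
  | zero => simp [contQ, prevQ]
  | succ k => simp [contQ, prevQ]

lemma prevQ_succ (a : ℕ → ℕ) (n : ℕ) : prevQ a (n + 1) = contQ a n := rfl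

lemma contQ_congr {a b : ℕ → ℕ} (n : ℕ) (h : ∀ i, 1 ≤ i → i ≤ n → a i = b i) :
    contQ a n = contQ b n := by
  induction n using Nat.strong_induction_on with
  | _ n ih =>
    match n with
    | 0 => rfl
    | 1 => simpa [contQ] using h 1 le_rfl le_rfl
    | k + 2 =>
      simp only [contQ]
      rw [h (k + 2) (by omega) le_rfl, ih (k + 1) (by omega) (fun i h1 h2 => h i h1 (by omega)),
        ih k (by omega) (fun i h1 h2 => h i h1 (by omega))]

lemma contQ_pos {a : ℕ → ℕ} (ha : ∀ i, 1 ≤ i → 1 ≤ a i) (n : ℕ) : 1 ≤ contQ a n := by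
  induction n with
  | zero => simp [contQ]
  | succ k ih =>
    rw [contQ_succ]
    have := Nat.mul_le_mul (ha (k + 1) (by omega)) ih
    omega

lemma prevQ_le {a : ℕ → ℕ} (ha : ∀ i, 1 ≤ i → 1 ≤ a i) (n : ℕ) : prevQ a n ≤ contQ a n := by
  cases n with
  | zero => simp [contQ, prevQ]
  | succ k =>
    rw [contQ_succ]
    have := Nat.mul_le_mul_right (contQ a k) (ha (k + 1) (by omega))
    simp only [prevQ]
    omega

lemma contQ_succ_le {a : ℕ → ℕ} (ha : ∀ i, 1 ≤ i → 1 ≤ a i) (n : ℕ) :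
    contQ a (n + 1) ≤ (a (n + 1) + 1) * contQ a n := by
  rw [contQ_succ]
  have := prevQ_le ha n
  nlinarith

lemma le_contQ {a : ℕ → ℕ} (ha : ∀ i, 1 ≤ i → 1 ≤ a i) (n : ℕ) : n ≤ contQ a n := by
  induction n with
  | zero => simp
  | succ k ih =>
    rw [contQ_succ]
    have := Nat.mul_le_mul_right (contQ a k) (ha (k + 1) (by omega))
    cases k with
    | zero => simp [contQ] at *; omega
    | succ l =>
      have := contQ_pos ha l
      simp only [prevQ]
      omega

lemma contQ_add_ge (a : ℕ → ℕ) (n k : ℕ) :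
    contQ a n * contQ (fun i => a (n + i)) k ≤ contQ a (n + k) := by
  induction k using Nat.strong_induction_on with
  | _ k ih =>
    match k with
    | 0 => simp [contQ]
    | 1 =>
      rw [contQ_succ a n]; simp only [contQ]; nlinarith [Nat.zero_le (prevQ a n)]
    | k + 2 =>
      have h1 := ih (k + 1) (by omega)
      have h2 := ih k (by omega)
      have e : n + (k + 2) = (n + k) + 2 := by ring
      rw [e]
      simp only [contQ]
      have e2 : n + (k + 1) = n + k + 1 := by ring
      rw [e2] at h1
      have e3 : n + (k + 2) = n + k + 2 := by ring
      rw [e3]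
      nlinarith [Nat.mul_le_mul_left (a (n + k + 2)) h1]

lemma contQ_add_le {a : ℕ → ℕ} (ha : ∀ i, 1 ≤ i → 1 ≤ a i) (n k : ℕ) :
    contQ a (n + k) ≤ 2 * (contQ a n * contQ (fun i => a (n + i)) k) := by
  induction k using Nat.strong_induction_on with
  | _ k ih =>
    match k with
    | 0 => simp [contQ]; omega
    | 1 =>
      rw [contQ_succ a n]; simp only [contQ]
      have := prevQ_le ha n
      have := Nat.mul_le_mul_left (contQ a n) (ha (n + 1) (by omega))
      nlinarith
    | k + 2 =>
      have h1 := ih (k + 1) (by omega)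
      have h2 := ih k (by omega)
      have e : n + (k + 2) = (n + k) + 2 := by ring
      rw [e]
      simp only [contQ]
      have e2 : n + (k + 1) = n + k + 1 := by ring
      rw [e2] at h1
      have e3 : n + (k + 2) = n + k + 2 := by ring
      rw [e3]
      nlinarith [Nat.mul_le_mul_left (a (n + k + 2)) h1]

noncomputable def psi (a : ℕ → ℕ) : ℕ → ℝ → ℝ
  | 0, t => t
  | n + 1, t => psi a n (1 / ((a (n + 1) : ℝ) + t))

lemma psi_congr {a b : ℕ → ℕ} (n : ℕ) (h : ∀ i, 1 ≤ i → i ≤ n → a i = b i) (t : ℝ) :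
    psi a n t = psi b n t := by
  induction n generalizing t with
  | zero => rfl
  | succ k ih =>
    simp only [psi]
    rw [h (k + 1) (by omega) le_rfl, ih (fun i h1 h2 => h i h1 (by omega))]

lemma psi_left (a : ℕ → ℕ) (n : ℕ) (t : ℝ) :
    psi a (n + 1) t = 1 / ((a 1 : ℝ) + psi (fun i => a (i + 1)) n t) := by
  induction n generalizing t with
  | zero => simp [psi]
  | succ k ih => rw [psi, ih]; simp [psi]

lemma psi_sub {a : ℕ → ℕ} (ha : ∀ i, 1 ≤ i → 1 ≤ a i) (n : ℕ) {t u : ℝ} (ht : 0 ≤ t) (hu : 0 ≤ u) :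
    |psi a n t - psi a n u| =
      |t - u| / (((contQ a n : ℝ) + t * prevQ a n) * ((contQ a n : ℝ) + u * prevQ a n)) := by
  induction n generalizing t u with
  | zero => simp [psi, contQ, prevQ]
  | succ k ih =>
    have hA : (1 : ℝ) ≤ a (k + 1) := by exact_mod_cast ha (k + 1) (by omega)
    have hq : (1 : ℝ) ≤ contQ a k := by exact_mod_cast contQ_pos ha k
    have hp : (0 : ℝ) ≤ prevQ a k := by positivity
    simp only [psi]
    rw [ih (by positivity) (by positivity), contQ_succ, prevQ_succ]
    push_cast
    set A : ℝ := (a (k + 1) : ℝ)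
    set q : ℝ := (contQ a k : ℝ)
    set p : ℝ := (prevQ a k : ℝ)
    have e1 : 1 / (A + t) - 1 / (A + u) = (u - t) / ((A + t) * (A + u)) := by
      field_simp; ring
    have e2 : q + 1 / (A + t) * p = (A * q + p + t * q) / (A + t) := by
      field_simp; ring
    have e3 : q + 1 / (A + u) * p = (A * q + p + u * q) / (A + u) := by
      field_simp; ring
    rw [e1, e2, e3, abs_div, abs_of_pos (show 0 < (A + t) * (A + u) by positivity), abs_sub_comm]
    field_simp

lemma psi_sub_le {a : ℕ → ℕ} (ha : ∀ i, 1 ≤ i → 1 ≤ a i) (n : ℕ) {t u : ℝ} (ht : 0 ≤ t)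
    (hu : 0 ≤ u) : |psi a n t - psi a n u| ≤ |t - u| / (contQ a n : ℝ) ^ 2 := by
  rw [psi_sub ha n ht hu]
  have hq : (1 : ℝ) ≤ contQ a n := by exact_mod_cast contQ_pos ha n
  have hp : (0 : ℝ) ≤ prevQ a n := by positivity
  gcongr
  rw [sq]
  gcongr <;> nlinarith [mul_nonneg ht hp, mul_nonneg hu hp]

lemma le_psi_sub {a : ℕ → ℕ} (ha : ∀ i, 1 ≤ i → 1 ≤ a i) (n : ℕ) {t u : ℝ} (ht : 0 ≤ t)
    (hu : 0 ≤ u) (ht1 : t ≤ 1) (hu1 : u ≤ 1) :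
    |t - u| / (4 * (contQ a n : ℝ) ^ 2) ≤ |psi a n t - psi a n u| := by
  rw [psi_sub ha n ht hu]
  have hq : (1 : ℝ) ≤ contQ a n := by exact_mod_cast contQ_pos ha n
  have hp : (0 : ℝ) ≤ prevQ a n := by positivity
  have hpq : (prevQ a n : ℝ) ≤ contQ a n := by exact_mod_cast prevQ_le ha n
  have e : 4 * (contQ a n : ℝ) ^ 2 = (2 * contQ a n) * (2 * contQ a n) := by ring
  rw [e]
  gcongr <;> nlinarith

lemma psi_mem {a : ℕ → ℕ} (ha : ∀ i, 1 ≤ i → 1 ≤ a i) (n : ℕ) {t : ℝ} (ht : 0 ≤ t) (ht1 : t ≤ 1) :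
    0 ≤ psi a n t ∧ psi a n t ≤ 1 := by
  induction n generalizing t with
  | zero => exact ⟨ht, ht1⟩
  | succ k ih =>
    have hA : (1 : ℝ) ≤ a (k + 1) := by exact_mod_cast ha (k + 1) (by omega)
    apply ih (by positivity)
    rw [div_le_one (by positivity)]
    linarith

/-! Gauss map facts -/

lemma gaussMap_facts {x : ℝ} (hx : Irrational x) (h0 : 0 < x) (h1 : x < 1) :
    Irrational (gaussMap x) ∧ 0 < gaussMap x ∧ gaussMap x < 1 ∧ 1 ≤ ⌊1 / x⌋₊ ∧
      x = 1 / ((⌊1 / x⌋₊ : ℝ) + gaussMap x) := by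
  have hg : gaussMap x = 1 / x - (⌊1 / x⌋ : ℝ) := by simp [gaussMap, h0.ne']
  have hpos : 0 < 1 / x := by positivity
  have hfl : ((⌊1 / x⌋₊ : ℕ) : ℝ) = (⌊1 / x⌋ : ℝ) := by
    exact natCast_floor_eq_intCast_floor hpos.le
  have hirr : Irrational (gaussMap x) := by
    rw [hg]
    have : Irrational (1 / x) := by rw [one_div]; exact hx.inv
    exact this.sub_intCast _
  refine ⟨hirr, ?_, ?_, ?_, ?_⟩
  · have : 0 ≤ gaussMap x := by rw [hg]; linarith [Int.floor_le (1 / x)]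
    exact lt_of_le_of_ne this (fun h => hirr ⟨0, by simp [h]⟩)
  · rw [hg]; linarith [Int.lt_floor_add_one (1 / x)]
  · rw [Nat.one_le_floor_iff, le_div_iff₀ h0]; linarith
  · rw [hg, hfl]; simp

lemma gaussIter_facts {x : ℝ} (hx : Irrational x) (h0 : 0 < x) (h1 : x < 1) (n : ℕ) :
    Irrational (gaussMap^[n] x) ∧ 0 < gaussMap^[n] x ∧ gaussMap^[n] x < 1 := by
  induction n with
  | zero => exact ⟨hx, h0, h1⟩
  | succ k ih =>
    rw [Function.iterate_succ_apply']
    obtain ⟨a, b, c, -⟩ := gaussMap_facts ih.1 ih.2.1 ih.2.2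
    exact ⟨a, b, c⟩

lemma pq_pos {x : ℝ} (hx : Irrational x) (h0 : 0 < x) (h1 : x < 1) (n : ℕ) : 1 ≤ pq n x := by
  obtain ⟨a, b, c⟩ := gaussIter_facts hx h0 h1 (n - 1)
  exact (gaussMap_facts a b c).2.2.2.1

lemma gaussIter_eq {x : ℝ} (hx : Irrational x) (h0 : 0 < x) (h1 : x < 1) (n : ℕ) :
    gaussMap^[n] x = 1 / ((pq (n + 1) x : ℝ) + gaussMap^[n + 1] x) := by
  obtain ⟨a, b, c⟩ := gaussIter_facts hx h0 h1 n
  rw [Function.iterate_succ_apply']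
  exact (gaussMap_facts a b c).2.2.2.2

lemma eq_psi {x : ℝ} (hx : Irrational x) (h0 : 0 < x) (h1 : x < 1) (n : ℕ) :
    x = psi (fun i => pq i x) n (gaussMap^[n] x) := by
  induction n with
  | zero => rfl
  | succ k ih => rw [psi, ← gaussIter_eq hx h0 h1]; exact ih

/-! Existence of a number with given digits -/

lemma psi_zero_cauchy {a : ℕ → ℕ} (ha : ∀ i, 1 ≤ i → 1 ≤ a i) :
    ∃ x, Tendsto (fun n => psi a n 0) atTop (nhds x) := by
  have key : ∀ n k, 1 ≤ n → |psi a (n + k) 0 - psi a n 0| ≤ 1 / ((n : ℝ)) := by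
    intro n k hn
    have gen : ∀ k, ∀ u : ℝ, 0 ≤ u → u ≤ 1 →
        ∃ t : ℝ, 0 ≤ t ∧ t ≤ 1 ∧ psi a (n + k) u = psi a n t := by
      intro k
      induction k with
      | zero => intro u h1 h2; exact ⟨u, h1, h2, rfl⟩
      | succ l ih =>
        intro u h1 h2
        have hA : (1 : ℝ) ≤ a (n + l + 1) := by exact_mod_cast ha _ (by omega)
        obtain ⟨t, h⟩ := ih (1 / ((a (n + l + 1) : ℝ) + u)) (by positivity)
          (by rw [div_le_one (by positivity)]; linarith)
        exact ⟨t, h⟩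
    obtain ⟨t, h1, h2, h3⟩ := gen k 0 le_rfl zero_le_one
    rw [h3]
    refine (psi_sub_le ha n h1 le_rfl).trans ?_
    have hn' : (1 : ℝ) ≤ n := by exact_mod_cast hn
    have hq : (n : ℝ) ≤ contQ a n := by exact_mod_cast le_contQ ha n
    have : |t - 0| ≤ 1 := by rw [sub_zero, abs_of_nonneg h1]; exact h2
    have h4 : (n : ℝ) ≤ (contQ a n : ℝ) ^ 2 := by nlinarith
    gcongr
  have : CauchySeq (fun n => psi a n 0) := by
    rw [Metric.cauchySeq_iff']
    intro ε hε
    obtain ⟨N, hN⟩ := exists_nat_gt (1 / ε)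
    have hN0 : 0 < (N : ℝ) := lt_trans (by positivity) hN
    refine ⟨N, fun n hn => ?_⟩
    obtain ⟨k, rfl⟩ := Nat.exists_eq_add_of_le hn
    rw [Real.dist_eq]
    refine (key N k (by exact_mod_cast hN0)).trans_lt ?_
    rw [div_lt_iff₀ hN0]
    rwa [div_lt_iff₀ hε, mul_comm] at hN
  exact cauchySeq_tendsto_of_complete this

open Classical in
noncomputable def xval (a : ℕ → ℕ) : ℝ :=
  if h : ∃ x, Tendsto (fun n => psi a n 0) atTop (nhds x) then h.choose else 0

lemma tendsto_xval {a : ℕ → ℕ} (ha : ∀ i, 1 ≤ i → 1 ≤ a i) :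
    Tendsto (fun n => psi a n 0) atTop (nhds (xval a)) := by
  have h := psi_zero_cauchy ha
  rw [xval, dif_pos h]
  exact h.choose_spec

lemma shift_pos {a : ℕ → ℕ} (ha : ∀ i, 1 ≤ i → 1 ≤ a i) : ∀ i, 1 ≤ i → 1 ≤ a (i + 1) :=
  fun i _ => ha _ (by omega)

lemma xval_mem' {a : ℕ → ℕ} (ha : ∀ i, 1 ≤ i → 1 ≤ a i) : 0 ≤ xval a ∧ xval a ≤ 1 :=
  ⟨ge_of_tendsto' (tendsto_xval ha) fun n => (psi_mem ha n le_rfl zero_le_one).1,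
    le_of_tendsto' (tendsto_xval ha) fun n => (psi_mem ha n le_rfl zero_le_one).2⟩

lemma xval_left {a : ℕ → ℕ} (ha : ∀ i, 1 ≤ i → 1 ≤ a i) :
    xval a = 1 / ((a 1 : ℝ) + xval (fun i => a (i + 1))) := by
  have h1 := (tendsto_add_atTop_iff_nat 1).2 (tendsto_xval ha)
  have h2 := tendsto_xval (shift_pos ha)
  have hA : (1 : ℝ) ≤ a 1 := by exact_mod_cast ha _ (by omega)
  have h3 : Tendsto (fun n => 1 / ((a 1 : ℝ) + psi (fun i => a (i + 1)) n 0)) atTop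
      (nhds (1 / ((a 1 : ℝ) + xval (fun i => a (i + 1))))) := by
    apply Tendsto.div tendsto_const_nhds (tendsto_const_nhds.add h2)
    have := (xval_mem' (shift_pos ha)).1
    positivity
  simp only [psi_left] at h1
  exact tendsto_nhds_unique h1 h3

lemma xval_pos {a : ℕ → ℕ} (ha : ∀ i, 1 ≤ i → 1 ≤ a i) : 0 < xval a := by
  rw [xval_left ha]
  have := (xval_mem' (shift_pos ha)).1
  have hA : (1 : ℝ) ≤ a 1 := by exact_mod_cast ha _ (by omega)
  positivity

lemma xval_lt {a : ℕ → ℕ} (ha : ∀ i, 1 ≤ i → 1 ≤ a i) : xval a < 1 := by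
  rw [xval_left ha]
  have := xval_pos (shift_pos ha)
  have hA : (1 : ℝ) ≤ a 1 := by exact_mod_cast ha _ (by omega)
  rw [div_lt_one (by positivity)]
  linarith

lemma xval_eq_psi {a : ℕ → ℕ} (ha : ∀ i, 1 ≤ i → 1 ≤ a i) (n : ℕ) :
    xval a = psi a n (xval (fun i => a (i + n))) := by
  induction n with
  | zero => rfl
  | succ k ih =>
    rw [psi, ih, xval_left (a := fun i => a (i + k)) (fun i hi => ha _ (by omega))]
    have e : (fun i => a (i + 1 + k)) = fun i => a (i + (k + 1)) := by
      funext i; congr 1; ring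
    rw [e, add_comm 1 k]

lemma xval_irrational {a : ℕ → ℕ} (ha : ∀ i, 1 ≤ i → 1 ≤ a i) : Irrational (xval a) := by
  have key : ∀ q : ℕ, ∀ a : ℕ → ℕ, (∀ i, 1 ≤ i → 1 ≤ a i) → ∀ p : ℤ, xval a * q ≠ p ∨ q = 0 := by
    intro q
    induction q using Nat.strong_induction_on with
    | _ q ih =>
      intro a ha p
      by_contra! hcon
      obtain ⟨h, hq⟩ := hcon
      have hq' : (0 : ℝ) < q := by exact_mod_cast Nat.pos_of_ne_zero hq
      have h0 := xval_pos ha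
      have h1 := xval_lt ha
      have hp0 : (0 : ℝ) < p := by rw [← h]; positivity
      have hpq : (p : ℝ) < q := by rw [← h]; nlinarith
      have hp0' : 0 < p := by exact_mod_cast hp0
      obtain ⟨r, rfl⟩ := Int.eq_ofNat_of_zero_le hp0'.le
      have hrq : r < q := by exact_mod_cast hpq
      rcases ih r hrq (fun i => a (i + 1)) (shift_pos ha) (q - a 1 * r) with h' | h'
      · apply h'
        have hy := xval_pos (shift_pos ha)
        have hx := xval_left ha
        set y := xval (fun i => a (i + 1))
        have hA : (1 : ℝ) ≤ a 1 := by exact_mod_cast ha _ (by omega)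
        rw [hx] at h
        have : (q : ℝ) = r * (a 1 + y) := by
          field_simp at h
          push_cast at h
          linarith
        push_cast
        linarith
      · omega
  rw [irrational_iff_ne_rational]
  intro p q hq h
  have hq' : (q : ℝ) ≠ 0 := by exact_mod_cast hq
  rcases key q.natAbs a ha (p * q.sign) with h' | h'
  · apply h'
    rw [h]
    have : ((q.natAbs : ℕ) : ℝ) = (q : ℝ) * q.sign := by
      have := Int.mul_sign_self q
      rw [← Int.cast_mul, this, ← Int.cast_natCast]
    rw [this]
    push_cast
    field_simp
  · exact hq (by simpa using h')

lemma gaussMap_xval {a : ℕ → ℕ} (ha : ∀ i, 1 ≤ i → 1 ≤ a i) :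
    ⌊1 / xval a⌋₊ = a 1 ∧ gaussMap (xval a) = xval (fun i => a (i + 1)) := by
  have hy := xval_pos (shift_pos ha)
  have hy1 := xval_lt (shift_pos ha)
  have hx := xval_left ha
  have h : 1 / xval a = (a 1 : ℝ) + xval (fun i => a (i + 1)) := by rw [hx, one_div_one_div]
  constructor
  · rw [h, Nat.floor_eq_iff (by positivity)]
    constructor <;> linarith
  · rw [gaussMap, if_neg (xval_pos ha).ne', h]
    have : ⌊(a 1 : ℝ) + xval (fun i => a (i + 1))⌋ = (a 1 : ℤ) := by
      rw [Int.floor_eq_iff]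
      push_cast
      constructor <;> linarith
    rw [this]; push_cast; ring

lemma pq_xval {a : ℕ → ℕ} (ha : ∀ i, 1 ≤ i → 1 ≤ a i) (n : ℕ) (hn : 1 ≤ n) :
    pq n (xval a) = a n := by
  obtain ⟨k, rfl⟩ := Nat.exists_eq_add_of_le' hn
  simp only [pq, Nat.add_sub_cancel]
  have : ∀ k, gaussMap^[k] (xval a) = xval (fun i => a (i + k)) := by
    intro k
    induction k with
    | zero => rfl
    | succ l ih =>
      rw [Function.iterate_succ_apply', ih, (gaussMap_xval (fun i hi => ha _ (by omega))).2]
      congr 1; funext i; congr 1; ring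
  rw [this, (gaussMap_xval (fun i hi => ha _ (by omega))).1, add_comm]

noncomputable def Zs (n : ℕ) (s : ℝ) : ENNReal :=
  ∑' v : Fin n → ℕ+, ENNReal.ofReal ((contQ (extendTuple v) n : ℝ) ^ (-(2 * s)))

lemma extendTuple_pos {n : ℕ} (v : Fin n → ℕ+) (i : ℕ) : 1 ≤ extendTuple v i := by
  unfold extendTuple
  split_ifs with h
  · exact (v _).2
  · exact le_rfl

lemma extendTuple_append_left {n k : ℕ} (u : Fin n → ℕ+) (w : Fin k → ℕ+) (i : ℕ) (h1 : 1 ≤ i)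
    (h2 : i ≤ n) : extendTuple (Fin.append u w) i = extendTuple u i := by
  unfold extendTuple
  rw [dif_pos ⟨by omega, h1⟩, dif_pos ⟨by omega, h1⟩]
  congr 1
  exact Fin.append_left u w ⟨i - 1, by omega⟩

lemma extendTuple_append_right {n k : ℕ} (u : Fin n → ℕ+) (w : Fin k → ℕ+) (i : ℕ) (h1 : 1 ≤ i)
    (h2 : i ≤ k) : extendTuple (Fin.append u w) (n + i) = extendTuple w i := by
  unfold extendTuple
  rw [dif_pos ⟨by omega, by omega⟩, dif_pos ⟨by omega, h1⟩]
  congr 1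
  rw [← Fin.append_right u w ⟨i - 1, by omega⟩]
  congr 1
  ext
  simp
  omega

lemma tsum_append {n k : ℕ} (f : (Fin (n + k) → ℕ+) → ENNReal) :
    ∑' v, f v = ∑' (u : Fin n → ℕ+) (w : Fin k → ℕ+), f (Fin.append u w) := by
  rw [← ENNReal.tsum_prod, ← (Fin.appendEquiv n k).tsum_eq]
  rfl

lemma contQ_append_le {n k : ℕ} (u : Fin n → ℕ+) (w : Fin k → ℕ+) :
    contQ (extendTuple (Fin.append u w)) (n + k) ≤
      2 * (contQ (extendTuple u) n * contQ (extendTuple w) k) := by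
  refine (contQ_add_le (fun i _ => extendTuple_pos _ i) n k).trans_eq ?_
  rw [contQ_congr n (fun i h1 h2 => extendTuple_append_left u w i h1 h2),
    contQ_congr k (fun i h1 h2 => extendTuple_append_right u w i h1 h2)]

lemma contQ_append_ge {n k : ℕ} (u : Fin n → ℕ+) (w : Fin k → ℕ+) :
    contQ (extendTuple u) n * contQ (extendTuple w) k ≤
      contQ (extendTuple (Fin.append u w)) (n + k) := by
  refine le_trans (le_of_eq ?_) (contQ_add_ge _ n k)
  rw [contQ_congr n (fun i h1 h2 => extendTuple_append_left u w i h1 h2),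
    contQ_congr k (fun i h1 h2 => extendTuple_append_right u w i h1 h2)]

lemma one_le_q {n : ℕ} (v : Fin n → ℕ+) : (1 : ℝ) ≤ contQ (extendTuple v) n := by
  exact_mod_cast contQ_pos (fun i _ => extendTuple_pos _ i) n

lemma Zs_add_le (n k : ℕ) {s : ℝ} (hs : 0 ≤ s) : Zs (n + k) s ≤ Zs n s * Zs k s := by
  unfold Zs
  rw [tsum_append, ← ENNReal.tsum_mul_right]
  refine ENNReal.tsum_le_tsum fun u => ?_
  rw [← ENNReal.tsum_mul_left]
  refine ENNReal.tsum_le_tsum fun w => ?_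
  rw [← ENNReal.ofReal_mul (by positivity)]
  apply ENNReal.ofReal_le_ofReal
  have h1 := one_le_q u
  have h2 := one_le_q w
  rw [← Real.mul_rpow (by positivity) (by positivity)]
  apply Real.rpow_le_rpow_of_nonpos (by positivity) _ (by linarith)
  exact_mod_cast contQ_append_ge u w

lemma Zs_mul_le (n k : ℕ) {s : ℝ} (hs : 0 ≤ s) :
    Zs n s * Zs k s ≤ ENNReal.ofReal (4 ^ s) * Zs (n + k) s := by
  unfold Zs
  rw [tsum_append, ← ENNReal.tsum_mul_right, ← ENNReal.tsum_mul_left]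
  refine ENNReal.tsum_le_tsum fun u => ?_
  rw [← ENNReal.tsum_mul_left, ← ENNReal.tsum_mul_left]
  refine ENNReal.tsum_le_tsum fun w => ?_
  rw [← ENNReal.ofReal_mul (by positivity), ← ENNReal.ofReal_mul (by positivity)]
  apply ENNReal.ofReal_le_ofReal
  have h1 := one_le_q u
  have h2 := one_le_q w
  have h3 := one_le_q (Fin.append u w)
  have e : (4 : ℝ) ^ s = (1 / 2 : ℝ) ^ (-(2 * s)) := by
    rw [show (4 : ℝ) = (1 / 2) ^ (-2 : ℝ) by norm_num, ← Real.rpow_mul (by norm_num)]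
    ring_nf
  rw [e, ← Real.mul_rpow (by positivity) (by positivity),
    ← Real.mul_rpow (by positivity) (by positivity)]
  apply Real.rpow_le_rpow_of_nonpos (by positivity) _ (by linarith)
  have : (contQ (extendTuple (Fin.append u w)) (n + k) : ℝ) ≤
      2 * (contQ (extendTuple u) n * contQ (extendTuple w) k) := by
    exact_mod_cast contQ_append_le u w
  linarith

lemma Zs_anti (n : ℕ) {s s' : ℝ} (h : s ≤ s') : Zs n s' ≤ Zs n s := by
  unfold Zs
  refine ENNReal.tsum_le_tsum fun v => ENNReal.ofReal_le_ofReal ?_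
  exact Real.rpow_le_rpow_of_exponent_le (one_le_q v) (by linarith)

lemma Zs_ne_zero (n : ℕ) (s : ℝ) : Zs n s ≠ 0 := by
  unfold Zs
  intro h
  rw [ENNReal.tsum_eq_zero] at h
  have := h (fun _ => 1)
  rw [ENNReal.ofReal_eq_zero] at this
  have h1 := one_le_q (n := n) (fun _ => 1)
  have : 0 < (contQ (extendTuple (n := n) (fun _ => 1)) n : ℝ) ^ (-(2 * s)) := by positivity
  linarith

lemma Zs_zero (s : ℝ) : Zs 0 s = 1 := by
  unfold Zs
  rw [tsum_eq_single default (fun b hb => (hb (Subsingleton.elim _ _)).elim)]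
  simp [contQ]

lemma Zs_finite {n : ℕ} (hn : 1 ≤ n) {s : ℝ} (hs : 0 ≤ s) (h : Zs n s ≠ ⊤) (r : ℕ) :
    Zs r s ≠ ⊤ := by
  obtain ⟨k, rfl⟩ := Nat.exists_eq_add_of_le' hn
  have h1 : Zs 1 s ≠ ⊤ := by
    intro ht
    have := Zs_mul_le k 1 hs
    rw [ht, ENNReal.mul_top (Zs_ne_zero _ _)] at this
    exact ENNReal.mul_ne_top ENNReal.ofReal_ne_top h (top_le_iff.1 this)
  induction r with
  | zero => rw [Zs_zero]; exact ENNReal.one_ne_top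
  | succ r ih =>
    exact ne_top_of_le_ne_top (ENNReal.mul_ne_top ih h1) (Zs_add_le r 1 hs)

lemma Zs_mul_pow (n k r : ℕ) {s : ℝ} (hs : 0 ≤ s) : Zs (n * k + r) s ≤ Zs n s ^ k * Zs r s := by
  induction k with
  | zero => simp
  | succ k ih =>
    have : n * (k + 1) + r = n + (n * k + r) := by ring
    rw [this, pow_succ', mul_assoc]
    refine (Zs_add_le n _ hs).trans ?_
    gcongr

/-- exponential bound from one level -/
lemma Zs_exp_bound {n : ℕ} (hn : 1 ≤ n) {s b : ℝ} (hs : 0 ≤ s) (hb : 0 < b)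
    (h : Zs n s ≤ ENNReal.ofReal (b ^ n)) :
    ∃ C : ℝ, 0 < C ∧ ∀ N, Zs N s ≤ ENNReal.ofReal (C * b ^ N) := by
  have hf := Zs_finite hn hs (ne_top_of_le_ne_top ENNReal.ofReal_ne_top h)
  refine ⟨∑ r ∈ Finset.range n, (Zs r s).toReal / b ^ r, ?_, fun N => ?_⟩
  · apply Finset.sum_pos
    · intro r _
      have := ENNReal.toReal_pos (Zs_ne_zero r s) (hf r)
      positivity
    · exact ⟨0, by simp; omega⟩
  · have hr : N % n < n := Nat.mod_lt _ (by omega)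
    have hN := Nat.div_add_mod N n
    have h1 := Zs_mul_pow n (N / n) (N % n) hs
    rw [hN] at h1
    refine h1.trans ?_
    have h2 : Zs n s ^ (N / n) ≤ ENNReal.ofReal (b ^ (n * (N / n))) := by
      rw [pow_mul, ENNReal.ofReal_pow (by positivity)]
      gcongr
    calc Zs n s ^ (N / n) * Zs (N % n) s
        ≤ ENNReal.ofReal (b ^ (n * (N / n))) * ENNReal.ofReal (Zs (N % n) s).toReal := by
          rw [ENNReal.ofReal_toReal (hf _)]; gcongr
      _ = ENNReal.ofReal (((Zs (N % n) s).toReal / b ^ (N % n)) * b ^ N) := by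
          rw [← ENNReal.ofReal_mul (by positivity)]
          congr 1
          conv_rhs => rw [← hN, pow_add]
          rw [hN]
          field_simp
      _ ≤ _ := by
          apply ENNReal.ofReal_le_ofReal
          gcongr
          exact Finset.single_le_sum (f := fun r => (Zs r s).toReal / b ^ r)
            (fun r _ => by positivity) (Finset.mem_range.2 hr)

lemma tsum_snoc {n : ℕ} (f : (Fin (n + 1) → ℕ+) → ENNReal) :
    ∑' v, f v = ∑' (u : Fin n → ℕ+) (a : ℕ+), f (Fin.append u (fun _ => a)) := by
  rw [tsum_append]
  congr 1
  ext u
  rw [← (Equiv.funUnique (Fin 1) ℕ+).symm.tsum_eq]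
  rfl

lemma contQ_snoc {n : ℕ} (u : Fin n → ℕ+) (a : ℕ+) :
    contQ (extendTuple (Fin.append u (fun _ : Fin 1 => a))) n = contQ (extendTuple u) n ∧
    prevQ (extendTuple (Fin.append u (fun _ : Fin 1 => a))) n = prevQ (extendTuple u) n ∧
    contQ (extendTuple (Fin.append u (fun _ : Fin 1 => a))) (n + 1) =
      a * contQ (extendTuple u) n + prevQ (extendTuple u) n := by
  have h1 : contQ (extendTuple (Fin.append u (fun _ : Fin 1 => a))) n = contQ (extendTuple u) n :=
    contQ_congr n (fun i h1 h2 => extendTuple_append_left u _ i h1 h2)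
  have h2 : prevQ (extendTuple (Fin.append u (fun _ : Fin 1 => a))) n =
      prevQ (extendTuple u) n := by
    cases n with
    | zero => rfl
    | succ k => exact contQ_congr k (fun i h1 h2 => extendTuple_append_left u _ i h1 (by omega))
  refine ⟨h1, h2, ?_⟩
  rw [contQ_succ, h1, h2, extendTuple_append_right u _ 1 le_rfl le_rfl]
  simp [extendTuple]

lemma Y_le (n : ℕ) : ∑' v : Fin n → ℕ+, ENNReal.ofReal (1 / ((contQ (extendTuple v) n : ℝ) *
    ((contQ (extendTuple v) n : ℝ) + prevQ (extendTuple v) n))) ≤ 1 := by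
  induction n with
  | zero =>
    rw [tsum_eq_single default (fun b hb => (hb (Subsingleton.elim _ _)).elim)]
    simp [contQ, prevQ]
  | succ n ih =>
    rw [tsum_snoc]
    refine le_trans (ENNReal.tsum_le_tsum fun u => ?_) ih
    have hq := one_le_q u
    obtain ⟨q, hq'⟩ : ∃ q : ℝ, q = contQ (extendTuple u) n := ⟨_, rfl⟩
    obtain ⟨p, hp'⟩ : ∃ p : ℝ, p = prevQ (extendTuple u) n := ⟨_, rfl⟩
    have hp : 0 ≤ p := by rw [hp']; positivity
    simp only [(contQ_snoc u _).2.2, prevQ_succ, (contQ_snoc u _).1]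
    push_cast
    rw [← hq', ← hp']
    rw [← hq'] at hq
    rw [← Equiv.pnatEquivNat.symm.tsum_eq]
    refine ENNReal.tsum_le_of_sum_range_le fun N => ?_
    rw [← ENNReal.ofReal_sum_of_nonneg (fun i _ => by positivity)]
    apply ENNReal.ofReal_le_ofReal
    have : ∀ i : ℕ, (((Equiv.pnatEquivNat.symm i : ℕ+) : ℕ) : ℝ) = (i : ℝ) + 1 := by
      intro i; simp
    simp only [this]
    have tele : ∀ N : ℕ, ∑ i ∈ Finset.range N, 1 / ((((i : ℝ) + 1) * q + p) * (((i : ℝ) + 1) * q + p + q))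
        = 1 / (q * (q + p)) - 1 / (q * (((N : ℝ) + 1) * q + p)) := by
      intro N
      induction N with
      | zero => simp
      | succ N ih =>
        rw [Finset.sum_range_succ, ih]
        push_cast
        field_simp
        ring
    rw [tele]
    have : 0 ≤ 1 / (q * (((N : ℝ) + 1) * q + p)) := by positivity
    linarith

lemma Zs_one_le (n : ℕ) : Zs n 1 ≤ 2 := by
  have h : Zs n 1 ≤ 2 * ∑' v : Fin n → ℕ+, ENNReal.ofReal (1 / ((contQ (extendTuple v) n : ℝ) *
    ((contQ (extendTuple v) n : ℝ) + prevQ (extendTuple v) n))) := by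
    unfold Zs
    rw [← ENNReal.tsum_mul_left]
    refine ENNReal.tsum_le_tsum fun v => ?_
    rw [show (2 : ENNReal) = ENNReal.ofReal 2 by simp, ← ENNReal.ofReal_mul (by norm_num)]
    apply ENNReal.ofReal_le_ofReal
    have hq := one_le_q v
    have hp : (prevQ (extendTuple v) n : ℝ) ≤ contQ (extendTuple v) n := by
      exact_mod_cast prevQ_le (fun i _ => extendTuple_pos _ i) n
    have e : (contQ (extendTuple v) n : ℝ) ^ (-(2 * 1) : ℝ) = 1 / (contQ (extendTuple v) n : ℝ) ^ 2 := by
      rw [Real.rpow_neg (by positivity)]; norm_num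
    rw [e]
    have : (0 : ℝ) ≤ prevQ (extendTuple v) n := by positivity
    rw [mul_one_div, div_le_div_iff₀ (by positivity) (by positivity)]
    nlinarith
  refine h.trans ?_
  calc _ ≤ (2 : ENNReal) * 1 := by gcongr; exact Y_le n
    _ = 2 := by simp

lemma gFun_pos (d : ℕ) {s : ℝ} (h0 : 0 < s) (h1 : s ≤ 1) : 0 < gFun d s := by
  induction d with
  | zero => simpa [gFun]
  | succ d ih =>
    cases d with
    | zero => simpa [gFun]
    | succ n =>
      simp only [gFun]
      have : 0 ≤ 1 - s := by linarith
      positivity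

lemma gFun_zero (d : ℕ) : gFun d 0 = 0 := by
  match d with
  | 0 => simp [gFun]
  | 1 => simp [gFun]
  | n + 2 => simp [gFun]

lemma gFun_succ_inv {d : ℕ} (hd : 1 ≤ d) {s : ℝ} (h0 : 0 < s) (h1 : s ≤ 1) :
    1 / gFun (d + 1) s = (1 - s) / s * (1 / gFun d s) + ((d : ℝ) + 1) / s := by
  obtain ⟨n, rfl⟩ := Nat.exists_eq_add_of_le' hd
  have hg := gFun_pos (n + 1) h0 h1
  have : 0 ≤ 1 - s := by linarith
  simp only [gFun]
  push_cast
  field_simp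
  ring

lemma gFun_lt (d : ℕ) {s s' : ℝ} (h0 : 0 < s) (h : s < s') (h1 : s' ≤ 1) :
    gFun d s < gFun d s' := by
  have h0' : 0 < s' := h0.trans h
  have h1' : s ≤ 1 := by linarith
  match d with
  | 0 => simpa [gFun]
  | d + 1 =>
    induction d with
    | zero => simpa [gFun]
    | succ d ih =>
      have p1 := gFun_pos (d + 1) h0 h1'
      have p2 := gFun_pos (d + 1) h0' h1
      have q1 := gFun_pos (d + 1 + 1) h0 h1'
      have q2 := gFun_pos (d + 1 + 1) h0' h1
      rw [← one_div_lt_one_div q2 q1, gFun_succ_inv (by omega) h0 h1',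
        gFun_succ_inv (by omega) h0' h1]
      have a1 : 1 / gFun (d + 1) s' ≤ 1 / gFun (d + 1) s :=
        one_div_le_one_div_of_le p1 ih.le
      have a2 : (1 - s') / s' ≤ (1 - s) / s := by
        rw [div_le_div_iff₀ h0' h0]; nlinarith
      have a3 : (((d + 1 : ℕ) : ℝ) + 1) / s' < (((d + 1 : ℕ) : ℝ) + 1) / s :=
        div_lt_div_of_pos_left (by positivity) h0 h
      have a4 : (1 - s') / s' * (1 / gFun (d + 1) s') ≤ (1 - s) / s * (1 / gFun (d + 1) s) := by
        apply mul_le_mul a2 a1 (by positivity)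
        have : 0 ≤ 1 - s := by linarith
        positivity
      linarith

lemma exists_weights {d : ℕ} (hd : 1 ≤ d) {s : ℝ} (h0 : 0 < s) (h1 : s ≤ 1) :
    ∃ w : ℕ → ℝ, (∀ i, 0 ≤ w i) ∧
      (∀ y : ℕ → ℝ, ∑ i ∈ Finset.range d, w i * ((2 * s - 1) * ∑ j ∈ Finset.range i, y j + s * y i)
        = ∑ i ∈ Finset.range d, y i) ∧
      ∑ i ∈ Finset.range d, w i * ((i : ℝ) + 1) = 1 / gFun d s := by
  induction d, hd using Nat.le_induction with
  | base =>
    refine ⟨fun _ => 1 / s, fun _ => by positivity, fun y => ?_, ?_⟩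
    · simp; field_simp
    · simp [gFun]
  | succ d hd ih =>
    obtain ⟨w, hw, hy, hi⟩ := ih
    have hs : 0 ≤ 1 - s := by linarith
    refine ⟨fun i => if i < d then (1 - s) / s * w i else 1 / s, fun i => ?_, fun y => ?_, ?_⟩
    · have := hw i
      dsimp only
      split_ifs <;> positivity
    · rw [Finset.sum_range_succ, Finset.sum_congr rfl
        (g := fun i => (1 - s) / s * (w i * ((2 * s - 1) * ∑ j ∈ Finset.range i, y j + s * y i)))
        (fun i hi => by beta_reduce; rw [if_pos (Finset.mem_range.1 hi)]; ring),
        ← Finset.mul_sum, hy, Finset.sum_range_succ]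
      beta_reduce
      rw [if_neg (lt_irrefl _)]
      field_simp
      ring
    · rw [Finset.sum_range_succ, Finset.sum_congr rfl
        (g := fun i => (1 - s) / s * (w i * ((i : ℝ) + 1)))
        (fun i hi => by beta_reduce; rw [if_pos (Finset.mem_range.1 hi)]; ring),
        ← Finset.mul_sum, hi, gFun_succ_inv hd h0 h1]
      beta_reduce
      rw [if_neg (lt_irrefl _)]
      ring

lemma exists_large_index {d : ℕ} (hd : 1 ≤ d) {s : ℝ} (h0 : 0 < s) (h1 : s ≤ 1) (y : ℕ → ℝ) (L : ℝ)
    (hL : L ≤ ∑ i ∈ Finset.range d, y i) :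
    ∃ i, i < d ∧ ((i : ℝ) + 1) * gFun d s * L ≤ (2 * s - 1) * ∑ j ∈ Finset.range i, y j + s * y i := by
  obtain ⟨w, hw, hy, hi⟩ := exists_weights hd h0 h1
  by_contra! hcon
  have hg := gFun_pos d h0 h1
  have hwpos : ∃ i ∈ Finset.range d, 0 < w i := by
    by_contra! h
    have : ∑ i ∈ Finset.range d, w i * ((i : ℝ) + 1) ≤ 0 := by
      apply Finset.sum_nonpos
      intro i hi
      have := le_antisymm (h i hi) (hw i)
      simp [this]
    have h2 : 0 < 1 / gFun d s := by positivity
    linarith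
  have : ∑ i ∈ Finset.range d, w i * ((2 * s - 1) * ∑ j ∈ Finset.range i, y j + s * y i) <
      ∑ i ∈ Finset.range d, w i * (((i : ℝ) + 1) * gFun d s * L) := by
    apply Finset.sum_lt_sum
    · intro i hi
      exact mul_le_mul_of_nonneg_left (hcon i (Finset.mem_range.1 hi)).le (hw i)
    · obtain ⟨i, hi, hi'⟩ := hwpos
      exact ⟨i, hi, mul_lt_mul_of_pos_left (hcon i (Finset.mem_range.1 hi)) hi'⟩
  rw [hy] at this
  have e : ∑ i ∈ Finset.range d, w i * (((i : ℝ) + 1) * gFun d s * L) = L := by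
    rw [Finset.sum_congr rfl (g := fun i => (w i * ((i : ℝ) + 1)) * (gFun d s * L))
      (fun i _ => by ring), ← Finset.sum_mul, hi]
    field_simp
  linarith

lemma exists_t {d : ℕ} (hd : 1 ≤ d) {s : ℝ} (h0 : 0 < s) (h1 : s ≤ 1) :
    ∃ t : ℕ → ℝ, (∀ i, 0 < t i) ∧
      (∀ i : ℕ, (2 * s - 1) * ∑ j ∈ Finset.range i, t j + s * t i = ((i : ℝ) + 1) * gFun d s) ∧
      ∑ i ∈ Finset.range d, t i = 1 := by
  have hg := gFun_pos d h0 h1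
  have hs : 0 ≤ 1 - s := by linarith
  let t : ℕ → ℝ := fun i => Nat.rec (gFun d s / s) (fun _ x => (gFun d s + (1 - s) * x) / s) i
  have t0 : t 0 = gFun d s / s := rfl
  have ts : ∀ i, t (i + 1) = (gFun d s + (1 - s) * t i) / s := fun i => rfl
  have hpos : ∀ i, 0 < t i := by
    intro i
    induction i with
    | zero => rw [t0]; positivity
    | succ i ih => rw [ts]; positivity
  have hid : ∀ i : ℕ, (2 * s - 1) * ∑ j ∈ Finset.range i, t j + s * t i = ((i : ℝ) + 1) * gFun d s := by
    intro i
    induction i with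
    | zero => rw [t0]; simp; field_simp
    | succ i ih =>
      rw [Finset.sum_range_succ, ts]
      have : s * ((gFun d s + (1 - s) * t i) / s) = gFun d s + (1 - s) * t i := by field_simp
      rw [this]
      push_cast
      linarith
  refine ⟨t, hpos, hid, ?_⟩
  obtain ⟨w, hw, hy, hi⟩ := exists_weights hd h0 h1
  rw [← hy t]
  simp only [hid]
  rw [Finset.sum_congr rfl (g := fun i => (w i * ((i : ℝ) + 1)) * (gFun d s))
      (fun i _ => by ring), ← Finset.sum_mul, hi]
  field_simp

/-! ### the critical exponent -/

def critSet (d : ℕ) (B : ℝ) : Set ℝ :=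
  {s | 0 < s ∧ s ≤ 1 ∧ ∃ n : ℕ, 1 ≤ n ∧ Zs n s ≤ ENNReal.ofReal ((B ^ gFun d s) ^ n)}

noncomputable def critL (d : ℕ) (B : ℝ) : ℝ := sInf (critSet d B)

lemma one_mem_critSet (d : ℕ) {B : ℝ} (hB : 1 < B) : (1 : ℝ) ∈ critSet d B := by
  have hg := gFun_pos d zero_lt_one le_rfl
  have hb : 1 < B ^ gFun d 1 := Real.one_lt_rpow hB hg
  refine ⟨zero_lt_one, le_rfl, ?_⟩
  obtain ⟨n, hn⟩ := pow_unbounded_of_one_lt 2 hb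
  refine ⟨n, ?_, (Zs_one_le n).trans ?_⟩
  · by_contra h
    have : n = 0 := by omega
    subst this
    norm_num at hn
  · rw [show (2 : ENNReal) = ENNReal.ofReal 2 by simp]
    exact ENNReal.ofReal_le_ofReal hn.le

lemma critSet_bdd (d : ℕ) (B : ℝ) : BddBelow (critSet d B) := ⟨0, fun _ h => h.1.le⟩

lemma critL_nonneg (d : ℕ) (B : ℝ) : 0 ≤ critL d B := Real.sInf_nonneg fun _ h => h.1.le

lemma critL_le_one (d : ℕ) {B : ℝ} (hB : 1 < B) : critL d B ≤ 1 :=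
  csInf_le (critSet_bdd d B) (one_mem_critSet d hB)

/-- Above the critical exponent -/
lemma above_crit {d : ℕ} {B : ℝ} (hB : 1 < B) {s : ℝ} (hs : critL d B < s) :
    ∃ s₀, 0 < s₀ ∧ s₀ < s ∧ s₀ ≤ 1 ∧
      ∃ C : ℝ, 0 < C ∧ ∀ N, Zs N s₀ ≤ ENNReal.ofReal (C * (B ^ gFun d s₀) ^ N) := by
  obtain ⟨s₀, ⟨h1, h2, n, hn, h3⟩, h4⟩ := exists_lt_of_csInf_lt ⟨1, one_mem_critSet d hB⟩ hs
  refine ⟨s₀, h1, h4, h2, Zs_exp_bound hn h1.le (by positivity) h3⟩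

/-- Below the critical exponent -/
lemma below_crit {d : ℕ} {B : ℝ} (hB : 1 < B) {s : ℝ} (h0 : 0 < s) (hs : s < critL d B) (n : ℕ)
    (hn : 1 ≤ n) : ENNReal.ofReal ((B ^ gFun d s) ^ n) < Zs n s := by
  by_contra! h
  have := csInf_le (critSet_bdd d B) (show s ∈ critSet d B from
    ⟨h0, hs.le.trans (critL_le_one d hB), n, hn, h⟩)
  exact absurd hs (not_lt.2 this)

lemma lambda_sum_eq (d : ℕ) {B : ℝ} (hB : 1 < B) (n : ℕ) (s : ℝ) :
    (∑' v : Fin n → ℕ+,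
      ENNReal.ofReal ((contQ (extendTuple v) n : ℝ) ^ (-(2 * s)) * B ^ (-(gFun d s) * (n : ℝ)))) ≤ 1
    ↔ Zs n s ≤ ENNReal.ofReal ((B ^ gFun d s) ^ n) := by
  have hB0 : 0 < B := by linarith
  have hpos : 0 < (B ^ gFun d s) ^ n := by positivity
  have e : B ^ (-(gFun d s) * (n : ℝ)) = ((B ^ gFun d s) ^ n)⁻¹ := by
    rw [neg_mul, Real.rpow_neg hB0.le, Real.rpow_mul hB0.le, Real.rpow_natCast]
  simp only [e]
  have : ∀ v : Fin n → ℕ+, ENNReal.ofReal ((contQ (extendTuple v) n : ℝ) ^ (-(2 * s)) *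
      ((B ^ gFun d s) ^ n)⁻¹) = ENNReal.ofReal ((contQ (extendTuple v) n : ℝ) ^ (-(2 * s))) *
      (ENNReal.ofReal ((B ^ gFun d s) ^ n))⁻¹ := by
    intro v
    rw [ENNReal.ofReal_mul (by positivity), ENNReal.ofReal_inv_of_pos hpos]
  simp only [this]
  rw [ENNReal.tsum_mul_right, ← div_eq_mul_inv]
  change Zs n s / _ ≤ 1 ↔ _
  rw [ENNReal.div_le_iff (by simpa using hpos) ENNReal.ofReal_ne_top, one_mul]

lemma tendsto_lambda (d : ℕ) {B : ℝ} (hB : 1 < B) :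
    Tendsto (fun n => lambdaBn d B n) atTop (nhds (critL d B)) := by
  have hB0 : 0 < B := by linarith
  have hlow : ∀ n, 1 ≤ n → (∀ s, 0 ≤ s → Zs n s ≤ ENNReal.ofReal ((B ^ gFun d s) ^ n) →
      critL d B ≤ s) := by
    intro n hn s hs h
    by_contra! hlt
    rcases hs.eq_or_lt with rfl | hs
    · have := below_crit (d := d) hB (s := critL d B / 2) (by linarith) (by linarith) n hn
      have h2 := Zs_anti n (show (0 : ℝ) ≤ critL d B / 2 by linarith)
      have h3 : ENNReal.ofReal ((B ^ gFun d (critL d B / 2)) ^ n) < ENNReal.ofReal ((B ^ gFun d 0) ^ n) :=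
        this.trans_le (h2.trans h)
      rw [gFun_zero, Real.rpow_zero, one_pow, ENNReal.ofReal_lt_ofReal_iff zero_lt_one] at h3
      have hg := gFun_pos d (s := critL d B / 2) (by linarith) (by linarith [critL_le_one d hB])
      have : 1 ≤ (B ^ gFun d (critL d B / 2)) ^ n := one_le_pow₀ (Real.one_le_rpow hB.le hg.le)
      linarith
    · exact absurd h (not_le.2 (below_crit hB hs hlt n hn))
  have hone : ∀ᶠ n in atTop, Zs n 1 ≤ ENNReal.ofReal ((B ^ gFun d 1) ^ n) := by
    have hg := gFun_pos d zero_lt_one le_rfl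
    have hb : 1 < B ^ gFun d 1 := Real.one_lt_rpow hB hg
    filter_upwards [(tendsto_pow_atTop_atTop_of_one_lt hb).eventually_ge_atTop 2] with n hn
    refine (Zs_one_le n).trans ?_
    rw [show (2 : ENNReal) = ENNReal.ofReal 2 by simp]
    exact ENNReal.ofReal_le_ofReal hn
  rw [tendsto_order]
  constructor
  · intro b hb
    filter_upwards [eventually_ge_atTop 1, hone] with n hn h1
    refine hb.trans_le ?_
    unfold lambdaBn
    simp only [lambda_sum_eq d hB]
    exact le_csInf ⟨1, zero_le_one, h1⟩ fun s hs => hlow n hn s hs.1 hs.2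
  · intro b hb
    obtain ⟨s, hs1, hs2⟩ := exists_between hb
    have key : ∃ s', 0 ≤ s' ∧ s' < b ∧ ∀ᶠ n in atTop, Zs n s' ≤ ENNReal.ofReal ((B ^ gFun d s') ^ n) := by
      rcases le_or_gt 1 s with h | h
      · exact ⟨1, zero_le_one, by linarith, hone⟩
      · obtain ⟨s₀, a1, a2, a3, C, hC, hZ⟩ := above_crit hB hs1
        refine ⟨s, by linarith, hs2, ?_⟩
        have hlt : B ^ gFun d s₀ < B ^ gFun d s :=
          Real.rpow_lt_rpow_of_exponent_lt hB (gFun_lt d a1 a2 h.le)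
        have hp : 0 < B ^ gFun d s₀ := by positivity
        have hr : 1 < B ^ gFun d s / B ^ gFun d s₀ := by rwa [one_lt_div hp]
        filter_upwards [(tendsto_pow_atTop_atTop_of_one_lt hr).eventually_ge_atTop C] with n hn
        refine (Zs_anti n a2.le).trans ((hZ n).trans (ENNReal.ofReal_le_ofReal ?_))
        rwa [div_pow, le_div_iff₀ (by positivity)] at hn
    obtain ⟨s', k1, k2, k3⟩ := key
    filter_upwards [k3] with n hn
    refine lt_of_le_of_lt ?_ k2
    unfold lambdaBn
    simp only [lambda_sum_eq d hB]
    exact csInf_le ⟨0, fun _ h => h.1⟩ ⟨k1, hn⟩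

/-! ### Upper bound -/

noncomputable def wgt (s' β : ℝ) (N i l : ℕ) (v : Fin l → ℕ+) : ℝ :=
  (contQ (extendTuple v) l : ℝ) ^ (-(2 * s')) *
    ∏ j ∈ Finset.range i, (extendTuple v ((N + 1) * (j + 1)) : ℝ) ^ β

lemma wgt_nonneg (s' β : ℝ) (N i l : ℕ) (v : Fin l → ℕ+) : 0 ≤ wgt s' β N i l v := by
  unfold wgt; positivity

lemma q_append_rpow {n k : ℕ} (u : Fin n → ℕ+) (w : Fin k → ℕ+) {s' : ℝ} (hs : 0 ≤ s') :
    (contQ (extendTuple (Fin.append u w)) (n + k) : ℝ) ^ (-(2 * s')) ≤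
    (contQ (extendTuple u) n : ℝ) ^ (-(2 * s')) * (contQ (extendTuple w) k : ℝ) ^ (-(2 * s')) := by
  have h1 := one_le_q u
  have h2 := one_le_q w
  rw [← Real.mul_rpow (by positivity) (by positivity)]
  apply Real.rpow_le_rpow_of_nonpos (by positivity) _ (by linarith)
  exact_mod_cast contQ_append_ge u w

lemma block_sum_le {s' β : ℝ} (hs : 0 ≤ s') (N : ℕ) :
    ∑' w : Fin (N + 1) → ℕ+, ENNReal.ofReal ((contQ (extendTuple w) (N + 1) : ℝ) ^ (-(2 * s')) *
      (extendTuple w (N + 1) : ℝ) ^ β) ≤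
      Zs N s' * ∑' a : ℕ+, ENNReal.ofReal (((a : ℕ) : ℝ) ^ (-(2 * s') + β)) := by
  rw [tsum_snoc]
  unfold Zs
  rw [← ENNReal.tsum_mul_right]
  refine ENNReal.tsum_le_tsum fun u => ?_
  rw [← ENNReal.tsum_mul_left]
  refine ENNReal.tsum_le_tsum fun a => ?_
  rw [← ENNReal.ofReal_mul (by positivity)]
  apply ENNReal.ofReal_le_ofReal
  have ha : (0 : ℝ) < (a : ℕ) := by exact_mod_cast a.2
  rw [extendTuple_append_right u _ 1 le_rfl le_rfl, Real.rpow_add ha, ← mul_assoc]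
  have e : (extendTuple (fun _ : Fin 1 => a) 1 : ℝ) = (a : ℕ) := by simp [extendTuple]
  rw [e]
  gcongr
  refine (q_append_rpow u _ hs).trans_eq ?_
  have : (contQ (extendTuple (fun _ : Fin 1 => a)) 1 : ℝ) = (a : ℕ) := by simp [contQ, extendTuple]
  rw [this]

lemma wgt_append_le {s' β : ℝ} (hs : 0 ≤ s') (N i k : ℕ) (u : Fin ((N + 1) * i) → ℕ+)
    (w : Fin k → ℕ+) :
    wgt s' β N i _ (Fin.append u w) ≤
      wgt s' β N i _ u * (contQ (extendTuple w) k : ℝ) ^ (-(2 * s')) := by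
  unfold wgt
  have e : ∏ j ∈ Finset.range i, (extendTuple (Fin.append u w) ((N + 1) * (j + 1)) : ℝ) ^ β =
      ∏ j ∈ Finset.range i, (extendTuple u ((N + 1) * (j + 1)) : ℝ) ^ β := by
    refine Finset.prod_congr rfl fun j hj => ?_
    rw [extendTuple_append_left u w _ (Nat.mul_pos (by omega) (by omega))
      (Nat.mul_le_mul_left _ (Finset.mem_range.1 hj))]
  rw [e]
  have h0 : 0 ≤ ∏ j ∈ Finset.range i, (extendTuple u ((N + 1) * (j + 1)) : ℝ) ^ β := by positivity
  calc _ ≤ ((contQ (extendTuple u) _ : ℝ) ^ (-(2 * s')) * (contQ (extendTuple w) k : ℝ) ^ (-(2 * s'))) *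
        ∏ j ∈ Finset.range i, (extendTuple u ((N + 1) * (j + 1)) : ℝ) ^ β :=
        mul_le_mul_of_nonneg_right (q_append_rpow u w hs) h0
    _ = _ := by ring

lemma wsum_le {s' β : ℝ} (hs : 0 ≤ s') (N i : ℕ) :
    ∑' v : Fin ((N + 1) * i) → ℕ+, ENNReal.ofReal (wgt s' β N i _ v) ≤
      (Zs N s' * ∑' a : ℕ+, ENNReal.ofReal (((a : ℕ) : ℝ) ^ (-(2 * s') + β))) ^ i := by
  induction i with
  | zero =>
    have : IsEmpty (Fin ((N + 1) * 0)) := ⟨fun x => absurd x.2 (by simp)⟩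
    rw [tsum_eq_single default (fun b hb => (hb (Subsingleton.elim _ _)).elim)]
    simp [wgt, contQ]
  | succ i ih =>
    refine le_trans (le_of_eq (tsum_append (n := (N + 1) * i) (k := N + 1)
      (fun v => ENNReal.ofReal (wgt s' β N (i + 1) _ v)))) ?_
    rw [pow_succ]
    refine le_trans ?_ (mul_le_mul' ih (block_sum_le hs N))
    rw [← ENNReal.tsum_mul_right]
    refine ENNReal.tsum_le_tsum fun u => ?_
    rw [← ENNReal.tsum_mul_left]
    refine ENNReal.tsum_le_tsum fun w => ?_
    rw [← ENNReal.ofReal_mul (wgt_nonneg _ _ _ _ _ _)]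
    apply ENNReal.ofReal_le_ofReal
    have e : wgt s' β N (i + 1) _ (Fin.append u w) = wgt s' β N i _ (Fin.append u w) *
        (extendTuple w (N + 1) : ℝ) ^ β := by
      unfold wgt
      rw [Finset.prod_range_succ, ← mul_assoc, ← extendTuple_append_right u w (N + 1) (by omega) le_rfl]
      rfl
    rw [e, ← mul_assoc]
    have := wgt_append_le (β := β) hs N i (N + 1) u w
    gcongr

lemma wsum_le' {s' β : ℝ} (hs : 0 ≤ s') (N i : ℕ) :
    ∑' v : Fin ((N + 1) * i + N) → ℕ+, ENNReal.ofReal (wgt s' β N i _ v) ≤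
      (Zs N s' * ∑' a : ℕ+, ENNReal.ofReal (((a : ℕ) : ℝ) ^ (-(2 * s') + β))) ^ i * Zs N s' := by
  rw [tsum_append]
  refine le_trans ?_ (mul_le_mul' (wsum_le hs N i) le_rfl)
  rw [← ENNReal.tsum_mul_right]
  refine ENNReal.tsum_le_tsum fun u => ?_
  unfold Zs
  rw [← ENNReal.tsum_mul_left]
  refine ENNReal.tsum_le_tsum fun w => ?_
  rw [← ENNReal.ofReal_mul (wgt_nonneg _ _ _ _ _ _)]
  exact ENNReal.ofReal_le_ofReal (wgt_append_le hs N i N u w)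

/-- covering sets: irrational numbers with prescribed first `l` digits and the next one at least `M` -/
def covSet (l : ℕ) (v : Fin l → ℕ+) (M : ℝ) : Set ℝ :=
  {x | Irrational x ∧ 0 < x ∧ x < 1 ∧ (∀ k, 1 ≤ k → k ≤ l → pq k x = extendTuple v k) ∧
    M ≤ pq (l + 1) x}

lemma covSet_diam (l : ℕ) (v : Fin l → ℕ+) {M : ℝ} (hM : 0 < M) :
    Metric.ediam (covSet l v M) ≤
      ENNReal.ofReal (min 1 (1 / M) / (contQ (extendTuple v) l : ℝ) ^ 2) := by
  refine Metric.ediam_le fun x hx y hy => ?_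
  rw [edist_dist, Real.dist_eq]
  apply ENNReal.ofReal_le_ofReal
  have rep : ∀ x ∈ covSet l v M, ∃ t : ℝ, 0 ≤ t ∧ t ≤ min 1 (1 / M) ∧ x = psi (extendTuple v) l t := by
    rintro x ⟨h1, h2, h3, h4, h5⟩
    refine ⟨gaussMap^[l] x, (gaussIter_facts h1 h2 h3 l).2.1.le, ?_, ?_⟩
    · refine le_min (gaussIter_facts h1 h2 h3 l).2.2.le ?_
      rw [gaussIter_eq h1 h2 h3]
      have := (gaussIter_facts h1 h2 h3 (l + 1)).2.1
      apply one_div_le_one_div_of_le hM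
      linarith
    · rw [← psi_congr l h4]
      exact eq_psi h1 h2 h3 l
  obtain ⟨t, t0, t1, rfl⟩ := rep x hx
  obtain ⟨u, u0, u1, rfl⟩ := rep y hy
  refine (psi_sub_le (fun i _ => extendTuple_pos v i) l t0 u0).trans ?_
  gcongr
  rw [abs_le]; constructor <;> linarith

/-- threshold -/
noncomputable def thr (s G : ℝ) (N i l : ℕ) (v : Fin l → ℕ+) : ℝ :=
  Real.exp ((G - (2 * s - 1) * ∑ j ∈ Finset.range i,
    Real.log (extendTuple v ((N + 1) * (j + 1)))) / s)

lemma cov_cost {s s' : ℝ} (h0 : 0 < s) (hs' : 0 < s') (G : ℝ) (N i l : ℕ) (v : Fin l → ℕ+) :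
    Metric.ediam (covSet l v (thr s G N i l v)) ^ s' ≤
      ENNReal.ofReal (Real.exp (-(G * s' / s))) *
        ENNReal.ofReal (wgt s' ((2 * s - 1) * s' / s) N i l v) := by
  have hM : 0 < thr s G N i l v := Real.exp_pos _
  have hq := one_le_q v
  rw [← ENNReal.ofReal_mul (Real.exp_pos _).le]
  calc _ ≤ (ENNReal.ofReal (min 1 (1 / thr s G N i l v) / (contQ (extendTuple v) l : ℝ) ^ 2)) ^ s' := by
        gcongr; exact covSet_diam l v hM
    _ ≤ (ENNReal.ofReal ((1 / thr s G N i l v) / (contQ (extendTuple v) l : ℝ) ^ 2)) ^ s' := by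
        gcongr; exact min_le_right _ _
    _ = ENNReal.ofReal (((1 / thr s G N i l v) / (contQ (extendTuple v) l : ℝ) ^ 2) ^ s') := by
        rw [ENNReal.ofReal_rpow_of_nonneg (by positivity) hs'.le]
    _ = _ := by
        congr 1
        unfold wgt thr
        rw [Real.div_rpow (by positivity) (by positivity), Real.rpow_neg (by positivity),
          Real.rpow_mul (by positivity), Real.rpow_two, one_div, ← Real.exp_neg, ← Real.exp_mul]
        have e : ∏ j ∈ Finset.range i, (extendTuple v ((N + 1) * (j + 1)) : ℝ) ^ ((2 * s - 1) * s' / s)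
          = Real.exp (((2 * s - 1) * s' / s) * ∑ j ∈ Finset.range i,
            Real.log (extendTuple v ((N + 1) * (j + 1)))) := by
          rw [Finset.mul_sum, Real.exp_sum]
          refine Finset.prod_congr rfl fun j _ => ?_
          have : (0 : ℝ) < extendTuple v ((N + 1) * (j + 1)) := by
            exact_mod_cast extendTuple_pos v _
          rw [Real.rpow_def_of_pos this, mul_comm]
        rw [e, mul_comm (((contQ (extendTuple v) l : ℝ) ^ 2) ^ s')⁻¹, ← mul_assoc, ← Real.exp_add,
          div_eq_mul_inv]
        congr 2
        field_simp
        ring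

lemma zeta_ne_top {r : ℝ} (hr : r < -1) : ∑' a : ℕ+, ENNReal.ofReal (((a : ℕ) : ℝ) ^ r) ≠ ⊤ := by
  have h1 : Summable (fun n : ℕ => (n : ℝ) ^ r) := Real.summable_nat_rpow.2 hr
  have h2 : Summable (fun a : ℕ+ => ((a : ℕ) : ℝ) ^ r) := h1.comp_injective PNat.coe_injective
  rw [← ENNReal.ofReal_tsum_of_nonneg (fun a => by positivity) h2]
  exact ENNReal.ofReal_ne_top

lemma upper_aux {d : ℕ} (hd : 1 ≤ d) {Φ : ℕ → ℝ} (hΦ : ∀ n, 2 ≤ Φ n) {B : ℝ} (hB : 1 < B)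
    (hlim : Filter.liminf (fun n => Real.log (Φ n) / n) Filter.atTop = Real.log B)
    {s' : ℝ} (h1 : critL d B < s') (hs1 : s' ≤ 1) : dimH (Lambda d Φ) ≤ ENNReal.ofReal s' := by
  obtain ⟨s₀, a1, a2, a3, C, hC, hZ⟩ := above_crit hB h1
  obtain ⟨s, b1, b2⟩ := exists_between a2
  have hs0 : 0 < s := a1.trans b1
  have hs'0 : 0 < s' := hs0.trans b2
  have hs1' : s ≤ 1 := by linarith
  have hB0 : 0 < B := by linarith
  have hlB : 0 < Real.log B := Real.log_pos hB
  have hg0 := gFun_pos d a1 a3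
  have hg := gFun_pos d hs0 hs1'
  have hgg := gFun_lt d a1 b1 hs1'
  set g := gFun d s with hgdef
  set g₀ := gFun d s₀ with hg0def
  set β := (2 * s - 1) * s' / s with hβ
  have hβ' : -(2 * s') + β < -1 := by
    rw [hβ]
    have : (2 * s - 1) * s' / s = 2 * s' - s' / s := by field_simp
    rw [this]
    have : 1 < s' / s := by rwa [one_lt_div hs0]
    linarith
  obtain ⟨ζ, hζ⟩ : ∃ ζ : ℝ, ζ = (∑' a : ℕ+, ENNReal.ofReal (((a : ℕ) : ℝ) ^ (-(2 * s') + β))).toReal :=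
    ⟨_, rfl⟩
  have hζ' : ∑' a : ℕ+, ENNReal.ofReal (((a : ℕ) : ℝ) ^ (-(2 * s') + β)) = ENNReal.ofReal ζ := by
    rw [hζ, ENNReal.ofReal_toReal (zeta_ne_top hβ')]
  have hζ0 : 0 ≤ ζ := by rw [hζ]; positivity
  -- the growth rate
  set ℓ := g₀ / g * Real.log B with hℓ
  have hℓB : ℓ < Real.log B := by
    rw [hℓ]
    have : g₀ / g < 1 := by rwa [div_lt_one hg]
    nlinarith
  have hev : ∀ᶠ n : ℕ in atTop, ℓ < Real.log (Φ n) / n := by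
    apply eventually_lt_of_lt_liminf
    · rw [hlim]; exact hℓB
    · refine ⟨0, ?_⟩
      rw [eventually_map]
      refine Eventually.of_forall fun n => ?_
      have := Real.log_nonneg (show 1 ≤ Φ n by linarith [hΦ n])
      positivity
  set θ := Real.exp (g₀ * Real.log B * (1 - s' / s)) with hθ
  have hθ0 : 0 < θ := Real.exp_pos _
  have hθ1 : θ < 1 := by
    rw [hθ, Real.exp_lt_one_iff]
    have : 1 < s' / s := by rwa [one_lt_div hs0]
    have : 0 < g₀ * Real.log B := by positivity
    nlinarith
  -- one-level cost
  obtain ⟨K, hK0, hK⟩ : ∃ K : ℝ, 0 ≤ K ∧ ∀ i < d, (C * ζ) ^ i * C ≤ K := by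
    refine ⟨∑ i ∈ Finset.range d, (C * ζ) ^ i * C, Finset.sum_nonneg fun i _ => by positivity,
      fun i hi => ?_⟩
    exact Finset.single_le_sum (f := fun i => (C * ζ) ^ i * C) (fun i _ => by positivity)
      (Finset.mem_range.2 hi)
  have hlevel : ∀ N i : ℕ, i < d → ℓ < Real.log (Φ (N + 1)) / (N + 1 : ℕ) →
      ∑' v : Fin ((N + 1) * i + N) → ℕ+, Metric.ediam (covSet _ v
        (thr s (((i : ℝ) + 1) * g * Real.log (Φ (N + 1))) N i _ v)) ^ s' ≤
        ENNReal.ofReal (K * θ ^ N) := by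
    intro N i hi hΦN
    have hΦN' : ℓ * (N + 1) < Real.log (Φ (N + 1)) := by
      rw [lt_div_iff₀ (by positivity)] at hΦN
      exact_mod_cast hΦN
    refine (ENNReal.tsum_le_tsum fun v => cov_cost hs0 hs'0 _ N i _ v).trans ?_
    rw [ENNReal.tsum_mul_left]
    refine (mul_le_mul' le_rfl (wsum_le' hs'0.le N i)).trans ?_
    rw [← hβ, hζ']
    have hZN : Zs N s' ≤ ENNReal.ofReal (C * (B ^ g₀) ^ N) := (Zs_anti N a2.le).trans (hZ N)
    have hA : 0 ≤ C * (B ^ g₀) ^ N := by positivity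
    calc _ ≤ ENNReal.ofReal (Real.exp (-(((i : ℝ) + 1) * g * Real.log (Φ (N + 1)) * s' / s))) *
          ((ENNReal.ofReal (C * (B ^ g₀) ^ N) * ENNReal.ofReal ζ) ^ i * ENNReal.ofReal (C * (B ^ g₀) ^ N)) := by
          gcongr
      _ = ENNReal.ofReal (Real.exp (-(((i : ℝ) + 1) * g * Real.log (Φ (N + 1)) * s' / s)) *
          ((C * (B ^ g₀) ^ N * ζ) ^ i * (C * (B ^ g₀) ^ N))) := by
          rw [← ENNReal.ofReal_mul hA, ← ENNReal.ofReal_pow (by positivity),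
            ← ENNReal.ofReal_mul (by positivity), ← ENNReal.ofReal_mul (by positivity)]
      _ ≤ _ := by
          apply ENNReal.ofReal_le_ofReal
          have e1 : (C * (B ^ g₀) ^ N * ζ) ^ i * (C * (B ^ g₀) ^ N) =
              ((C * ζ) ^ i * C) * Real.exp (((i : ℝ) + 1) * (g₀ * Real.log B * N)) := by
            have : (B ^ g₀) ^ N = Real.exp (g₀ * Real.log B * N) := by
              rw [Real.rpow_def_of_pos hB0, ← Real.exp_nat_mul]; congr 1; ring
            rw [this]
            have e2 : Real.exp (((i : ℝ) + 1) * (g₀ * Real.log B * N)) =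
              Real.exp (g₀ * Real.log B * N) ^ i * Real.exp (g₀ * Real.log B * N) := by
              rw [← pow_succ, ← Real.exp_nat_mul]; push_cast; ring_nf
            rw [e2]; ring
          rw [e1]
          have hfin : Real.exp (-(((i : ℝ) + 1) * g * Real.log (Φ (N + 1)) * s' / s)) *
              Real.exp (((i : ℝ) + 1) * (g₀ * Real.log B * N)) ≤ θ ^ N := by
            rw [← Real.exp_add, hθ, ← Real.exp_nat_mul]
            apply Real.exp_le_exp.2
            have k1 : g * ℓ = g₀ * Real.log B := by rw [hℓ]; field_simp
            have k2 : g₀ * Real.log B * N ≤ g * Real.log (Φ (N + 1)) := by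
              rw [← k1]
              have : 0 < g * ℓ := by rw [k1]; positivity
              nlinarith
            have hrr : 1 < s' / s := by rwa [one_lt_div hs0]
            set ρ := s' / s
            have k3 : ((i : ℝ) + 1) * g * Real.log (Φ (N + 1)) * s' / s =
              ((i : ℝ) + 1) * (g * Real.log (Φ (N + 1)) * ρ) := by simp only [ρ]; ring
            rw [k3]
            set E := g₀ * Real.log B * (N : ℝ)
            have hE : 0 ≤ E := by positivity
            have k4 : E * ρ ≤ g * Real.log (Φ (N + 1)) * ρ := by gcongr
            have k5 : (N : ℝ) * (g₀ * Real.log B * (1 - ρ)) = E * (1 - ρ) := by simp only [E]; ring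
            rw [k5]
            have k6 : ((i : ℝ) + 1) * (E - g * Real.log (Φ (N + 1)) * ρ) ≤ ((i : ℝ) + 1) * (E - E * ρ) := by
              gcongr
            have k7 : 0 ≤ (i : ℝ) * (E * (ρ - 1)) := by
              have : 0 ≤ ρ - 1 := by linarith
              positivity
            nlinarith
          calc _ = ((C * ζ) ^ i * C) * (Real.exp (-(((i : ℝ) + 1) * g * Real.log (Φ (N + 1)) * s' / s)) *
              Real.exp (((i : ℝ) + 1) * (g₀ * Real.log B * N))) := by ring
            _ ≤ K * θ ^ N := by
              apply mul_le_mul (hK i hi) hfin (by positivity) hK0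
  -- assemble
  have hzero : μH[s'] (Lambda d Φ) = 0 := by
    let ι : ℕ → Type := fun N₀ => Σ p : ℕ × Fin d, (Fin ((N₀ + p.1 + 1) * (p.2 : ℕ) + (N₀ + p.1)) → ℕ+)
    let t : ∀ N₀ : ℕ, ι N₀ → Set ℝ := fun N₀ x => covSet _ x.2
      (thr s ((((x.1.2 : ℕ) : ℝ) + 1) * g * Real.log (Φ (N₀ + x.1.1 + 1))) (N₀ + x.1.1) x.1.2 _ x.2)
    have hle := Measure.hausdorffMeasure_le_liminf_tsum (β := ℕ) (ι := ι) s' (Lambda d Φ) (l := atTop)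
      (fun N => ENNReal.ofReal (1 / (N : ℝ)))
      (by
        rw [← ENNReal.ofReal_zero]
        exact ENNReal.tendsto_ofReal tendsto_one_div_atTop_nhds_zero_nat)
      t ?_ ?_
    · have htend : Tendsto (fun N₀ => ∑' x : ι N₀, Metric.ediam (t N₀ x) ^ s') atTop (nhds 0) := by
        have hub : Tendsto (fun N₀ : ℕ => ENNReal.ofReal (d * K / (1 - θ) * θ ^ N₀)) atTop (nhds 0) := by
          rw [← ENNReal.ofReal_zero]
          apply ENNReal.tendsto_ofReal
          simpa using (tendsto_pow_atTop_nhds_zero_of_lt_one hθ0.le hθ1).const_mul (d * K / (1 - θ))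
        refine tendsto_of_tendsto_of_tendsto_of_le_of_le' tendsto_const_nhds hub
          (Eventually.of_forall fun _ => bot_le) ?_
        obtain ⟨n₀, hn₀⟩ := eventually_atTop.1 hev
        filter_upwards [eventually_ge_atTop n₀] with N₀ hN₀
        refine le_trans (le_of_eq (ENNReal.tsum_sigma' _)) ?_
        refine (ENNReal.tsum_le_tsum fun p : ℕ × Fin d => hlevel (N₀ + p.1) p.2 p.2.2 (hn₀ _ (by omega))).trans ?_
        rw [ENNReal.tsum_prod (f := fun (a : ℕ) (_ : Fin d) => ENNReal.ofReal (K * θ ^ (N₀ + a)))]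
        simp only [tsum_fintype, Finset.sum_const, Finset.card_univ, Fintype.card_fin, nsmul_eq_mul]
        have hsum : HasSum (fun k : ℕ => (d : ℝ) * (K * θ ^ (N₀ + k))) (d * K / (1 - θ) * θ ^ N₀) := by
          have := (hasSum_geometric_of_lt_one hθ0.le hθ1).mul_left ((d : ℝ) * K * θ ^ N₀)
          have e1 : (fun k : ℕ => (d : ℝ) * (K * θ ^ (N₀ + k))) = fun i => (d : ℝ) * K * θ ^ N₀ * θ ^ i := by
            funext k; rw [pow_add]; ring
          have e2 : (d : ℝ) * K / (1 - θ) * θ ^ N₀ = d * K * θ ^ N₀ * (1 - θ)⁻¹ := by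
            rw [div_eq_mul_inv]; ring
          rw [e1, e2]
          exact this
        rw [← hsum.tsum_eq, ENNReal.ofReal_tsum_of_nonneg (fun k => by positivity) hsum.summable]
        refine ENNReal.tsum_le_tsum fun k => ?_
        rw [ENNReal.ofReal_mul (p := (d : ℝ)) (by positivity), ENNReal.ofReal_natCast]
      rw [htend.liminf_eq] at hle
      exact le_antisymm hle bot_le
    · filter_upwards [eventually_ge_atTop 1] with N₀ hN₀ x
      refine (covSet_diam _ _ (Real.exp_pos _)).trans (ENNReal.ofReal_le_ofReal ?_)
      have hq : (N₀ : ℝ) ≤ contQ (extendTuple x.2) ((N₀ + x.1.1 + 1) * (x.1.2 : ℕ) + (N₀ + x.1.1)) := by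
        have := le_contQ (fun i _ => extendTuple_pos x.2 i) ((N₀ + x.1.1 + 1) * (x.1.2 : ℕ) + (N₀ + x.1.1))
        have h2 : N₀ ≤ (N₀ + x.1.1 + 1) * (x.1.2 : ℕ) + (N₀ + x.1.1) := by
          have := Nat.zero_le ((N₀ + x.1.1 + 1) * (x.1.2 : ℕ)); omega
        exact_mod_cast h2.trans this
      have hN1 : (1 : ℝ) ≤ N₀ := by exact_mod_cast hN₀
      have : (N₀ : ℝ) ≤ (contQ (extendTuple x.2) ((N₀ + x.1.1 + 1) * (x.1.2 : ℕ) + (N₀ + x.1.1)) : ℝ) ^ 2 := by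
        nlinarith
      apply div_le_div₀ zero_le_one (min_le_left _ _) (by positivity) this
    · refine Eventually.of_forall fun N₀ x hx => ?_
      obtain ⟨⟨hx0, hx1⟩, hirr, hfreq⟩ := hx
      have hx0' : 0 < x := lt_of_le_of_ne hx0 (fun h => hirr ⟨0, by simp [h]⟩)
      obtain ⟨n, hn, hP⟩ := frequently_atTop.1 hfreq (N₀ + 1)
      obtain ⟨k, rfl⟩ := Nat.exists_eq_add_of_le hn
      have hpqpos : ∀ j, (0 : ℝ) < pq j x := fun j => by
        exact_mod_cast pq_pos hirr hx0' hx1 j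
      have hL : Real.log (Φ (N₀ + k + 1)) ≤
          ∑ i ∈ Finset.range d, Real.log (pq ((N₀ + k + 1) * (i + 1)) x) := by
        rw [← Real.log_prod (fun i _ => (hpqpos _).ne')]
        have e : N₀ + 1 + k = N₀ + k + 1 := by ring
        rw [e] at hP
        apply Real.log_le_log (by linarith [hΦ (N₀ + k + 1)])
        refine hP.trans_eq ?_
        rw [Finset.range_eq_Ico, Finset.prod_Ico_add' (fun i => (pq ((N₀ + k + 1) * i) x : ℝ)) 0 d 1]
        have : Finset.Ico (0 + 1) (d + 1) = Finset.Icc 1 d := by ext; simp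
        rw [this]
        exact Finset.prod_congr rfl fun i _ => by rw [mul_comm]
      obtain ⟨i, hi, hi2⟩ := exists_large_index hd hs0 hs1' _ _ hL
      rw [mem_iUnion]
      have hext : ∀ l j, 1 ≤ j → j ≤ l →
          extendTuple (fun r : Fin l => (⟨pq (r + 1) x, pq_pos hirr hx0' hx1 _⟩ : ℕ+)) j = pq j x := by
        intro l j h1 h2
        unfold extendTuple
        rw [dif_pos ⟨by omega, h1⟩]
        simp only [PNat.mk_coe]
        rw [Nat.sub_add_cancel h1]
      refine ⟨⟨(k, ⟨i, hi⟩), fun r => ⟨pq (r + 1) x, pq_pos hirr hx0' hx1 _⟩⟩, hirr, hx0', hx1,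
        fun j h1 h2 => (hext _ j h1 h2).symm, ?_⟩
      unfold thr
      have hidx : (N₀ + k + 1) * i + (N₀ + k) + 1 = (N₀ + k + 1) * (i + 1) := by ring
      dsimp only
      rw [hidx]
      rw [← Real.le_log_iff_exp_le (hpqpos _), div_le_iff₀ hs0]
      rw [Finset.sum_congr rfl (g := fun j => Real.log (pq ((N₀ + k + 1) * (j + 1)) x))]
      · linarith
      · intro j hj
        rw [hext _ _ (Nat.mul_pos (by omega) (by omega))]
        have : (N₀ + k + 1) * (j + 1) ≤ (N₀ + k + 1) * i := Nat.mul_le_mul_left _ (Finset.mem_range.1 hj)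
        omega
  have : ((s'.toNNReal : NNReal) : ℝ) = s' := Real.coe_toNNReal _ hs'0.le
  refine (dimH_le_of_hausdorffMeasure_ne_top (d := s'.toNNReal) ?_)
  rw [this, hzero]
  exact ENNReal.zero_ne_top

lemma upper_bound {d : ℕ} (hd : 1 ≤ d) {Φ : ℕ → ℝ} (hΦ : ∀ n, 2 ≤ Φ n) {B : ℝ} (hB : 1 < B)
    (hlim : Filter.liminf (fun n => Real.log (Φ n) / n) Filter.atTop = Real.log B) :
    dimH (Lambda d Φ) ≤ ENNReal.ofReal (critL d B) := by
  rcases (critL_le_one d hB).eq_or_lt with h | h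
  · rw [h, ENNReal.ofReal_one]
    calc dimH (Lambda d Φ) ≤ dimH (Set.univ : Set ℝ) := dimH_mono (subset_univ _)
      _ = 1 := by rw [Real.dimH_univ]
  · have h2 : Tendsto (fun s => ENNReal.ofReal s) (nhdsWithin (critL d B) (Ioi (critL d B)))
        (nhds (ENNReal.ofReal (critL d B))) :=
      (ENNReal.continuous_ofReal.tendsto _).mono_left nhdsWithin_le_nhds
    refine ge_of_tendsto h2 ?_
    filter_upwards [Ioo_mem_nhdsGT h] with s hs
    exact upper_aux hd hΦ hB hlim hs.1 hs.2.le

lemma mass_dist {Ω : Type*} [MeasurableSpace Ω] (P : Measure Ω) (hP : P univ = 1) (X : Ω → ℝ)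
    {s : ℝ} (hs : 0 ≤ s) {C : ℝ} (hC : 0 ≤ C)
    (h : ∀ U : Set ℝ, Metric.ediam U ≤ 1 → P (X ⁻¹' U) ≤ ENNReal.ofReal C * Metric.ediam U ^ s) :
    ENNReal.ofReal s ≤ dimH (range X) := by
  apply le_dimH_of_hausdorffMeasure_ne_zero (d := s.toNNReal)
  rw [Real.coe_toNNReal s hs]
  intro h0
  rw [Measure.hausdorffMeasure_apply] at h0
  have h1 := le_iSup₂ (f := fun (r : ENNReal) (_ : 0 < r) =>
        ⨅ (t : ℕ → Set ℝ) (_ : range X ⊆ ⋃ n, t n) (_ : ∀ n, Metric.ediam (t n) ≤ r),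
          ∑' n, ⨆ _ : (t n).Nonempty, Metric.ediam (t n) ^ s) (1 : ENNReal) one_pos
  rw [h0] at h1
  have h2 := lt_of_le_of_lt h1 (show (0 : ENNReal) < ENNReal.ofReal (1 / (C + 1)) by
    rw [ENNReal.ofReal_pos]; positivity)
  simp only [iInf_lt_iff] at h2
  obtain ⟨t, ht, hd, hlt⟩ := h2
  have h3 : (1 : ENNReal) ≤ ENNReal.ofReal C * ∑' n, ⨆ _ : (t n).Nonempty, Metric.ediam (t n) ^ s := by
    rw [← hP, ← ENNReal.tsum_mul_left]
    calc P univ ≤ P (⋃ n, X ⁻¹' (t n)) := by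
          apply measure_mono
          intro ω _
          have := ht (mem_range_self ω)
          simpa using this
      _ ≤ ∑' n, P (X ⁻¹' (t n)) := measure_iUnion_le _
      _ ≤ _ := by
          refine ENNReal.tsum_le_tsum fun n => ?_
          rcases (t n).eq_empty_or_nonempty with he | hne
          · simp [he]
          · simpa [hne] using h (t n) (hd n)
  have h4 : (1 : ENNReal) ≤ ENNReal.ofReal C * ENNReal.ofReal (1 / (C + 1)) :=
    h3.trans (by gcongr)
  rw [← ENNReal.ofReal_mul hC, ENNReal.one_le_ofReal, mul_one_div, le_div_iff₀ (by positivity)] at h4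
  linarith

lemma exists_prod {W : Type} [DecidableEq W] (A : ℕ → Finset W) (p : ℕ → W → ℝ)
    (hp : ∀ j v, v ∈ A j → 0 ≤ p j v) (hsum : ∀ j, ∑ v ∈ A j, p j v = 1) :
    ∃ (_ : MeasurableSpace (∀ j, A j)) (P : Measure (∀ j, A j)), P univ = 1 ∧
      ∀ (k : ℕ) (ω : ∀ j, A j) (T : Finset W), T ⊆ A k →
        P {ω' | (∀ i < k, ω' i = ω i) ∧ (ω' k).1 ∈ T} ≤
          ENNReal.ofReal ((∏ i ∈ Finset.range k, p i (ω i).1) * ∑ v ∈ T, p k v) := by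
  let _ : ∀ j, MeasurableSpace (A j) := fun _ => ⊤
  let μ : ∀ j, Measure (A j) := fun j => ∑ v : A j, ENNReal.ofReal (p j v.1) • Measure.dirac v
  have hμ : ∀ j (S : Finset W), S ⊆ A j → μ j {x | x.1 ∈ S} = ENNReal.ofReal (∑ v ∈ S, p j v) := by
    intro j S hS
    simp only [μ, Measure.coe_finsetSum, Finset.sum_apply, Measure.smul_apply, smul_eq_mul]
    rw [ENNReal.ofReal_sum_of_nonneg (fun v hv => hp j v (hS hv))]
    have : ∀ v : A j, ENNReal.ofReal (p j v.1) * (Measure.dirac v) {x : A j | x.1 ∈ S} =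
        (fun w => if w ∈ S then ENNReal.ofReal (p j w) else 0) v.1 := by
      intro v
      rw [Measure.dirac_apply' _ MeasurableSpace.measurableSet_top]
      by_cases h : v.1 ∈ S <;> simp [h, Set.indicator]
    rw [Finset.sum_congr rfl (fun v _ => this v),
      Finset.sum_coe_sort (A j) (fun w => if w ∈ S then ENNReal.ofReal (p j w) else 0),
      Finset.sum_ite_mem, Finset.inter_eq_right.2 hS]
  have hprob : ∀ j, IsProbabilityMeasure (μ j) := by
    intro j
    constructor
    have := hμ j (A j) (Finset.Subset.refl _)
    rw [hsum j, ENNReal.ofReal_one] at this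
    rw [← this]
    congr 1
    ext x
    simp
  refine ⟨inferInstance, Measure.infinitePi μ, measure_univ, ?_⟩
  intro k ω T hT
  let t : ∀ i, Set (A i) := fun i => {x | x.1 ∈ (if i < k then {(ω i).1} else if i = k then T else A i)}
  have hsub : {ω' : ∀ j, A j | (∀ i < k, ω' i = ω i) ∧ (ω' k).1 ∈ T} ⊆
      Set.pi (Finset.range (k + 1) : Set ℕ) t := by
    rintro ω' ⟨h1, h2⟩ i hi
    simp only [Finset.coe_range, mem_Iio] at hi
    simp only [t, mem_ofPred_eq]
    by_cases hik : i < k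
    · simp [hik, h1 i hik]
    · have : i = k := by omega
      subst this
      simpa using h2
  refine (measure_mono hsub).trans ?_
  rw [Measure.infinitePi_pi μ (fun i _ => MeasurableSpace.measurableSet_top), Finset.prod_range_succ]
  have e1 : ∀ i ∈ Finset.range k, μ i (t i) = ENNReal.ofReal (p i (ω i).1) := by
    intro i hi
    have hik : i < k := Finset.mem_range.1 hi
    have := hμ i {(ω i).1} (by simp)
    simpa [t, hik] using this
  have e2 : μ k (t k) = ENNReal.ofReal (∑ v ∈ T, p k v) := by
    simpa [t] using hμ k T hT
  rw [Finset.prod_congr rfl e1, e2, ENNReal.ofReal_mul (Finset.prod_nonneg fun i _ => hp i _ (ω i).2),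
    ENNReal.ofReal_prod_of_nonneg (fun i _ => hp i _ (ω i).2)]

lemma xval_ge {a : ℕ → ℕ} (ha : ∀ i, 1 ≤ i → 1 ≤ a i) {M : ℕ} (h : a 1 ≤ M) :
    1 / ((M : ℝ) + 1) ≤ xval a := by
  rw [xval_left ha]
  have h1 := xval_pos (shift_pos ha)
  have h2 := xval_lt (shift_pos ha)
  have h3 : (1 : ℝ) ≤ a 1 := by exact_mod_cast ha 1 le_rfl
  have h4 : (a 1 : ℝ) ≤ M := by exact_mod_cast h
  apply one_div_le_one_div_of_le (by linarith) (by linarith)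

lemma xval_le_half {a : ℕ → ℕ} (ha : ∀ i, 1 ≤ i → 1 ≤ a i) (h : 2 ≤ a 1) :
    xval a ≤ 1 / 2 := by
  rw [xval_left ha]
  have h1 := xval_pos (shift_pos ha)
  have h4 : (2 : ℝ) ≤ a 1 := by exact_mod_cast h
  apply one_div_le_one_div_of_le (by norm_num) (by linarith)

lemma xval_sep {a b : ℕ → ℕ} (ha : ∀ i, 1 ≤ i → 1 ≤ a i) (hb : ∀ i, 1 ≤ i → 1 ≤ b i)
    {M : ℕ} (hM : 1 ≤ M) (n : ℕ) (hag : ∀ i, 1 ≤ i → i ≤ n → a i = b i) (hlt : a (n + 1) < b (n + 1))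
    (hnext : (a (n + 2) ≤ M ∧ b (n + 2) ≤ M) ∨ (2 ≤ a (n + 2) ∧ 2 ≤ b (n + 2))) :
    ((b (n + 1) : ℝ) - a (n + 1)) /
      (4 * ((M : ℝ) + 1) * ((b (n + 1) : ℝ) + 1) ^ 2 * (contQ a n : ℝ) ^ 2) ≤ |xval a - xval b| := by
  have hM' : (1 : ℝ) ≤ M := by exact_mod_cast hM
  set a1 : ℕ → ℕ := fun i => a (i + n) with ha1
  set b1 : ℕ → ℕ := fun i => b (i + n) with hb1
  have pa1 : ∀ i, 1 ≤ i → 1 ≤ a1 i := fun i hi => ha _ (by omega)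
  have pb1 : ∀ i, 1 ≤ i → 1 ≤ b1 i := fun i hi => hb _ (by omega)
  rw [xval_eq_psi ha n, xval_eq_psi hb n, ← psi_congr n hag]
  refine le_trans ?_ (le_psi_sub ha n (xval_pos pa1).le (xval_pos pb1).le (xval_lt pa1).le (xval_lt pb1).le)
  have hu0 := xval_pos (shift_pos pa1)
  have hv0 := xval_pos (shift_pos pb1)
  have hu1 := xval_lt (shift_pos pa1)
  have hv1 := xval_lt (shift_pos pb1)
  have hq : (1 : ℝ) ≤ contQ a n := by exact_mod_cast contQ_pos ha n
  have ea : a1 1 = a (n + 1) := by simp only [ha1]; congr 1; omega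
  have eb : b1 1 = b (n + 1) := by simp only [hb1]; congr 1; omega
  have ea2 : a1 (1 + 1) = a (n + 2) := by simp only [ha1]; congr 1; omega
  have eb2 : b1 (1 + 1) = b (n + 2) := by simp only [hb1]; congr 1; omega
  have hA : (1 : ℝ) ≤ a (n + 1) := by exact_mod_cast ha _ (by omega)
  have hAB : (a (n + 1) : ℝ) + 1 ≤ b (n + 1) := by exact_mod_cast hlt
  have hdiff : ((b (n + 1) : ℝ) - a (n + 1)) / (M + 1) ≤
      (b (n + 1) : ℝ) + xval (fun i => b1 (i + 1)) - (a (n + 1) + xval (fun i => a1 (i + 1))) := by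
    rw [div_le_iff₀ (by linarith)]
    rcases hnext with ⟨h1, h2⟩ | ⟨h1, h2⟩
    · have := xval_ge (shift_pos pb1) (M := M) (by rw [eb2]; exact h2)
      rw [div_le_iff₀ (by linarith)] at this
      nlinarith
    · have := xval_le_half (shift_pos pa1) (by rw [ea2]; exact h1)
      nlinarith
  rw [xval_left pa1, xval_left pb1, ea, eb]
  set u := xval (fun i => a1 (i + 1))
  set v := xval (fun i => b1 (i + 1))
  set α : ℝ := (a (n + 1) : ℝ)
  set β : ℝ := (b (n + 1) : ℝ)
  have e : 1 / (α + u) - 1 / (β + v) = (β + v - (α + u)) / ((α + u) * (β + v)) := by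
    have z1 : α + u ≠ 0 := by linarith
    have z2 : β + v ≠ 0 := by linarith
    rw [div_sub_div _ _ z1 z2]; ring
  have hnum : 0 ≤ (β - α) / ((M : ℝ) + 1) := by
    apply div_nonneg <;> linarith
  rw [e, abs_of_nonneg (div_nonneg (hnum.trans hdiff) (by nlinarith [mul_pos (show 0 < α + u by linarith) (show 0 < β + v by linarith)]))]
  have h5 : (α + u) * (β + v) ≤ (β + 1) ^ 2 := by
    rw [sq]; apply mul_le_mul <;> linarith
  have h6 : (β - α) / (M + 1) / (β + 1) ^ 2 ≤ (β + v - (α + u)) / ((α + u) * (β + v)) := by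
    apply div_le_div₀ (hnum.trans hdiff) hdiff
    · exact mul_pos (by linarith) (by linarith)
    · exact h5
  have h7 : (β - α) / (4 * ((M : ℝ) + 1) * (β + 1) ^ 2 * (contQ a n : ℝ) ^ 2) =
      (β - α) / (M + 1) / (β + 1) ^ 2 / (4 * (contQ a n : ℝ) ^ 2) := by
    have : β + 1 ≠ 0 := by linarith
    field_simp
  rw [h7]
  gcongr

/-- Digit sequence obtained by concatenating words of length `m`. -/
def dig {m : ℕ} (hm : 0 < m) (w : ℕ → Fin m → ℕ+) (i : ℕ) : ℕ :=
  (w ((i - 1) / m) ⟨(i - 1) % m, Nat.mod_lt _ hm⟩ : ℕ)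

lemma dig_pos {m : ℕ} (hm : 0 < m) (w : ℕ → Fin m → ℕ+) (i : ℕ) : 1 ≤ dig hm w i :=
  (w ((i - 1) / m) ⟨(i - 1) % m, Nat.mod_lt _ hm⟩).2

lemma dig_apply {m : ℕ} (hm : 0 < m) (w : ℕ → Fin m → ℕ+) (j : ℕ) (r : Fin m) :
    dig hm w (m * j + r + 1) = w j r := by
  unfold dig
  have h1 : (m * j + r + 1 - 1) / m = j := by
    rw [Nat.add_sub_cancel, Nat.mul_add_div hm, Nat.div_eq_of_lt r.2, Nat.add_zero]
  have h2 : (m * j + r + 1 - 1) % m = r := by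
    rw [Nat.add_sub_cancel, Nat.mul_add_mod, Nat.mod_eq_of_lt r.2]
  have : ∀ (j' r' : ℕ) (hr' : r' < m), j' = j → r' = r → ((w j' ⟨r', hr'⟩ : ℕ+) : ℕ) = w j r := by
    rintro j' r' hr' rfl h; congr 2; exact Fin.ext h
  exact this _ _ _ h1 h2

lemma dig_block {m : ℕ} (hm : 0 < m) (w : ℕ → Fin m → ℕ+) (j : ℕ) :
    contQ (fun i => dig hm w (m * j + i)) m = contQ (extendTuple (w j)) m := by
  apply contQ_congr
  intro i hi1 hi2
  have h : i - 1 < m ∧ 1 ≤ i := by omega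
  have := dig_apply hm w j ⟨i - 1, h.1⟩
  simp only [extendTuple, h, and_self, dite_true]
  rw [← this]
  congr 1
  simp only
  omega

lemma cyl_bound {m : ℕ} (hm : 0 < m) {s : ℝ} (hs : 0 < s) (w : ℕ → Fin m → ℕ+) (p f : ℕ → ℝ)
    (hp : ∀ j, 0 ≤ p j) (hf0 : ∀ j, 0 ≤ f j)
    (hf : ∀ j, p j ≤ f j * (2 * (contQ (extendTuple (w j)) m : ℝ)) ^ (-(2 * s))) (k : ℕ) :
    ∏ i ∈ Finset.range k, p i ≤
      (∏ i ∈ Finset.range k, f i) * (contQ (dig hm w) (m * k) : ℝ) ^ (-(2 * s)) := by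
  induction k with
  | zero => simp [contQ]
  | succ k ih =>
    rw [Finset.prod_range_succ, Finset.prod_range_succ]
    have h1 := contQ_add_le (a := dig hm w) (fun i _ => dig_pos hm w i) (m * k) m
    rw [dig_block] at h1
    have h1' : (contQ (dig hm w) (m * (k + 1)) : ℝ) ≤
        contQ (dig hm w) (m * k) * (2 * (contQ (extendTuple (w k)) m : ℝ)) := by
      have : (contQ (dig hm w) (m * (k + 1)) : ℝ) ≤
        ((2 * (contQ (dig hm w) (m * k) * contQ (extendTuple (w k)) m) : ℕ) : ℝ) := by
        exact_mod_cast h1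
      push_cast at this
      linarith
    have q1 : (1 : ℝ) ≤ contQ (dig hm w) (m * k) := by
      exact_mod_cast contQ_pos (fun i _ => dig_pos hm w i) _
    have q2 : (1 : ℝ) ≤ contQ (dig hm w) (m * (k + 1)) := by
      exact_mod_cast contQ_pos (fun i _ => dig_pos hm w i) _
    have q3 : (1 : ℝ) ≤ contQ (extendTuple (w k)) m := by
      exact_mod_cast contQ_pos (fun i _ => extendTuple_pos _ i) _
    have h2 := Real.rpow_le_rpow_of_nonpos (by linarith) h1' (show -(2 * s) ≤ 0 by linarith)
    rw [Real.mul_rpow (by linarith) (by linarith)] at h2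
    have hF : 0 ≤ (∏ i ∈ Finset.range k, f i) := Finset.prod_nonneg fun i _ => hf0 i
    calc _ ≤ ((∏ i ∈ Finset.range k, f i) * (contQ (dig hm w) (m * k) : ℝ) ^ (-(2 * s))) *
          (f k * (2 * (contQ (extendTuple (w k)) m : ℝ)) ^ (-(2 * s))) := by
          apply mul_le_mul ih (hf k) (hp k)
          positivity
      _ = ((∏ i ∈ Finset.range k, f i) * f k) * ((contQ (dig hm w) (m * k) : ℝ) ^ (-(2 * s)) *
          (2 * (contQ (extendTuple (w k)) m : ℝ)) ^ (-(2 * s))) := by ring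
      _ ≤ _ := by
          apply mul_le_mul_of_nonneg_left h2
          exact mul_nonneg hF (hf0 k)

lemma q_grow {a : ℕ → ℕ} (ha : ∀ i, 1 ≤ i → 1 ≤ a i) {M : ℕ} (n l : ℕ)
    (h : ∀ i, n < i → i ≤ n + l → a i ≤ M) : contQ a (n + l) ≤ (M + 1) ^ l * contQ a n := by
  induction l with
  | zero => simp
  | succ l ih =>
    have h1 := contQ_succ_le ha (n + l)
    have h2 := ih (fun i hi hi2 => h i hi (by omega))
    have h3 := h (n + l + 1) (by omega) (by omega)
    calc contQ a (n + (l + 1)) ≤ (a (n + l + 1) + 1) * contQ a (n + l) := h1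
      _ ≤ (M + 1) * ((M + 1) ^ l * contQ a n) := Nat.mul_le_mul (by omega) h2
      _ = _ := by ring

lemma final_est {s M q D c E C K δ : ℝ} (hs0 : 0 < s) (hs1 : s < 1) (hM : 1 ≤ M) (hq : 1 ≤ q)
    (hD : 1 ≤ D) (hc : 1 ≤ c) (hEC : E * c ^ s ≤ C) (hDc : D ≤ 2 * M * c)
    (hC : 0 ≤ C) (hK : 0 < K) (hδ : D / (K * c ^ 2 * q ^ 2) ≤ δ) :
    E * q ^ (-(2 * s)) * (2 * D / c) ≤ 4 * M * C * (K / (2 * M)) ^ s * δ ^ s := by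
  have hc0 : 0 < c := by linarith
  have hq0 : 0 < q := by linarith
  have hM0 : 0 < M := by linarith
  have hD0 : 0 < D := by linarith
  have hδ0 : 0 ≤ δ := le_trans (by positivity) hδ
  have hcs : 0 < c ^ s := Real.rpow_pos_of_pos hc0 s
  have h1 : E ≤ C * (c ^ s)⁻¹ := by
    rw [← div_eq_mul_inv, le_div_iff₀ hcs]; exact hEC
  have hy0 : 0 < D / (2 * M * c) := by positivity
  have hy1 : D / (2 * M * c) ≤ 1 := by rw [div_le_one (by positivity)]; exact hDc
  have hy : D / (2 * M * c) ≤ (D / (2 * M * c)) ^ s := by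
    calc _ = (D / (2 * M * c)) ^ (1 : ℝ) := (Real.rpow_one _).symm
      _ ≤ _ := Real.rpow_le_rpow_of_exponent_ge hy0 hy1 hs1.le
  have h2 : 2 * D / c ≤ 4 * M * (D / (2 * M * c)) ^ s := by
    calc 2 * D / c = 4 * M * (D / (2 * M * c)) := by field_simp; ring
      _ ≤ _ := by gcongr
  have hqs : q ^ (-(2 * s)) = ((q ^ 2)⁻¹) ^ s := by
    rw [Real.rpow_neg hq0.le, Real.rpow_mul hq0.le, Real.inv_rpow (by positivity)]
    norm_num
  have hci : (c ^ s)⁻¹ = (c⁻¹) ^ s := (Real.inv_rpow hc0.le s).symm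
  calc E * q ^ (-(2 * s)) * (2 * D / c)
      ≤ (C * (c ^ s)⁻¹) * q ^ (-(2 * s)) * (4 * M * (D / (2 * M * c)) ^ s) := by
        apply mul_le_mul _ h2 (by positivity) (by positivity)
        gcongr
    _ = 4 * M * C * ((c⁻¹) ^ s * ((q ^ 2)⁻¹) ^ s * (D / (2 * M * c)) ^ s) := by
        rw [hqs, hci]; ring
    _ = 4 * M * C * (c⁻¹ * (q ^ 2)⁻¹ * (D / (2 * M * c))) ^ s := by
        rw [Real.mul_rpow (by positivity) (by positivity), Real.mul_rpow (by positivity) (by positivity)]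
    _ ≤ 4 * M * C * (K / (2 * M) * δ) ^ s := by
        apply mul_le_mul_of_nonneg_left _ (by positivity)
        apply Real.rpow_le_rpow (by positivity) _ hs0.le
        calc c⁻¹ * (q ^ 2)⁻¹ * (D / (2 * M * c)) = K / (2 * M) * (D / (K * c ^ 2 * q ^ 2)) := by
              field_simp
          _ ≤ _ := by gcongr
    _ = _ := by rw [Real.mul_rpow (by positivity) hδ0]; ring

/-- Either a normal block (bounded digits) or a special block (one large digit). -/
def BlockOK (m M : ℕ) (A : Finset (Fin m → ℕ+)) (p : (Fin m → ℕ+) → ℝ) (c : ℕ) : Prop :=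
  (c = 1 ∧ ∀ v ∈ A, ∀ r, (v r : ℕ) ≤ M) ∨
  (2 ≤ c ∧ ∃ r₀ : Fin m, ∀ v ∈ A, c ≤ (v r₀ : ℕ) ∧ (v r₀ : ℕ) < 2 * c ∧ (∀ r, r ≠ r₀ → (v r : ℕ) = 1) ∧
    p v = 1 / (c : ℝ))

lemma next_ok {m M : ℕ} (hM : 1 ≤ M) {A : Finset (Fin m → ℕ+)} {p : (Fin m → ℕ+) → ℝ} {c : ℕ}
    (h : BlockOK m M A p c) {v v' : Fin m → ℕ+} (hv : v ∈ A) (hv' : v' ∈ A) (r : Fin m) :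
    ((v r : ℕ) ≤ M ∧ (v' r : ℕ) ≤ M) ∨ (2 ≤ (v r : ℕ) ∧ 2 ≤ (v' r : ℕ)) := by
  rcases h with ⟨_, h⟩ | ⟨hc, r₀, h⟩
  · exact Or.inl ⟨h v hv r, h v' hv' r⟩
  · by_cases hr : r = r₀
    · subst hr
      have h1 := (h v hv).1
      have h2 := (h v' hv').1
      exact Or.inr ⟨by omega, by omega⟩
    · have h1 := (h v hv).2.2.1 r hr
      have h2 := (h v' hv').2.2.1 r hr
      exact Or.inl ⟨by omega, by omega⟩

lemma split_ok {m M : ℕ} (hM : 1 ≤ M) {A : Finset (Fin m → ℕ+)} {p : (Fin m → ℕ+) → ℝ} {c : ℕ}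
    (h : BlockOK m M A p c) (hsum : ∑ v ∈ A, p v = 1) (S : Set (Fin m → ℕ+)) (hS : S ⊆ A) (r : Fin m)
    (hne : ∃ v ∈ S, ∃ v' ∈ S, v r ≠ v' r) :
    ∃ v ∈ S, ∃ v' ∈ S, ∃ T : Finset (Fin m → ℕ+), T ⊆ A ∧ S ⊆ T ∧ (v r : ℕ) < v' r ∧
      ∑ v ∈ T, p v ≤ 2 * ((v' r : ℕ) - (v r : ℕ) : ℝ) / c ∧ (v' r : ℕ) ≤ 2 * M * c ∧
      ∀ v ∈ S, ∀ i : Fin m, i < r → (v i : ℕ) ≤ M := by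
  classical
  rcases h with ⟨hc, h⟩ | ⟨hc, r₀, h⟩
  · obtain ⟨v, hv, v', hv', hvv⟩ := hne
    have hvv' : (v r : ℕ) ≠ v' r := fun h => hvv (PNat.coe_injective h)
    wlog hlt : (v r : ℕ) < v' r generalizing v v'
    · exact this v' hv' v hv hvv.symm hvv'.symm (by omega)
    refine ⟨v, hv, v', hv', A, Finset.Subset.refl _, hS, hlt, ?_, ?_, fun u hu i _ => h u (hS hu) i⟩
    · rw [hsum, hc]
      have : ((v r : ℕ) : ℝ) + 1 ≤ (v' r : ℕ) := by exact_mod_cast hlt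
      simp only [Nat.cast_one, div_one]
      linarith
    · have := h v' (hS hv') r
      subst hc
      omega
  · have hr : r = r₀ := by
      by_contra hr
      obtain ⟨v, hv, v', hv', hvv⟩ := hne
      apply hvv
      apply PNat.coe_injective
      rw [(h v (hS hv)).2.2.1 r hr, (h v' (hS hv')).2.2.1 r hr]
    subst hr
    obtain ⟨v0, hv0, v0', hv0', hvv⟩ := hne
    have hSf : S.Finite := A.finite_toSet.subset hS
    obtain ⟨v, hv, hmin⟩ := Set.exists_min_image S (fun u => (u r : ℕ)) hSf ⟨v0, hv0⟩
    obtain ⟨v', hv', hmax⟩ := Set.exists_max_image S (fun u => (u r : ℕ)) hSf ⟨v0, hv0⟩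
    have hlt : (v r : ℕ) < v' r := by
      by_contra hle
      apply hvv
      apply PNat.coe_injective
      have := hmin v0 hv0; have := hmin v0' hv0'; have := hmax v0 hv0; have := hmax v0' hv0'
      change (v0 r : ℕ) = v0' r
      omega
    refine ⟨v, hv, v', hv', A.filter (fun u => (v r : ℕ) ≤ u r ∧ (u r : ℕ) ≤ v' r), Finset.filter_subset _ _,
      ?_, hlt, ?_, ?_, ?_⟩
    · intro u hu
      simp only [Finset.coe_filter]
      exact ⟨hS hu, hmin u hu, hmax u hu⟩
    · have hcard : (A.filter (fun u => (v r : ℕ) ≤ u r ∧ (u r : ℕ) ≤ v' r)).card ≤ (v' r : ℕ) + 1 - v r := by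
        rw [← Nat.card_Icc]
        apply Finset.card_le_card_of_injOn (fun u => (u r : ℕ))
        · intro u hu
          simp only [Finset.coe_filter] at hu
          simp only [Finset.coe_Icc]
          exact hu.2
        · intro u hu u' hu' huu
          simp only [Finset.coe_filter] at hu hu'
          funext i
          by_cases hi : i = r
          · subst hi; exact PNat.coe_injective huu
          · apply PNat.coe_injective
            rw [(h u hu.1).2.2.1 i hi, (h u' hu'.1).2.2.1 i hi]
      rw [Finset.sum_congr rfl (fun u hu => (h u (Finset.mem_filter.1 hu).1).2.2.2), Finset.sum_const,
        nsmul_eq_mul, mul_one_div]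
      apply div_le_div_of_nonneg_right _ (by positivity)
      have h1 : ((A.filter (fun u => (v r : ℕ) ≤ u r ∧ (u r : ℕ) ≤ v' r)).card : ℝ) + (v r : ℕ) ≤ (v' r : ℕ) + 1 := by
        exact_mod_cast (by omega :
          (A.filter (fun u => (v r : ℕ) ≤ u r ∧ (u r : ℕ) ≤ v' r)).card + (v r : ℕ) ≤ (v' r : ℕ) + 1)
      have h2 : ((v r : ℕ) : ℝ) + 1 ≤ (v' r : ℕ) := by exact_mod_cast hlt
      linarith
    · have := (h v' (hS hv')).2.1
      nlinarith
    · intro u hu i hi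
      rw [(h u (hS hu)).2.2.1 i hi.ne]
      exact hM

theorem cantor_dim {m M : ℕ} (hm : 0 < m) (hM : 1 ≤ M) {s : ℝ} (hs0 : 0 < s) (hs1 : s < 1)
    (A : ℕ → Finset (Fin m → ℕ+)) (p : ℕ → (Fin m → ℕ+) → ℝ) (f : ℕ → ℝ) (c : ℕ → ℕ) (C : ℝ)
    (hp : ∀ j v, v ∈ A j → 0 ≤ p j v) (hsum : ∀ j, ∑ v ∈ A j, p j v = 1) (hf0 : ∀ j, 0 ≤ f j)
    (hf : ∀ j v, v ∈ A j → p j v ≤ f j * (2 * (contQ (extendTuple v) m : ℝ)) ^ (-(2 * s)))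
    (hOK : ∀ j, BlockOK m M (A j) (p j) (c j))
    (hE : ∀ k, (∏ i ∈ Finset.range k, f i) * (c k : ℝ) ^ s ≤ C) :
    ENNReal.ofReal s ≤ dimH (range (fun ω : ∀ j, A j => xval (dig hm (fun j => (ω j).1)))) := by
  classical
  obtain ⟨ms, P, hP1, hPc⟩ := exists_prod A p hp hsum
  have hc1 : ∀ j, (1 : ℝ) ≤ c j := by
    intro j
    rcases hOK j with h | h
    · rw [h.1]; simp
    · exact_mod_cast (by omega : 1 ≤ c j)
  have hF0 : ∀ k, 0 ≤ ∏ i ∈ Finset.range k, f i := fun k => Finset.prod_nonneg fun i _ => hf0 i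
  have hC0 : 0 ≤ C := le_trans (mul_nonneg (hF0 0) (by positivity)) (hE 0)
  have hEC : ∀ k, ∏ i ∈ Finset.range k, f i ≤ C := by
    intro k
    refine le_trans ?_ (hE k)
    exact le_mul_of_one_le_right (hF0 k) (Real.one_le_rpow (hc1 k) hs0.le)
  have hM' : (1 : ℝ) ≤ M := by exact_mod_cast hM
  set K : ℝ := 4 * ((M : ℝ) + 1) * (3 * M) ^ 2 * (((M : ℝ) + 1) ^ m) ^ 2 with hK
  have hK0 : 0 < K := by positivity
  have hcyl : ∀ (ω : ∀ j, A j) (k : ℕ), ∏ i ∈ Finset.range k, p i (ω i).1 ≤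
      (∏ i ∈ Finset.range k, f i) * (contQ (dig hm (fun j => (ω j).1)) (m * k) : ℝ) ^ (-(2 * s)) :=
    fun ω k => cyl_bound hm hs0 (fun j => (ω j).1) (fun i => p i (ω i).1) f (fun j => hp j _ (ω j).2) hf0
      (fun j => hf j _ (ω j).2) k
  apply mass_dist P hP1 _ hs0.le (C := 4 * M * C * (K / (2 * M)) ^ s) (by positivity)
  intro U hU
  set X : (∀ j, A j) → ℝ := fun ω => xval (dig hm (fun j => (ω j).1)) with hX
  by_cases hall : ∀ ω ∈ X ⁻¹' U, ∀ ω' ∈ X ⁻¹' U, ∀ n, dig hm (fun j => (ω j).1) (n + 1) = dig hm (fun j => (ω' j).1) (n + 1)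
  · -- at most one point
    have : P (X ⁻¹' U) = 0 := by
      rcases (X ⁻¹' U).eq_empty_or_nonempty with he | ⟨ω, hω⟩
      · simp [he]
      have hb : ∀ k : ℕ, P (X ⁻¹' U) ≤ ENNReal.ofReal (C * ((k : ℝ) + 1) ^ (-(2 * s))) := by
        intro k
        refine le_trans (measure_mono ?_) ((hPc (k + 1) ω (A (k + 1)) (Finset.Subset.refl _)).trans
          (ENNReal.ofReal_le_ofReal ?_))
        · intro ω' hω'
          refine ⟨fun i _ => ?_, (ω' (k + 1)).2⟩
          apply Subtype.ext
          funext r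
          apply PNat.coe_injective
          have := hall ω' hω' ω hω (m * i + r)
          rw [dig_apply, dig_apply] at this
          exact this
        · rw [hsum, mul_one]
          refine (hcyl ω (k + 1)).trans ?_
          apply mul_le_mul (hEC _) _ (by positivity) hC0
          apply Real.rpow_le_rpow_of_nonpos (by positivity) _ (by linarith)
          have h1 := le_contQ (a := dig hm (fun j => (ω j).1)) (fun i _ => dig_pos hm _ i) (m * (k + 1))
          have h2 : k + 1 ≤ m * (k + 1) := Nat.le_mul_of_pos_left _ hm
          exact_mod_cast h2.trans h1
      have ht : Tendsto (fun k : ℕ => ENNReal.ofReal (C * ((k : ℝ) + 1) ^ (-(2 * s)))) atTop (nhds 0) := by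
        rw [← ENNReal.ofReal_zero]
        apply ENNReal.tendsto_ofReal
        have h1 := (tendsto_rpow_neg_atTop (show 0 < 2 * s by linarith)).comp
          (tendsto_atTop_add_const_right atTop (1 : ℝ) tendsto_natCast_atTop_atTop)
        simpa using h1.const_mul C
      exact le_antisymm (ge_of_tendsto' ht hb) bot_le
    rw [this]
    exact bot_le
  · have hex : ∃ n, ∃ ω ∈ X ⁻¹' U, ∃ ω' ∈ X ⁻¹' U, dig hm (fun j => (ω j).1) (n + 1) ≠ dig hm (fun j => (ω' j).1) (n + 1) := by
      push Not at hall
      obtain ⟨ω, h1, ω', h2, n, h3⟩ := hall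
      exact ⟨n, ω, h1, ω', h2, h3⟩
    obtain ⟨n, ⟨ωa, ha, ωb, hb, hab⟩, hmin⟩ : ∃ n, (∃ ω ∈ X ⁻¹' U, ∃ ω' ∈ X ⁻¹' U, dig hm (fun j => (ω j).1) (n + 1) ≠ dig hm (fun j => (ω' j).1) (n + 1)) ∧
        ∀ n' < n, ∀ ω ∈ X ⁻¹' U, ∀ ω' ∈ X ⁻¹' U, dig hm (fun j => (ω j).1) (n' + 1) = dig hm (fun j => (ω' j).1) (n' + 1) := by
      refine ⟨Nat.find hex, Nat.find_spec hex, fun n' hn' ω h ω' h' => ?_⟩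
      by_contra hne
      exact Nat.find_min hex hn' ⟨ω, h, ω', h', hne⟩
    set k := n / m with hk
    let r : Fin m := ⟨n % m, Nat.mod_lt _ hm⟩
    have hn : n = m * k + r := (Nat.div_add_mod n m).symm
    have hdig : ∀ ω : ∀ j, A j, dig hm (fun j => (ω j).1) (n + 1) = (ω k).1 r := by
      intro ω
      have := dig_apply hm (fun j => (ω j).1) k r
      rw [← hn] at this
      exact this
    obtain ⟨v, ⟨ω1, h1, rfl⟩, v', ⟨ω2, h2, rfl⟩, T, hTA, hST, hlt, hTs, hle, hsm⟩ :=
      split_ok hM (hOK k) (hsum k) ((fun ω : ∀ j, A j => (ω k).1) '' (X ⁻¹' U))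
        (by rintro _ ⟨ω, _, rfl⟩; exact (ω k).2) r
        ⟨_, ⟨ωa, ha, rfl⟩, _, ⟨ωb, hb, rfl⟩, fun h => hab (by rw [hdig, hdig]; exact congrArg _ h)⟩
    simp only at hlt hTs hle
    -- measure bound
    have hPV : P (X ⁻¹' U) ≤ ENNReal.ofReal ((∏ i ∈ Finset.range k, f i) *
        (contQ (dig hm (fun j => (ω1 j).1)) (m * k) : ℝ) ^ (-(2 * s)) *
        (2 * ((((ω2 k).1 r : ℕ) : ℝ) - ((ω1 k).1 r : ℕ)) / c k)) := by
      refine le_trans (measure_mono ?_) ((hPc k ω1 T hTA).trans (ENNReal.ofReal_le_ofReal ?_))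
      · intro ω' hω'
        refine ⟨fun i hi => ?_, hST ⟨ω', hω', rfl⟩⟩
        apply Subtype.ext
        funext r'
        apply PNat.coe_injective
        have hlt' : m * i + r' < n := by
          have : m * (i + 1) ≤ m * k := Nat.mul_le_mul_left m hi
          have h4 := r'.2
          rw [Nat.mul_add] at this
          omega
        have := hmin _ hlt' ω' hω' ω1 h1
        rw [dig_apply, dig_apply] at this
        exact this
      · apply mul_le_mul (hcyl ω1 k) hTs
        · exact Finset.sum_nonneg fun v hv => hp k v (hTA hv)
        · have := hF0 k; positivity
    -- separation
    have hsep := xval_sep (a := dig hm (fun j => (ω1 j).1)) (b := dig hm (fun j => (ω2 j).1))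
      (fun i _ => dig_pos hm _ i) (fun i _ => dig_pos hm _ i) hM n
      (fun i hi1 hi2 => by
        have := hmin (i - 1) (by omega) ω1 h1 ω2 h2
        rwa [Nat.sub_add_cancel hi1] at this)
      (by rw [hdig, hdig]; exact hlt)
      (by
        have hj := Nat.div_add_mod (n + 1) m
        have e1 := dig_apply hm (fun j => (ω1 j).1) ((n + 1) / m) ⟨(n + 1) % m, Nat.mod_lt _ hm⟩
        have e2 := dig_apply hm (fun j => (ω2 j).1) ((n + 1) / m) ⟨(n + 1) % m, Nat.mod_lt _ hm⟩
        simp only [hj] at e1 e2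
        rw [show n + 2 = n + 1 + 1 from rfl, e1, e2]
        exact next_ok hM (hOK _) (ω1 _).2 (ω2 _).2 _)
    rw [hdig, hdig] at hsep
    have hgrow := q_grow (a := dig hm (fun j => (ω1 j).1)) (fun i _ => dig_pos hm _ i) (M := M) (m * k) r
      (fun i hi1 hi2 => by
        have hi : i = m * k + (i - 1 - m * k) + 1 := by omega
        have hlt2 : i - 1 - m * k < r := by omega
        have := dig_apply hm (fun j => (ω1 j).1) k ⟨i - 1 - m * k, lt_trans hlt2 r.2⟩
        simp only [← hi] at this
        rw [this]
        exact hsm _ ⟨ω1, h1, rfl⟩ _ hlt2)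
    rw [← hn] at hgrow
    set D : ℝ := (((ω2 k).1 r : ℕ) : ℝ) - ((ω1 k).1 r : ℕ) with hD
    set q : ℝ := (contQ (dig hm (fun j => (ω1 j).1)) (m * k) : ℝ) with hq
    have hq1 : 1 ≤ q := by
      rw [hq]; exact_mod_cast contQ_pos (fun i _ => dig_pos hm _ i) _
    have hqn1 : (1 : ℝ) ≤ contQ (dig hm (fun j => (ω1 j).1)) n := by
      exact_mod_cast contQ_pos (fun i _ => dig_pos hm _ i) _
    have hqn : (contQ (dig hm (fun j => (ω1 j).1)) n : ℝ) ≤ ((M : ℝ) + 1) ^ m * q := by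
      have h3 : (contQ (dig hm (fun j => (ω1 j).1)) n : ℝ) ≤ ((M : ℝ) + 1) ^ (r : ℕ) * q := by
        rw [hq]; exact_mod_cast hgrow
      refine h3.trans ?_
      gcongr
      · linarith
      · exact r.2.le
    have hD1 : 1 ≤ D := by
      have : (((ω1 k).1 r : ℕ) : ℝ) + 1 ≤ ((ω2 k).1 r : ℕ) := by exact_mod_cast hlt
      rw [hD]; linarith
    have hβ : (((ω2 k).1 r : ℕ) : ℝ) ≤ 2 * M * c k := by exact_mod_cast hle
    have hβ0 : (0 : ℝ) ≤ ((ω1 k).1 r : ℕ) := by positivity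
    have hfin := final_est (δ := |X ω1 - X ω2|) hs0 hs1 hM' hq1 hD1 (hc1 k) (hE k)
      (by rw [hD]; linarith) hC0 hK0 (by
        refine le_trans ?_ hsep
        apply div_le_div_of_nonneg_left (by linarith) (by positivity)
        have e : K * (c k : ℝ) ^ 2 * q ^ 2 =
          4 * ((M : ℝ) + 1) * (3 * M * c k) ^ 2 * (((M : ℝ) + 1) ^ m * q) ^ 2 := by rw [hK]; ring
        rw [e]
        have h5 : (((ω2 k).1 r : ℕ) : ℝ) + 1 ≤ 3 * M * c k := by nlinarith [hc1 k]
        gcongr)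
    refine hPV.trans ((ENNReal.ofReal_le_ofReal hfin).trans ?_)
    rw [ENNReal.ofReal_mul (by positivity)]
    gcongr
    rw [← ENNReal.ofReal_rpow_of_nonneg (abs_nonneg _) hs0.le]
    apply ENNReal.rpow_le_rpow _ hs0.le
    have := Metric.edist_le_ediam_of_mem (s := U) h1 h2
    rwa [edist_dist, Real.dist_eq] at this

lemma contQ_le_prod {a : ℕ → ℕ} (ha : ∀ i, 1 ≤ i → 1 ≤ a i) (n : ℕ) :
    contQ a n ≤ ∏ i ∈ Finset.range n, (2 * a (i + 1)) := by
  induction n with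
  | zero => simp [contQ]
  | succ n ih =>
    rw [Finset.prod_range_succ]
    have h1 := contQ_succ_le ha n
    have h2 := ha (n + 1) (by omega)
    calc _ ≤ _ := h1
      _ ≤ (2 * a (n + 1)) * ∏ i ∈ Finset.range n, (2 * a (i + 1)) := Nat.mul_le_mul (by omega) ih
      _ = _ := by ring

lemma q_special {m : ℕ} (v : Fin m → ℕ+) (r₀ : Fin m) (h : ∀ r, r ≠ r₀ → (v r : ℕ) = 1) :
    contQ (extendTuple v) m ≤ 2 ^ m * (v r₀ : ℕ) := by
  refine (contQ_le_prod (fun i _ => extendTuple_pos v i) m).trans ?_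
  rw [Finset.prod_mul_distrib, Finset.prod_const, Finset.card_range]
  apply Nat.mul_le_mul_left
  rw [← Fin.prod_univ_eq_prod_range (fun i => extendTuple v (i + 1)) m]
  have : ∀ i : Fin m, extendTuple v ((i : ℕ) + 1) = v i := by
    intro i
    simp [extendTuple]
  rw [Finset.prod_congr rfl (fun i _ => this i), Finset.prod_eq_single r₀ (fun b _ hb => h b hb) (by simp)]

lemma special_block {m M : ℕ} {s : ℝ} (hs0 : 0 < s) (r₀ : Fin m) {c : ℕ} (hc : 2 ≤ c) :
    ∃ (A : Finset (Fin m → ℕ+)) (p : (Fin m → ℕ+) → ℝ), (∀ v ∈ A, 0 ≤ p v) ∧ ∑ v ∈ A, p v = 1 ∧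
      (∀ v ∈ A, p v ≤ ((4 * 2 ^ m) ^ (2 * s) * (c : ℝ) ^ (2 * s - 1)) *
        (2 * (contQ (extendTuple v) m : ℝ)) ^ (-(2 * s))) ∧
      BlockOK m M A p c ∧ ∀ v ∈ A, c ≤ (v r₀ : ℕ) := by
  classical
  let F : ℕ → Fin m → ℕ+ := fun x r => if r = r₀ then x.succPNat else 1
  have hc0 : (0 : ℝ) < c := by positivity
  have key : ∀ v ∈ (Finset.Ico (c - 1) (2 * c - 1)).image F,
      c ≤ (v r₀ : ℕ) ∧ (v r₀ : ℕ) < 2 * c ∧ (∀ r, r ≠ r₀ → (v r : ℕ) = 1) := by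
    intro v hv
    obtain ⟨x, hx, rfl⟩ := Finset.mem_image.1 hv
    rw [Finset.mem_Ico] at hx
    refine ⟨?_, ?_, ?_⟩
    · simp only [F, if_true, Nat.succPNat_coe]; omega
    · simp only [F, if_true, Nat.succPNat_coe]; omega
    · intro r hr; simp [F, hr]
  refine ⟨(Finset.Ico (c - 1) (2 * c - 1)).image F, fun _ => 1 / (c : ℝ), fun _ _ => by positivity, ?_, ?_,
    Or.inr ⟨hc, r₀, fun v hv => ⟨(key v hv).1, (key v hv).2.1, (key v hv).2.2, rfl⟩⟩, fun v hv => (key v hv).1⟩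
  · rw [Finset.sum_const, Finset.card_image_of_injective, Nat.card_Ico, nsmul_eq_mul]
    · rw [show 2 * c - 1 - (c - 1) = c by omega]
      field_simp
    · intro x y hxy
      have := congrFun hxy r₀
      simpa [F] using this
  · intro v hv
    obtain ⟨h1, h2, h3⟩ := key v hv
    have hq := q_special v r₀ h3
    have hq1 : (1 : ℝ) ≤ contQ (extendTuple v) m := by
      exact_mod_cast contQ_pos (fun i _ => extendTuple_pos _ i) _
    have hq2 : 2 * (contQ (extendTuple v) m : ℝ) ≤ (4 * 2 ^ m) * c := by
      have : (contQ (extendTuple v) m : ℝ) ≤ 2 ^ m * (v r₀ : ℕ) := by exact_mod_cast hq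
      have h4 : ((v r₀ : ℕ) : ℝ) ≤ 2 * c := by exact_mod_cast h2.le
      have h5 : (0 : ℝ) < 2 ^ m := by positivity
      nlinarith
    have h6 := Real.rpow_le_rpow_of_nonpos (by linarith) hq2 (show -(2 * s) ≤ 0 by linarith)
    calc 1 / (c : ℝ) = ((4 * 2 ^ m) ^ (2 * s) * (c : ℝ) ^ (2 * s - 1)) * ((4 * 2 ^ m) * (c : ℝ)) ^ (-(2 * s)) := by
          rw [Real.mul_rpow (x := 4 * 2 ^ m) (y := (c : ℝ)) (by positivity) (by positivity),
            Real.rpow_neg (x := 4 * 2 ^ m) (by positivity), Real.rpow_neg hc0.le, Real.rpow_sub hc0, Real.rpow_one]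
          have e1 : ((4 : ℝ) * 2 ^ m) ^ (2 * s) ≠ 0 := (Real.rpow_pos_of_pos (by positivity) _).ne'
          have e2 : (c : ℝ) ^ (2 * s) ≠ 0 := (Real.rpow_pos_of_pos hc0 _).ne'
          field_simp
      _ ≤ _ := by gcongr

theorem cantor_lower {m M : ℕ} (hm : 0 < m) (hM : 1 ≤ M) {s : ℝ} (hs0 : 0 < s) (hs1 : s < 1)
    (N : Finset (Fin m → ℕ+)) (hN : ∀ v ∈ N, ∀ r, (v r : ℕ) ≤ M) {Z : ℝ}
    (hZ : Z = ∑ v ∈ N, (contQ (extendTuple v) m : ℝ) ^ (-(2 * s))) (hZ0 : 0 < Z)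
    (c : ℕ → ℕ) (hc : ∀ j, 1 ≤ c j) (r₀ : ℕ → Fin m) (f : ℕ → ℝ)
    (hf1 : ∀ j, c j = 1 → 2 ^ (2 * s) / Z ≤ f j)
    (hf2 : ∀ j, 2 ≤ c j → (4 * 2 ^ m) ^ (2 * s) * (c j : ℝ) ^ (2 * s - 1) ≤ f j) (C : ℝ)
    (hE : ∀ k, (∏ i ∈ Finset.range k, f i) * (c k : ℝ) ^ s ≤ C) :
    ENNReal.ofReal s ≤ dimH {x | ∃ w : ℕ → Fin m → ℕ+, (∀ j, c j ≤ (w j (r₀ j) : ℕ)) ∧ x = xval (dig hm w)} := by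
  have hblock : ∀ j, ∃ (A : Finset (Fin m → ℕ+)) (p : (Fin m → ℕ+) → ℝ), (∀ v ∈ A, 0 ≤ p v) ∧
      ∑ v ∈ A, p v = 1 ∧
      (∀ v ∈ A, p v ≤ f j * (2 * (contQ (extendTuple v) m : ℝ)) ^ (-(2 * s))) ∧
      BlockOK m M A p (c j) ∧ ∀ v ∈ A, c j ≤ (v (r₀ j) : ℕ) := by
    intro j
    rcases Nat.lt_or_ge (c j) 2 with h | h
    · have h1 : c j = 1 := by have := hc j; omega
      refine ⟨N, fun v => (contQ (extendTuple v) m : ℝ) ^ (-(2 * s)) / Z, fun v _ => by positivity, ?_, ?_,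
        Or.inl ⟨h1, hN⟩, fun v _ => by rw [h1]; exact (v (r₀ j)).2⟩
      · rw [← Finset.sum_div, ← hZ, div_self hZ0.ne']
      · intro v _
        rw [Real.mul_rpow (by norm_num) (by positivity)]
        have e : (contQ (extendTuple v) m : ℝ) ^ (-(2 * s)) / Z = 2 ^ (2 * s) / Z *
            (2 ^ (-(2 * s)) * (contQ (extendTuple v) m : ℝ) ^ (-(2 * s))) := by
          rw [Real.rpow_neg (by norm_num : (0 : ℝ) ≤ 2) (2 * s)]
          have : (2 : ℝ) ^ (2 * s) ≠ 0 := (Real.rpow_pos_of_pos (by norm_num) _).ne'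
          field_simp
        simp only [e]
        have := hf1 j h1
        gcongr
    · obtain ⟨A, p, h1, h2, h3, h4, h5⟩ := special_block (M := M) hs0 (r₀ j) h
      refine ⟨A, p, h1, h2, fun v hv => (h3 v hv).trans ?_, h4, h5⟩
      have := hf2 j h
      gcongr
  choose A p h1 h2 h3 h4 h5 using hblock
  have hf0 : ∀ j, 0 ≤ f j := by
    intro j
    rcases Nat.lt_or_ge (c j) 2 with h | h
    · exact le_trans (by positivity) (hf1 j (by have := hc j; omega))
    · exact le_trans (by positivity) (hf2 j h)
  refine (cantor_dim hm hM hs0 hs1 A p f c C h1 h2 hf0 h3 h4 hE).trans (dimH_mono ?_)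
  rintro _ ⟨ω, rfl⟩
  exact ⟨fun j => (ω j).1, fun j => h5 j _ (ω j).2, rfl⟩

lemma div_mod_step {d : ℕ} (hd : 1 ≤ d) (l : ℕ) :
    ((l + 1) / d = l / d ∧ (l + 1) % d = l % d + 1) ∨
    ((l + 1) / d = l / d + 1 ∧ (l + 1) % d = 0 ∧ l % d + 1 = d) := by
  have h := Nat.div_add_mod l d
  have hlt := Nat.mod_lt l hd
  rcases Nat.lt_or_ge (l % d + 1) d with h1 | h1
  · left
    have e : l + 1 = d * (l / d) + (l % d + 1) := by omega
    constructor
    · conv_lhs => rw [e]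
      rw [Nat.mul_add_div hd, Nat.div_eq_of_lt h1, Nat.add_zero]
    · conv_lhs => rw [e]
      rw [Nat.mul_add_mod, Nat.mod_eq_of_lt h1]
  · right
    have h2 : l % d + 1 = d := by omega
    have e : l + 1 = d * (l / d + 1) := by rw [Nat.mul_add]; omega
    refine ⟨?_, ?_, h2⟩
    · conv_lhs => rw [e]
      rw [Nat.mul_div_cancel_left _ hd]
    · conv_lhs => rw [e]
      rw [Nat.mul_mod_right]

/-- The `l`-th special position. -/
def posn (d : ℕ) (n : ℕ → ℕ) (l : ℕ) : ℕ := (l % d + 1) * n (l / d)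

lemma posn_step {d m : ℕ} (hd : 1 ≤ d) {n : ℕ → ℕ} (hn0 : ∀ k, m ≤ n k)
    (hn : ∀ k, (d + 1) * n k ≤ n (k + 1)) (l : ℕ) : posn d n l + m ≤ posn d n (l + 1) := by
  unfold posn
  rcases div_mod_step hd l with ⟨h1, h2⟩ | ⟨h1, h2, h3⟩
  · rw [h1, h2]
    have := hn0 (l / d)
    nlinarith
  · rw [h1, h2, h3]
    have := hn0 (l / d)
    have := hn (l / d)
    nlinarith

lemma block_strictMono {d m : ℕ} (hd : 1 ≤ d) (hm : 0 < m) {n : ℕ → ℕ} (hn0 : ∀ k, m ≤ n k)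
    (hn : ∀ k, (d + 1) * n k ≤ n (k + 1)) : StrictMono (fun l => (posn d n l - 1) / m) := by
  apply strictMono_nat_of_lt_succ
  intro l
  have h := posn_step hd hn0 hn l
  have h1 : 1 ≤ posn d n l := by
    unfold posn
    have := hn0 (l / d)
    exact Nat.mul_pos (by omega) (by omega)
  have h2 : (posn d n l - 1) + m ≤ posn d n (l + 1) - 1 := by omega
  have h3 := Nat.div_le_div_right (c := m) h2
  rw [Nat.add_div_right _ hm] at h3
  exact h3

lemma sum_extend {e : ℕ → ℕ} (he : StrictMono e) (u : ℕ → ℝ) (j : ℕ) :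
    ∃ L, ∑ i ∈ Finset.range j, Function.extend e u 0 i = ∑ l ∈ Finset.range L, u l ∧
      (∀ l < L, e l < j) ∧ j ≤ e L := by
  induction j with
  | zero => exact ⟨0, by simp, by simp, by simp⟩
  | succ j ih =>
    obtain ⟨L, h1, h2, h3⟩ := ih
    rcases h3.eq_or_lt with h | h
    · refine ⟨L + 1, ?_, ?_, ?_⟩
      · rw [Finset.sum_range_succ, Finset.sum_range_succ, h1, h, he.injective.extend_apply]
      · intro l hl
        have : e l ≤ e L := he.monotone (by omega)
        omega
      · have : e L < e (L + 1) := he (by omega)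
        omega
    · refine ⟨L, ?_, fun l hl => by have := h2 l hl; omega, by omega⟩
      rw [Finset.sum_range_succ, h1, Function.extend_apply']
      · simp
      · rintro ⟨l, rfl⟩
        rcases Nat.lt_or_ge l L with h4 | h4
        · exact absurd (h2 l h4) (by omega)
        · exact absurd (he.monotone h4) (by omega)

lemma group_sum {d : ℕ} (hd : 1 ≤ d) {s ℓ κ : ℝ} (t : ℕ → ℝ) (n : ℕ → ℕ) (k i : ℕ) (hi : i ≤ d) :
    ∑ l ∈ Finset.range (d * k + i), (κ + (2 * s - 1) * ℓ * (t (l % d) * n (l / d))) =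
      ∑ l ∈ Finset.range (d * k), (κ + (2 * s - 1) * ℓ * (t (l % d) * n (l / d))) +
      (i * κ + (2 * s - 1) * ℓ * (∑ j ∈ Finset.range i, t j) * n k) := by
  rw [Finset.sum_range_add]
  congr 1
  have : ∀ x ∈ Finset.range i, (κ + (2 * s - 1) * ℓ * (t ((d * k + x) % d) * n ((d * k + x) / d))) =
      κ + (2 * s - 1) * ℓ * n k * t x := by
    intro x hx
    have hx' : x < d := lt_of_lt_of_le (Finset.mem_range.1 hx) hi
    rw [Nat.mul_add_mod, Nat.mod_eq_of_lt hx', Nat.mul_add_div hd, Nat.div_eq_of_lt hx', Nat.add_zero]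
    ring
  rw [Finset.sum_congr rfl this, Finset.sum_add_distrib, ← Finset.mul_sum]
  simp
  ring

lemma numeric {d m : ℕ} (hd : 1 ≤ d) (hm : 0 < m) {s g ℓ ℓ' κ : ℝ} (hs0 : 0 < s) (hs1 : s < 1) (hg : 0 < g)
    (hℓ : 0 < ℓ) (hℓ' : ℓ < ℓ') (hκ : 0 ≤ κ) (t : ℕ → ℝ)
    (ht : ∀ i, (2 * s - 1) * ∑ j ∈ Finset.range i, t j + s * t i = (i + 1) * g)
    (ht1 : ∑ i ∈ Finset.range d, t i = 1) (R : ℕ)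
    (hR : g * (ℓ' - ℓ) + (d * κ + ℓ) ≤ R * (g * (ℓ' - ℓ))) (n : ℕ → ℕ) (hn0 : ∀ k, 1 ≤ n k)
    (hn : ∀ k, R * n k ≤ n (k + 1)) (L : ℕ) :
    -(g * ℓ' * m) * ((posn d n L - 1) / m : ℕ) +
      ∑ l ∈ Finset.range L, (κ + (2 * s - 1) * ℓ * (t (l % d) * n (l / d))) +
      s * ℓ * (t (L % d) * n (L / d)) ≤ g * ℓ' * m + d * κ := by
  set δ := g * (ℓ' - ℓ) with hδ
  have hδ0 : 0 < δ := mul_pos hg (by linarith)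
  have hS : ∀ k, ∑ l ∈ Finset.range (d * k), (κ + (2 * s - 1) * ℓ * (t (l % d) * n (l / d))) ≤ δ * n k := by
    intro k
    induction k with
    | zero => simp; positivity
    | succ k ih =>
      have h1 := group_sum hd (s := s) (ℓ := ℓ) (κ := κ) t n k d le_rfl
      rw [← Nat.mul_succ] at h1
      rw [h1, ht1]
      have h2 : (1 : ℝ) ≤ n k := by exact_mod_cast hn0 k
      have h3 : (R : ℝ) * n k ≤ n (k + 1) := by exact_mod_cast hn k
      have h4 : (d : ℝ) * κ ≤ d * κ * n k := le_mul_of_one_le_right (by positivity) h2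
      have h5 : (2 * s - 1) * ℓ * 1 * n k ≤ ℓ * n k := by
        have : 0 < ℓ * n k := by positivity
        nlinarith
      have h6 : (δ + (d * κ + ℓ)) * n k ≤ R * δ * n k := by gcongr
      have h7 : δ * (R * n k) ≤ δ * n (k + 1) := by gcongr
      nlinarith
  have hL : L = d * (L / d) + L % d := (Nat.div_add_mod L d).symm
  have hi : L % d < d := Nat.mod_lt L hd
  have h1 := group_sum hd (s := s) (ℓ := ℓ) (κ := κ) t n (L / d) (L % d) hi.le
  rw [← hL] at h1
  have h2 := hS (L / d)
  rw [h1]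
  set k := L / d
  set i := L % d
  have h3 := ht i
  have hP : ((i : ℝ) + 1) * n k - m ≤ m * (((posn d n L - 1) / m : ℕ) : ℝ) := by
    have h4 : posn d n L ≤ m * ((posn d n L - 1) / m) + m := by
      have := Nat.lt_mul_div_succ (posn d n L - 1) hm
      rw [Nat.mul_succ] at this
      omega
    have h5 : (posn d n L : ℝ) ≤ m * (((posn d n L - 1) / m : ℕ) : ℝ) + m := by exact_mod_cast h4
    have h6 : (posn d n L : ℝ) = ((i : ℝ) + 1) * n k := by simp [posn, i, k]
    linarith
  have h7 : (i : ℝ) * κ ≤ d * κ := by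
    have : (i : ℝ) ≤ d := by exact_mod_cast hi.le
    gcongr
  have h8 : (2 * s - 1) * ℓ * (∑ j ∈ Finset.range i, t j) * n k + s * ℓ * (t i * n k) =
      ℓ * n k * ((i + 1) * g) := by rw [← h3]; ring
  have h9 : g * ℓ' * (((i : ℝ) + 1) * n k - m) ≤ g * ℓ' * (m * (((posn d n L - 1) / m : ℕ) : ℝ)) := by
    have : 0 < ℓ' := by linarith
    gcongr
  have h10 : δ * n k ≤ δ * n k * (i + 1) := le_mul_of_one_le_right (by positivity) (by
    have : (0 : ℝ) ≤ i := by positivity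
    linarith)
  have h11 : δ * n k * (i + 1) = g * ℓ' * (((i : ℝ) + 1) * n k) - ℓ * n k * ((i + 1) * g) := by
    rw [hδ]; ring
  nlinarith

lemma exists_small {Φ : ℕ → ℝ} {B ℓ : ℝ} (hB : 1 < B)
    (hlim : Filter.liminf (fun n : ℕ => Real.log (Φ n) / (n : ℝ)) Filter.atTop = Real.log B)
    (hℓ : Real.log B < ℓ) (N : ℕ) : ∃ n, N ≤ n ∧ 1 ≤ n ∧ Real.log (Φ n) ≤ ℓ * n := by
  by_contra hcon
  push Not at hcon
  have hev : ∀ᶠ n : ℕ in atTop, ℓ ≤ Real.log (Φ n) / (n : ℝ) := by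
    filter_upwards [eventually_ge_atTop (N + 1)] with n hn
    have h1 := hcon n (by omega) (by omega)
    have : (0 : ℝ) < n := by exact_mod_cast (by omega : 0 < n)
    rw [le_div_iff₀ this]
    exact h1.le
  rw [Filter.liminf_eq] at hlim
  have hlB : 0 < Real.log B := Real.log_pos hB
  by_cases hbdd : BddAbove {a : ℝ | ∀ᶠ n : ℕ in atTop, a ≤ Real.log (Φ n) / (n : ℝ)}
  · have := le_csSup hbdd hev
    rw [hlim] at this
    linarith
  · rw [Real.sSup_of_not_bddAbove hbdd] at hlim
    linarith

lemma exists_seq {Φ : ℕ → ℝ} {B ℓ : ℝ} (hB : 1 < B)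
    (hlim : Filter.liminf (fun n : ℕ => Real.log (Φ n) / (n : ℝ)) Filter.atTop = Real.log B)
    (hℓ : Real.log B < ℓ) (m R : ℕ) (hR : 2 ≤ R) (hm : 1 ≤ m) :
    ∃ n : ℕ → ℕ, (∀ k, m ≤ n k) ∧ (∀ k, R * n k ≤ n (k + 1)) ∧ (∀ k, Real.log (Φ (n k)) ≤ ℓ * n k) ∧
      ∀ k, k ≤ n k := by
  choose F hF1 _ hF3 using exists_small hB hlim hℓ
  let n : ℕ → ℕ := fun k => Nat.rec (F m) (fun _ x => F (R * x)) k
  have hn : ∀ k, R * n k ≤ n (k + 1) := fun k => hF1 (R * n k)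
  have hnm : ∀ k, m ≤ n k := by
    intro k
    induction k with
    | zero => exact hF1 m
    | succ k ih =>
      have := hn k
      nlinarith
  refine ⟨n, hnm, hn, ?_, ?_⟩
  · intro k
    cases k with
    | zero => exact hF3 m
    | succ k => exact hF3 (R * n k)
  · intro k
    induction k with
    | zero => omega
    | succ k ih =>
      have := hn k
      have := hnm k
      nlinarith

lemma ceil_bounds {y : ℝ} (hy : 1 < y) : 2 ≤ ⌈y⌉₊ ∧ y ≤ (⌈y⌉₊ : ℝ) ∧ (⌈y⌉₊ : ℝ) ≤ 2 * y := by
  have h1 := Nat.le_ceil y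
  have h2 := Nat.ceil_lt_add_one (show 0 ≤ y by linarith)
  refine ⟨?_, h1, by linarith⟩
  have : (1 : ℝ) < ⌈y⌉₊ := by linarith
  exact_mod_cast this

lemma ceil_rpow_le {y s : ℝ} (hy : 1 < y) (hs0 : 0 < s) (hs1 : s < 1) :
    (⌈y⌉₊ : ℝ) ^ (2 * s - 1) ≤ 2 * y ^ (2 * s - 1) ∧ (⌈y⌉₊ : ℝ) ^ s ≤ 2 * y ^ s := by
  obtain ⟨h1, h2, h3⟩ := ceil_bounds hy
  have hy0 : 0 < y := by linarith
  have key : ∀ x : ℝ, 0 ≤ x → x ≤ 1 → (⌈y⌉₊ : ℝ) ^ x ≤ 2 * y ^ x := by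
    intro x hx0 hx1
    calc (⌈y⌉₊ : ℝ) ^ x ≤ (2 * y) ^ x := Real.rpow_le_rpow (by positivity) h3 hx0
      _ = 2 ^ x * y ^ x := Real.mul_rpow (by norm_num) hy0.le
      _ ≤ 2 ^ (1 : ℝ) * y ^ x := by
          gcongr
          norm_num
      _ = _ := by rw [Real.rpow_one]
  refine ⟨?_, key s hs0.le hs1.le⟩
  rcases le_total 0 (2 * s - 1) with h | h
  · exact key _ h (by linarith)
  · have h4 := Real.rpow_le_rpow_of_nonpos hy0 h2 h
    have : 0 ≤ y ^ (2 * s - 1) := by positivity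
    linarith

lemma exists_block {d : ℕ} {B s s₁ g ℓ' : ℝ} (hB : 1 < B) (hs0 : 0 < s) (hs : s < s₁) (hs1 : s < 1)
    (hs₁ : s₁ < critL d B) (hg : g * ℓ' < gFun d s₁ * Real.log B) :
    ∃ (m M : ℕ) (N : Finset (Fin m → ℕ+)), 0 < m ∧ 1 ≤ M ∧ (∀ v ∈ N, ∀ r, (v r : ℕ) ≤ M) ∧
      0 < ∑ v ∈ N, (contQ (extendTuple v) m : ℝ) ^ (-(2 * s)) ∧
      2 ^ (2 * s) / ∑ v ∈ N, (contQ (extendTuple v) m : ℝ) ^ (-(2 * s)) ≤ Real.exp (-(g * ℓ' * m)) := by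
  set η := gFun d s₁ * Real.log B - g * ℓ' with hη
  have hη0 : 0 < η := by linarith
  have hB0 : 0 < B := by linarith
  let m := ⌈2 / η⌉₊ + 1
  have hm : 0 < m := Nat.succ_pos _
  have hmη : 2 ≤ η * m := by
    have h1 := Nat.le_ceil (2 / η)
    rw [div_le_iff₀ hη0] at h1
    have : (m : ℝ) = ⌈2 / η⌉₊ + 1 := by simp [m]
    rw [this]; nlinarith
  have h1 := below_crit (d := d) hB (hs0.trans hs) hs₁ m hm
  have h2 := lt_of_lt_of_le h1 (Zs_anti m hs.le)
  unfold Zs at h2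
  rw [ENNReal.tsum_eq_iSup_sum, lt_iSup_iff] at h2
  obtain ⟨N, hN⟩ := h2
  rw [← ENNReal.ofReal_sum_of_nonneg (fun v _ => by positivity)] at hN
  have hx0 : 0 < (B ^ gFun d s₁) ^ m := by positivity
  have hN' : (B ^ gFun d s₁) ^ m < ∑ v ∈ N, (contQ (extendTuple v) m : ℝ) ^ (-(2 * s)) :=
    (ENNReal.ofReal_lt_ofReal_iff_of_nonneg hx0.le).1 hN
  have hZ0 := hx0.trans hN'
  refine ⟨m, N.sup (fun v => Finset.univ.sup (fun r => (v r : ℕ))) + 1, N, hm, by omega, ?_, hZ0, ?_⟩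
  · intro v hv r
    have h3 : (v r : ℕ) ≤ Finset.univ.sup (fun r => (v r : ℕ)) :=
      Finset.le_sup (f := fun r => (v r : ℕ)) (Finset.mem_univ r)
    have h4 := Finset.le_sup (f := fun v : Fin m → ℕ+ => Finset.univ.sup (fun r => (v r : ℕ))) hv
    omega
  · rw [div_le_iff₀ hZ0]
    have e1 : (B ^ gFun d s₁) ^ m = Real.exp (gFun d s₁ * Real.log B * m) := by
      rw [Real.rpow_def_of_pos hB0, ← Real.exp_nat_mul]
      congr 1; ring
    have e2 : (2 : ℝ) ^ (2 * s) ≤ Real.exp 2 := by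
      rw [Real.rpow_def_of_pos (by norm_num)]
      apply Real.exp_le_exp.2
      have := Real.log_two_lt_d9
      have := Real.log_two_gt_d9
      nlinarith
    calc (2 : ℝ) ^ (2 * s) ≤ Real.exp 2 := e2
      _ ≤ Real.exp (η * m) := Real.exp_le_exp.2 hmη
      _ = Real.exp (-(g * ℓ' * m)) * (B ^ gFun d s₁) ^ m := by
          rw [e1, ← Real.exp_add]; congr 1; rw [hη]; ring
      _ ≤ _ := by gcongr

lemma mem_Lambda {d m : ℕ} (hd : 1 ≤ d) (hm : 0 < m) {Φ : ℕ → ℝ} (hΦ : ∀ n, 2 ≤ Φ n) {ℓ : ℝ}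
    (t : ℕ → ℝ) (ht1 : ∑ i ∈ Finset.range d, t i = 1)
    (n : ℕ → ℕ) (hnm : ∀ k, m ≤ n k) (hΦn : ∀ k, Real.log (Φ (n k)) ≤ ℓ * n k) (hnk : ∀ k, k ≤ n k)
    (w : ℕ → Fin m → ℕ+)
    (hw : ∀ l, Real.exp (ℓ * (t (l % d) * n (l / d))) ≤ dig hm w (posn d n l)) :
    xval (dig hm w) ∈ Lambda d Φ := by
  have hp : ∀ i, 1 ≤ i → 1 ≤ dig hm w i := fun i _ => dig_pos hm w i
  refine ⟨⟨(xval_pos hp).le, xval_lt hp⟩, xval_irrational hp, ?_⟩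
  rw [frequently_atTop]
  intro N₀
  refine ⟨n N₀, hnk N₀, ?_⟩
  have hn1 : 1 ≤ n N₀ := by have := hnm N₀; omega
  have h1 : ∏ i ∈ Finset.range d, Real.exp (ℓ * (t i * n N₀)) ≤
      ∏ i ∈ Finset.range d, (pq ((i + 1) * n N₀) (xval (dig hm w)) : ℝ) := by
    apply Finset.prod_le_prod (fun i _ => (Real.exp_pos _).le)
    intro i hi
    have hi' : i < d := Finset.mem_range.1 hi
    rw [pq_xval hp _ (Nat.mul_pos (by omega) hn1)]
    have := hw (d * N₀ + i)
    unfold posn at this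
    rwa [Nat.mul_add_mod, Nat.mod_eq_of_lt hi', Nat.mul_add_div hd, Nat.div_eq_of_lt hi', Nat.add_zero] at this
  have h2 : ∏ i ∈ Finset.range d, Real.exp (ℓ * (t i * n N₀)) = Real.exp (ℓ * n N₀) := by
    rw [← Real.exp_sum, ← Finset.mul_sum, ← Finset.sum_mul, ht1, one_mul]
  have h3 : Φ (n N₀) ≤ Real.exp (ℓ * n N₀) := by
    have := hΦ (n N₀)
    rw [← Real.exp_log (show 0 < Φ (n N₀) by linarith)]
    exact Real.exp_le_exp.2 (hΦn N₀)
  refine h3.trans (h2 ▸ h1.trans_eq ?_)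
  rw [Finset.range_eq_Ico, Finset.prod_Ico_add' (fun i => (pq (i * n N₀) (xval (dig hm w)) : ℝ)) 0 d 1]
  have : Finset.Ico (0 + 1) (d + 1) = Finset.Icc 1 d := by ext; simp
  rw [this]

lemma lower_aux {d : ℕ} (hd : 1 ≤ d) {Φ : ℕ → ℝ} (hΦ : ∀ n, 2 ≤ Φ n) {B : ℝ} (hB : 1 < B)
    (hlim : Filter.liminf (fun n : ℕ => Real.log (Φ n) / (n : ℝ)) Filter.atTop = Real.log B)
    {s : ℝ} (hs0 : 0 < s) (hs : s < critL d B) : ENNReal.ofReal s ≤ dimH (Lambda d Φ) := by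
  obtain ⟨s₁, hs₁, hs₁c⟩ := exists_between hs
  have hc1 := critL_le_one d hB
  have hs1 : s < 1 := by linarith
  set g := gFun d s with hgdef
  have hg : 0 < g := gFun_pos d hs0 hs1.le
  have hgg : g < gFun d s₁ := gFun_lt d hs0 hs₁ (by linarith)
  set b := Real.log B with hb
  have hb0 : 0 < b := Real.log_pos hB
  set σ := gFun d s₁ * b / g with hσ
  have hσg : g * σ = gFun d s₁ * b := by rw [hσ]; field_simp
  have hσb : b < σ := by
    rw [hσ, lt_div_iff₀ hg]; nlinarith
  obtain ⟨ℓ, hℓ1, hℓ2⟩ := exists_between hσb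
  obtain ⟨ℓ', hℓ'1, hℓ'2⟩ := exists_between hℓ2
  have hℓ0 : 0 < ℓ := by linarith
  have hℓ'0 : 0 < ℓ' := by linarith
  obtain ⟨m, M, N, hm, hM, hN, hZ0, hZ⟩ := exists_block (d := d) (g := g) (ℓ' := ℓ') hB hs0 hs₁ hs1 hs₁c
    (by rw [← hb, ← hσg]; gcongr)
  obtain ⟨t, ht0, ht, ht1⟩ := exists_t hd hs0 hs1.le
  rw [← hgdef] at ht
  set G := g * ℓ' * m with hG
  have hG0 : 0 < G := by positivity
  set Kc : ℝ := (4 * 2 ^ m) ^ (2 * s) * 2 with hKc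
  have hKc1 : 1 ≤ Kc := by
    have : (1 : ℝ) ≤ (4 * 2 ^ m) ^ (2 * s) := by
      apply Real.one_le_rpow _ (by linarith)
      have : (1 : ℝ) ≤ 2 ^ m := one_le_pow₀ (by norm_num)
      linarith
    rw [hKc]; linarith
  set κ := Real.log Kc + G with hκ
  have hκ0 : 0 ≤ κ := by have := Real.log_nonneg hKc1; linarith
  set δ := g * (ℓ' - ℓ) with hδ
  have hδ0 : 0 < δ := mul_pos hg (by linarith)
  let R := ⌈(δ + (d * κ + ℓ)) / δ⌉₊ + d + 1
  have hR : δ + (d * κ + ℓ) ≤ R * δ := by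
    have h1 := Nat.le_ceil ((δ + (d * κ + ℓ)) / δ)
    rw [div_le_iff₀ hδ0] at h1
    have : (R : ℝ) = ⌈(δ + (d * κ + ℓ)) / δ⌉₊ + d + 1 := by simp [R]
    rw [this]
    have : 0 ≤ ((d : ℝ) + 1) * δ := by positivity
    linarith
  obtain ⟨n, hnm, hnR, hΦn, hnk⟩ := exists_seq hB hlim hℓ1 m R (by simp only [R]; omega) hm
  have hnd : ∀ k, (d + 1) * n k ≤ n (k + 1) := fun k =>
    le_trans (Nat.mul_le_mul_right _ (by simp only [R]; omega)) (hnR k)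
  have hn1 : ∀ k, 1 ≤ n k := fun k => hm.trans_le (hnm k)
  set τ : ℕ → ℝ := fun l => t (l % d) * n (l / d) with hτ
  have hτ0 : ∀ l, 0 < τ l := fun l => mul_pos (ht0 _) (by exact_mod_cast hn1 _)
  set e : ℕ → ℕ := fun l => (posn d n l - 1) / m with he
  have hemono : StrictMono e := block_strictMono hd hm hnm hnd
  set u : ℕ → ℝ := fun l => κ + (2 * s - 1) * ℓ * τ l with hu
  set y : ℕ → ℝ := fun l => Real.exp (ℓ * τ l) with hy
  have hy1 : ∀ l, 1 < y l := fun l => by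
    simp only [hy]; rw [Real.one_lt_exp_iff]; exact mul_pos hℓ0 (hτ0 l)
  set c : ℕ → ℕ := Function.extend e (fun l => ⌈y l⌉₊) (fun _ => 1) with hc
  have hce : ∀ l, c (e l) = ⌈y l⌉₊ := fun l => hemono.injective.extend_apply _ _ l
  have hcn : ∀ j, (¬ ∃ l, e l = j) → c j = 1 := fun j hj => Function.extend_apply' _ _ _ hj
  set h : ℕ → ℝ := Function.extend e u 0 with hh
  have hhe : ∀ l, h (e l) = u l := fun l => hemono.injective.extend_apply _ _ l
  have hhn : ∀ j, (¬ ∃ l, e l = j) → h j = 0 := fun j hj => Function.extend_apply' _ _ _ hj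
  set r₀ : ℕ → Fin m := Function.extend e (fun l => ⟨(posn d n l - 1) % m, Nat.mod_lt _ hm⟩) (fun _ => ⟨0, hm⟩) with hr₀
  have hre : ∀ l, r₀ (e l) = ⟨(posn d n l - 1) % m, Nat.mod_lt _ hm⟩ := fun l =>
    hemono.injective.extend_apply _ _ l
  have hkey := numeric hd hm hs0 hs1 hg hℓ0 hℓ'1 hκ0 t ht ht1 R hR n hn1 hnR
  have hmain := cantor_lower hm hM hs0 hs1 N hN rfl hZ0 c (fun j => by
      by_cases hj : ∃ l, e l = j
      · obtain ⟨l, rfl⟩ := hj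
        rw [hce]; have := (ceil_bounds (hy1 l)).1; omega
      · rw [hcn j hj]) r₀ (fun j => Real.exp (-G + h j))
    (fun j hj => by
      by_cases hj' : ∃ l, e l = j
      · obtain ⟨l, rfl⟩ := hj'
        rw [hce] at hj; have := (ceil_bounds (hy1 l)).1; omega
      · rw [hhn j hj', add_zero]; exact hZ)
    (fun j hj => by
      by_cases hj' : ∃ l, e l = j
      · obtain ⟨l, rfl⟩ := hj'
        rw [hce, hhe]
        have h1 := (ceil_rpow_le (hy1 l) hs0 hs1).1
        have h2 : Real.exp (-G + u l) = Kc * y l ^ (2 * s - 1) := by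
          have h3 : y l ^ (2 * s - 1) = Real.exp ((2 * s - 1) * ℓ * τ l) := by
            simp only [hy]; rw [← Real.exp_mul]; congr 1; ring
          have h4 : Real.exp (Real.log Kc) = Kc := Real.exp_log (by linarith)
          have h5 : Real.exp (-G + u l) =
              Real.exp (Real.log Kc) * Real.exp ((2 * s - 1) * ℓ * τ l) := by
            rw [← Real.exp_add]; congr 1
            simp only [hu, hκ]; ring
          rw [h3, h5, h4]
        rw [h2, hKc, mul_assoc]
        gcongr
      · rw [hcn j hj'] at hj; omega)
    (Real.exp (G + d * κ + κ + 1))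
    (fun j => by
      obtain ⟨L, hL1, hL2, hL3⟩ := sum_extend hemono u j
      have hprod : ∏ i ∈ Finset.range j, Real.exp (-G + h i) =
          Real.exp (-G * j + ∑ l ∈ Finset.range L, u l) := by
        rw [← Real.exp_sum, Finset.sum_add_distrib, ← hL1]
        congr 2
        simp; ring
      rw [hprod]
      have hdk : 0 ≤ (d : ℝ) * κ := by positivity
      rcases hL3.eq_or_lt with hj | hj
      · rw [hj, hce]
        have h1 := (ceil_rpow_le (hy1 L) hs0 hs1).2
        have h2 : y L ^ s = Real.exp (s * ℓ * τ L) := by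
          simp only [hy]; rw [← Real.exp_mul]; congr 1; ring
        have h3 : (2 : ℝ) ≤ Real.exp 1 := by
          have := Real.add_one_le_exp (1 : ℝ); linarith
        calc Real.exp (-G * (e L : ℕ) + ∑ l ∈ Finset.range L, u l) * (⌈y L⌉₊ : ℝ) ^ s
            ≤ Real.exp (-G * (e L : ℕ) + ∑ l ∈ Finset.range L, u l) * (Real.exp 1 * Real.exp (s * ℓ * τ L)) := by
              rw [← h2]
              have : 0 ≤ y L ^ s := by rw [h2]; positivity
              gcongr
              exact h1.trans (by gcongr)
          _ = Real.exp ((-G * (e L : ℕ) + ∑ l ∈ Finset.range L, u l + s * ℓ * τ L) + 1) := by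
              rw [← Real.exp_add, ← Real.exp_add]; congr 1; ring
          _ ≤ _ := by
              apply Real.exp_le_exp.2
              have := hkey L
              simp only [hu, hτ, he]
              linarith
      · have hne : ¬ ∃ l, e l = j := by
          rintro ⟨l, rfl⟩
          rcases Nat.lt_or_ge l L with h4 | h4
          · exact absurd (hL2 l h4) (by omega)
          · exact absurd (hemono.monotone h4) (by omega)
        rw [hcn j hne, Nat.cast_one, Real.one_rpow, mul_one]
        apply Real.exp_le_exp.2
        cases L with
        | zero =>
          simp only [Finset.range_zero, Finset.sum_empty, add_zero]
          have : 0 ≤ G * j := by positivity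
          linarith
        | succ L =>
          have h1 := hL2 L (by omega)
          have h2 := hkey L
          have h3 : (e L : ℝ) ≤ j := by exact_mod_cast h1.le
          have h4 : G * (e L : ℝ) ≤ G * j := by gcongr
          have h5 : (2 * s - 1) * ℓ * τ L ≤ s * ℓ * τ L := by
            have : 0 < ℓ * τ L := mul_pos hℓ0 (hτ0 L)
            nlinarith
          rw [Finset.sum_range_succ]
          change -G * (e L : ℕ) + ∑ l ∈ Finset.range L, u l + s * ℓ * τ L ≤ G + d * κ at h2
          have h6 : u L = κ + (2 * s - 1) * ℓ * τ L := rfl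
          linarith)
  refine hmain.trans (dimH_mono ?_)
  rintro x ⟨w, hw, rfl⟩
  apply mem_Lambda hd hm hΦ t ht1 n hnm hΦn hnk w
  intro l
  have h1 := hw (e l)
  rw [hce, hre] at h1
  have h2 : dig hm w (posn d n l) = w (e l) ⟨(posn d n l - 1) % m, Nat.mod_lt _ hm⟩ := rfl
  rw [h2]
  refine (ceil_bounds (hy1 l)).2.1.trans ?_
  exact_mod_cast h1

lemma lower_bound {d : ℕ} (hd : 1 ≤ d) {Φ : ℕ → ℝ} (hΦ : ∀ n, 2 ≤ Φ n) {B : ℝ} (hB : 1 < B)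
    (hlim : Filter.liminf (fun n : ℕ => Real.log (Φ n) / (n : ℝ)) Filter.atTop = Real.log B) :
    ENNReal.ofReal (critL d B) ≤ dimH (Lambda d Φ) := by
  rcases (critL_nonneg (d := d) (B := B)).eq_or_lt with h | h
  · rw [← h]; simp
  have htend : Tendsto (fun s : ℝ => ENNReal.ofReal s) (nhdsWithin (critL d B) (Iio (critL d B)))
      (nhds (ENNReal.ofReal (critL d B))) :=
    (ENNReal.continuous_ofReal.tendsto _).mono_left nhdsWithin_le_nhds
  refine le_of_tendsto htend ?_
  filter_upwards [Ioo_mem_nhdsLT h] with s hs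
  exact lower_aux hd hΦ hB hlim hs.1 hs.2

/-- If `liminf (log Φ(n))/n = log B` with `1 < B < ∞`, then the sequence `λ_d(B, n)`
converges and `dim_H Λ_d(Φ) = lim_n λ_d(B, n)`. -/
theorem dimH_lambda_eq_lim_lambdaBn (d : ℕ) (hd : 1 ≤ d) (Φ : ℕ → ℝ) (hΦ : ∀ n, 2 ≤ Φ n)
    (B : ℝ) (hB : 1 < B)
    (hlim : Filter.liminf (fun n => Real.log (Φ n) / n) Filter.atTop = Real.log B) :
    ∃ L : ℝ, Filter.Tendsto (fun n => lambdaBn d B n) Filter.atTop (nhds L) ∧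
      dimH (Lambda d Φ) = ENNReal.ofReal L := by
  exact ⟨critL d B, tendsto_lambda d hB,
    le_antisymm (upper_bound hd hΦ hB hlim) (lower_bound hd hΦ hB hlim)⟩
end

section
/- Let d ≥ 1 be an integer, B > 1 and 0 < s < 1. Then the supremum, over all real tuples 1 ≤ α_1 ≤ α_2 ≤ ⋯ ≤ α_{d−1} ≤ B, of the minimum of the d quantities α_1^{−s}, (α_1^{1−s} α_2^{−s})^{1/2}, …, (α_{k−1}^{1−s} α_k^{−s})^{1/k} for 2 ≤ k ≤ d−1, and (α_{d−1}^{1−s} B^{−s})^{1/d}, equals B^{−g_d(s)}. Moreover, the supremum is attained at a tuple for which all d quantities are equal. -/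
open MeasureTheory Filter Set

/-- Auxiliary sequence with `1 / c_n = g_n`. -/
noncomputable def cAux (s : ℝ) : ℕ → ℝ
  | 0 => 0
  | n + 1 => ((1 - s) * cAux s n + ((n : ℝ) + 1)) / s

lemma cAux_rec (s : ℝ) (hs : 0 < s) (n : ℕ) :
    s * cAux s (n + 1) = (1 - s) * cAux s n + ((n : ℝ) + 1) := by
  simp only [cAux]; field_simp

lemma cAux_lt (s : ℝ) (hs : 0 < s) (hs1 : s < 1) (n : ℕ) : cAux s n < cAux s (n + 1) := by
  induction n with
  | zero => simp [cAux, hs]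
  | succ n ih =>
    have h1 := cAux_rec s hs n
    have h2 := cAux_rec s hs (n + 1)
    push_cast at h2
    have : 0 < s * (cAux s (n + 1 + 1) - cAux s (n + 1)) := by
      nlinarith [mul_pos (sub_pos.mpr hs1) (sub_pos.mpr ih)]
    have := pos_of_mul_pos_right this hs.le
    linarith

lemma cAux_pos (s : ℝ) (hs : 0 < s) (hs1 : s < 1) (n : ℕ) : 0 < cAux s (n + 1) := by
  induction n with
  | zero => simpa [cAux] using cAux_lt s hs hs1 0
  | succ n ih => exact ih.trans (cAux_lt s hs hs1 (n + 1))

lemma gFun_eq (s : ℝ) (hs : 0 < s) (hs1 : s < 1) (n : ℕ) :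
    gFun (n + 1) s = (cAux s (n + 1))⁻¹ := by
  induction n with
  | zero => simp [cAux, gFun]
  | succ n ih =>
    have hp := cAux_pos s hs hs1 n
    have e : cAux s (n + 1 + 1) = ((1 - s) * cAux s (n + 1) + ((n : ℝ) + 2)) / s := by
      rw [cAux]; push_cast; ring
    have hq : 0 < (1 - s) * cAux s (n + 1) + ((n : ℝ) + 2) := by
      have := mul_pos (sub_pos.mpr hs1) hp
      positivity
    rw [e]
    simp only [gFun]
    rw [ih]
    generalize cAux s (n + 1) = c at *
    have hq' : 1 - s + ((n : ℝ) + 2) * c⁻¹ = ((1 - s) * c + ((n : ℝ) + 2)) / c := by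
      field_simp
    rw [hq']
    field_simp

/-- The supremum over tuples `1 ≤ α_1 ≤ ⋯ ≤ α_{d-1} ≤ B` (with `α_0 = 1`, `α_d = B`) of
`min_{1 ≤ k ≤ d} (α_{k-1}^{1-s} α_k^{-s})^{1/k}` equals `B^{-g_d(s)}`, and it is attained
at a tuple for which all `d` quantities are equal. -/
theorem sup_min_eq_B_pow_neg_gd (d : ℕ) (hd : 1 ≤ d) (B s : ℝ) (hB : 1 < B)
    (hs : s ∈ Set.Ioo (0 : ℝ) 1) :
    IsGreatest
      {m : ℝ | ∃ α : ℕ → ℝ, α 0 = 1 ∧ α d = B ∧ (∀ i, i < d → α i ≤ α (i + 1)) ∧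
        m = (Finset.Icc 1 d).inf' (Finset.nonempty_Icc.mpr hd)
              (fun k => ((α (k - 1)) ^ (1 - s) * (α k) ^ (-s)) ^ ((1 : ℝ) / (k : ℝ)))}
      (B ^ (-(gFun d s))) ∧
    ∃ α : ℕ → ℝ, α 0 = 1 ∧ α d = B ∧ (∀ i, i < d → α i ≤ α (i + 1)) ∧
      ∀ k ∈ Finset.Icc 1 d,
        ((α (k - 1)) ^ (1 - s) * (α k) ^ (-s)) ^ ((1 : ℝ) / (k : ℝ)) = B ^ (-(gFun d s)) := by
  obtain ⟨hs0, hs1⟩ := hs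
  have hB0 : 0 < B := by linarith
  have hL : 0 < Real.log B := Real.log_pos hB
  have hg : gFun d s * cAux s d = 1 ∧ 0 < gFun d s := by
    obtain ⟨n, rfl⟩ : ∃ n, d = n + 1 := ⟨d - 1, by omega⟩
    have hp := cAux_pos s hs0 hs1 n
    rw [gFun_eq s hs0 hs1 n]
    exact ⟨inv_mul_cancel₀ hp.ne', inv_pos.mpr hp⟩
  obtain ⟨hgc, hgp⟩ := hg
  have key : ∃ α : ℕ → ℝ, α 0 = 1 ∧ α d = B ∧ (∀ i, i < d → α i ≤ α (i + 1)) ∧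
      ∀ k ∈ Finset.Icc 1 d,
        ((α (k - 1)) ^ (1 - s) * (α k) ^ (-s)) ^ ((1 : ℝ) / (k : ℝ)) = B ^ (-(gFun d s)) := by
    refine ⟨fun k => B ^ (gFun d s * cAux s k), by simp [cAux], by simp [hgc], ?_, ?_⟩
    · intro i _
      exact Real.rpow_le_rpow_of_exponent_le hB.le
        (mul_le_mul_of_nonneg_left (cAux_lt s hs0 hs1 i).le hgp.le)
    · intro k hk
      obtain ⟨n, rfl⟩ : ∃ n, k = n + 1 := ⟨k - 1, by have := (Finset.mem_Icc.mp hk).1; omega⟩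
      have hr := cAux_rec s hs0 n
      simp only [Nat.add_sub_cancel]
      rw [← Real.rpow_mul hB0.le, ← Real.rpow_mul hB0.le, ← Real.rpow_add hB0,
        ← Real.rpow_mul hB0.le]
      congr 1
      have hn : (0 : ℝ) < (n : ℝ) + 1 := by positivity
      push_cast
      rw [mul_one_div, div_eq_iff hn.ne']
      linear_combination (- gFun d s) * hr
  refine ⟨⟨?_, ?_⟩, key⟩
  · obtain ⟨α, h0, h1, h2, h3⟩ := key
    refine ⟨α, h0, h1, h2, ?_⟩
    apply le_antisymm
    · exact Finset.le_inf' _ _ (fun k hk => (h3 k hk).ge)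
    · have hm : 1 ∈ Finset.Icc 1 d := Finset.mem_Icc.mpr ⟨le_rfl, hd⟩
      exact (Finset.inf'_le _ hm).trans (h3 1 hm).le
  · rintro m ⟨α, h0, h1, h2, rfl⟩
    by_contra! hlt
    rw [Finset.lt_inf'_iff] at hlt
    have hpos : ∀ i, i ≤ d → 1 ≤ α i := by
      intro i
      induction i with
      | zero => intro _; exact h0.ge
      | succ i ih => intro hi; exact (ih (by omega)).trans (h2 i (by omega))
    have hstep : ∀ n, n < d → s * Real.log (α (n + 1)) <
        (1 - s) * Real.log (α n) + ((n : ℝ) + 1) * (gFun d s * Real.log B) := by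
      intro n hn
      have h := hlt (n + 1) (Finset.mem_Icc.mpr ⟨by omega, by omega⟩)
      simp only [Nat.add_sub_cancel] at h
      have ha : 0 < α n := by linarith [hpos n (by omega)]
      have hb : 0 < α (n + 1) := by linarith [hpos (n + 1) (by omega)]
      have ha' := Real.rpow_pos_of_pos ha (1 - s)
      have hb' := Real.rpow_pos_of_pos hb (-s)
      have h' := Real.log_lt_log (Real.rpow_pos_of_pos hB0 _) h
      rw [Real.log_rpow hB0, Real.log_rpow (mul_pos ha' hb'), Real.log_mul ha'.ne' hb'.ne',
        Real.log_rpow ha, Real.log_rpow hb] at h'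
      have hn : (0 : ℝ) < (n : ℝ) + 1 := by positivity
      push_cast at h'
      rw [one_div_mul_eq_div, lt_div_iff₀ hn] at h'
      linarith
    have hind : ∀ n, n ≤ d → Real.log (α n) ≤ gFun d s * Real.log B * cAux s n := by
      intro n
      induction n with
      | zero => intro _; simp [h0, cAux]
      | succ n ih =>
        intro hn
        have h := hstep n (by omega)
        have hr := cAux_rec s hs0 n
        have h4 := mul_le_mul_of_nonneg_left (ih (by omega)) (sub_pos.mpr hs1).le
        refine le_of_mul_le_mul_left ?_ hs0
        have : s * (gFun d s * Real.log B * cAux s (n + 1)) =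
          gFun d s * Real.log B * ((1 - s) * cAux s n + ((n : ℝ) + 1)) := by rw [← hr]; ring
        rw [this]
        linarith
    obtain ⟨n, rfl⟩ : ∃ n, d = n + 1 := ⟨d - 1, by omega⟩
    have h := hstep n (by omega)
    have h4 := mul_le_mul_of_nonneg_left (hind n (by omega)) (sub_pos.mpr hs1).le
    have hr := cAux_rec s hs0 n
    rw [h1] at h
    have : s * Real.log B =
        gFun (n + 1) s * Real.log B * ((1 - s) * cAux s n + ((n : ℝ) + 1)) := by
      rw [← hr]; linear_combination (- s * Real.log B) * hgc
    linarith
end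

section
/- Let d ≥ 1 be an integer, B > 1 and 1/2 < s < 1. Define real numbers A_1, …, A_d by A_1 = B^{g_d(s)/s} and A_{j+1} = A_1 · A_j^{(1−s)/s} for 1 ≤ j ≤ d−1. Then A_1 A_2 ⋯ A_d = B. -/
open MeasureTheory Filter Set

noncomputable def eSeq (r : ℝ) : ℕ → ℝ
  | 0 => 0
  | n + 1 => 1 + r * eSeq r n

noncomputable def sSeq (r : ℝ) : ℕ → ℝ
  | 0 => 0
  | n + 1 => sSeq r n + eSeq r (n + 1)

lemma sSeq_rec (r : ℝ) (n : ℕ) : sSeq r (n + 1) = (n + 1 : ℝ) + r * sSeq r n := by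
  induction n with
  | zero => simp [sSeq, eSeq]
  | succ k ih =>
    have h1 : sSeq r (k + 1 + 1) = sSeq r (k + 1) + (1 + r * eSeq r (k + 1)) := rfl
    have h2 : sSeq r (k + 1) = sSeq r k + eSeq r (k + 1) := rfl
    push_cast
    linear_combination h1 + ih - r * h2

lemma gFun_sSeq (s : ℝ) (h0 : 0 < s) (h1 : s < 1) (n : ℕ) :
    0 < gFun (n + 1) s ∧ gFun (n + 1) s * sSeq ((1 - s) / s) (n + 1) = s := by
  induction n with
  | zero => simp [gFun, sSeq, eSeq, h0]
  | succ k ih =>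
    obtain ⟨hp, he⟩ := ih
    have hg : gFun (k + 1 + 1) s
      = s * gFun (k + 1) s / (1 - s + ((k : ℝ) + 2) * gFun (k + 1) s) := rfl
    have hd : 0 < 1 - s + ((k : ℝ) + 2) * gFun (k + 1) s := by
      have : 0 < 1 - s := by linarith
      positivity
    refine ⟨by rw [hg]; positivity, ?_⟩
    rw [hg, sSeq_rec, div_mul_eq_mul_div, div_eq_iff hd.ne']
    have : s * ((1 - s) / s) = 1 - s := by field_simp
    push_cast
    linear_combination (gFun (k + 1) s * sSeq ((1 - s) / s) (k + 1)) * this + (1 - s) * he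

/-- With `A_1 = B^{g_d(s)/s}` and `A_{j+1} = A_1 A_j^{(1-s)/s}`, one has `A_1 A_2 ⋯ A_d = B`. -/
theorem prod_A_eq_B (d : ℕ) (hd : 1 ≤ d) (B s : ℝ) (hB : 1 < B)
    (hs : s ∈ Set.Ioo (1 / 2 : ℝ) 1) (A : ℕ → ℝ)
    (hA1 : A 1 = B ^ (gFun d s / s))
    (hA : ∀ j, 1 ≤ j → j ≤ d - 1 → A (j + 1) = A 1 * (A j) ^ ((1 - s) / s)) :
    ∏ i ∈ Finset.Icc 1 d, A i = B := by
  obtain ⟨hs0, hs1⟩ := hs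
  have h0 : 0 < s := by linarith
  have hB0 : 0 < B := by linarith
  set r := (1 - s) / s with hr
  set c := gFun d s / s with hc
  have hAe : ∀ j, j + 1 ≤ d → A (j + 1) = B ^ (c * eSeq r (j + 1)) := by
    intro j
    induction j with
    | zero => intro _; simp [hA1, eSeq]
    | succ k ih =>
      intro hk
      have he : eSeq r (k + 1 + 1) = 1 + r * eSeq r (k + 1) := rfl
      rw [hA (k + 1) (by omega) (by omega), ih (by omega), hA1, ← Real.rpow_mul hB0.le,
        ← Real.rpow_add hB0, he]
      congr 1
      ring
  have hP : ∀ n, n ≤ d → ∏ i ∈ Finset.Icc 1 n, A i = B ^ (c * sSeq r n) := by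
    intro n
    induction n with
    | zero => intro _; simp [sSeq]
    | succ k ih =>
      intro hk
      have he : sSeq r (k + 1) = sSeq r k + eSeq r (k + 1) := rfl
      rw [Finset.prod_Icc_succ_top (by omega), ih (by omega), hAe k hk, ← Real.rpow_add hB0, he]
      congr 1
      ring
  obtain ⟨m, rfl⟩ : ∃ m, d = m + 1 := ⟨d - 1, by omega⟩
  have hf := (gFun_sSeq s h0 hs1 m).2
  have h1 : c * sSeq r (m + 1) = 1 := by
    rw [hc, div_mul_eq_mul_div, hf, div_self h0.ne']
  rw [hP _ le_rfl, h1, Real.rpow_one]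
end

section
/- For every fixed integer n ≥ 1, the function g_n is well defined on [0,1] (its denominator 1 − s + n·g_{n−1}(s) never vanishes there), is continuous and strictly increasing on [0,1], and is differentiable on (0,1); moreover g_n(0) = 0 and g_n(1) = 1/n. -/
open MeasureTheory Filter Set

theorem gFun_den_pos (m : ℕ) (c : ℝ) (hc : 0 < c)
    (hm : StrictMonoOn (gFun (m + 1)) (Set.Icc (0 : ℝ) 1)) (h0 : gFun (m + 1) 0 = 0)
    (s : ℝ) (hs : s ∈ Set.Icc (0 : ℝ) 1) :
    0 ≤ gFun (m + 1) s ∧ 0 < 1 - s + c * gFun (m + 1) s := by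
  rcases eq_or_lt_of_le hs.1 with h | h
  · subst h
    simp [h0]
  · have h1 := hm (by simp) hs h
    rw [h0] at h1
    have := mul_pos hc h1
    exact ⟨h1.le, by linarith [hs.2]⟩

theorem gFun_aux (m : ℕ) :
    ContinuousOn (gFun (m + 1)) (Set.Icc (0 : ℝ) 1) ∧
    StrictMonoOn (gFun (m + 1)) (Set.Icc (0 : ℝ) 1) ∧
    (∀ s ∈ Set.Ioo (0 : ℝ) 1, DifferentiableAt ℝ (gFun (m + 1)) s) ∧
    gFun (m + 1) 0 = 0 ∧ gFun (m + 1) 1 = 1 / ((m : ℝ) + 1) := by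
  induction m with
  | zero =>
    have h : gFun (0 + 1) = fun s => s := by
      funext s
      simp [gFun]
    rw [h]
    exact ⟨continuousOn_id, strictMono_id.strictMonoOn _, fun s _ => differentiableAt_id, rfl,
      by simp⟩
  | succ m ih =>
    obtain ⟨hc, hm, hd, h0, h1⟩ := ih
    have h : gFun (m + 1 + 1) =
        fun s => s * gFun (m + 1) s / (1 - s + ((m : ℝ) + 2) * gFun (m + 1) s) := by
      funext s
      rw [gFun]
    have hp : (0 : ℝ) < (m : ℝ) + 2 := by positivity
    have key := gFun_den_pos m _ hp hm h0
    rw [h]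
    refine ⟨?_, ?_, ?_, by simp, ?_⟩
    · refine ContinuousOn.div (continuousOn_id.mul hc) ?_ fun s hs => (key s hs).2.ne'
      exact (continuousOn_const.sub continuousOn_id).add (continuousOn_const.mul hc)
    · intro s hs t ht hst
      have hk := hm hs ht hst
      obtain ⟨a1, a2⟩ := key s hs
      obtain ⟨b1, b2⟩ := key t ht
      simp only
      rw [div_lt_div_iff₀ a2 b2]
      have hkp : 0 < gFun (m + 1) t := lt_of_le_of_lt a1 hk
      have e1 : 0 < t * (1 - s) := mul_pos (by linarith [hs.1]) (by linarith [ht.2])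
      have e2 : gFun (m + 1) s * (s * (1 - t)) ≤ gFun (m + 1) s * (t * (1 - s)) :=
        mul_le_mul_of_nonneg_left (by nlinarith) a1
      have e3 : gFun (m + 1) s * (t * (1 - s)) < gFun (m + 1) t * (t * (1 - s)) :=
        mul_lt_mul_of_pos_right hk e1
      have e4 : 0 ≤ ((m : ℝ) + 2) * (gFun (m + 1) s * gFun (m + 1) t) * (t - s) :=
        mul_nonneg (mul_nonneg hp.le (mul_nonneg a1 b1)) (by linarith)
      nlinarith
    · intro s hs
      have hs' := hd s hs
      refine DifferentiableAt.fun_div ?_ ?_ (key s ⟨hs.1.le, hs.2.le⟩).2.ne'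
      · fun_prop
      · fun_prop
    · simp only
      rw [h1]
      push_cast
      have : (m : ℝ) + 1 ≠ 0 := by positivity
      have : (m : ℝ) + 1 + 1 ≠ 0 := by positivity
      have : (m : ℝ) + 2 ≠ 0 := by positivity
      field_simp
      ring

/-- For fixed `n ≥ 1`, `g_n` is well defined on `[0,1]` (for `n ≥ 2` its denominator
`1 - s + n g_{n-1}(s)` never vanishes there), continuous and strictly increasing on `[0,1]`,
differentiable on `(0,1)`, with `g_n(0) = 0` and `g_n(1) = 1/n`. -/
theorem gFun_properties (n : ℕ) (hn : 1 ≤ n) :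
    (2 ≤ n → ∀ s ∈ Set.Icc (0 : ℝ) 1, 1 - s + (n : ℝ) * gFun (n - 1) s ≠ 0) ∧
    ContinuousOn (gFun n) (Set.Icc (0 : ℝ) 1) ∧
    StrictMonoOn (gFun n) (Set.Icc (0 : ℝ) 1) ∧
    (∀ s ∈ Set.Ioo (0 : ℝ) 1, DifferentiableAt ℝ (gFun n) s) ∧
    gFun n 0 = 0 ∧ gFun n 1 = 1 / (n : ℝ) := by
  obtain ⟨m, rfl⟩ : ∃ m, n = m + 1 := ⟨n - 1, by omega⟩
  obtain ⟨hc, hm, hd, h0, h1⟩ := gFun_aux m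
  refine ⟨?_, hc, hm, hd, h0, by rw [h1]; push_cast; rfl⟩
  intro h2 s hs
  obtain ⟨k, rfl⟩ : ∃ k, m = k + 1 := ⟨m - 1, by omega⟩
  obtain ⟨-, hm', -, h0', -⟩ := gFun_aux k
  exact (gFun_den_pos k ((k + 1 + 1 : ℕ) : ℝ) (by positivity) hm' h0' s hs).2.ne'
end

section
/- For every integer n ≥ 1 and every s ∈ (1/2, 1) one has g_{n+1}(s) ≤ g_n(s) ≤ s < 1. -/
open MeasureTheory Filter Set

theorem gFun_aux_s12 (s : ℝ) (h1 : 1 / 2 < s) (h2 : s < 1) (k : ℕ) :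
    0 < gFun (k + 1) s ∧ 2 * s - 1 ≤ ((k : ℝ) + 2) * gFun (k + 1) s ∧
    gFun (k + 2) s ≤ gFun (k + 1) s ∧ gFun (k + 1) s ≤ s := by
  have step : ∀ k : ℕ, 0 < gFun (k + 1) s → 2 * s - 1 ≤ ((k : ℝ) + 2) * gFun (k + 1) s →
      gFun (k + 2) s ≤ gFun (k + 1) s := by
    intro k hp hb
    rw [gFun]
    have hk : (0 : ℝ) ≤ k := Nat.cast_nonneg k
    have hd : 0 < 1 - s + ((k : ℝ) + 2) * gFun (k + 1) s := by linarith
    rw [div_le_iff₀ hd]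
    nlinarith
  induction k with
  | zero =>
    have e : gFun (0 + 1) s = s := by simp [gFun]
    have hp : 0 < gFun (0 + 1) s := by rw [e]; linarith
    have hb : 2 * s - 1 ≤ (((0 : ℕ) : ℝ) + 2) * gFun (0 + 1) s := by
      rw [e]; push_cast; linarith
    exact ⟨hp, hb, step 0 hp hb, e.le⟩
  | succ k ih =>
    obtain ⟨hp, hb, hm, hs⟩ := ih
    have hk : (0 : ℝ) ≤ k := Nat.cast_nonneg k
    have hd : 0 < 1 - s + ((k : ℝ) + 2) * gFun (k + 1) s := by linarith
    have hp' : 0 < gFun (k + 1 + 1) s := by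
      rw [gFun]
      exact div_pos (mul_pos (by linarith) hp) hd
    have hb0 : 2 * s - 1 ≤ ((k : ℝ) + 2) * gFun (k + 1 + 1) s := by
      rw [gFun, ← mul_div_assoc, le_div_iff₀ hd]
      nlinarith
    have hb' : 2 * s - 1 ≤ (((k + 1 : ℕ) : ℝ) + 2) * gFun (k + 1 + 1) s := by
      push_cast
      linarith
    exact ⟨hp', hb', step (k + 1) hp' hb', hm.trans hs⟩

/-- For every `n ≥ 1` and `s ∈ (1/2, 1)` one has `g_{n+1}(s) ≤ g_n(s) ≤ s < 1`. -/
theorem gFun_antitone (n : ℕ) (hn : 1 ≤ n) (s : ℝ) (hs : s ∈ Set.Ioo (1 / 2 : ℝ) 1) :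
    gFun (n + 1) s ≤ gFun n s ∧ gFun n s ≤ s ∧ s < 1 := by
  obtain ⟨k, rfl⟩ : ∃ k, n = k + 1 := ⟨n - 1, by omega⟩
  obtain ⟨_, _, h3, h4⟩ := gFun_aux_s12 s hs.1 hs.2 k
  exact ⟨h3, h4, hs.2⟩
end

section
/- For every integer n ≥ 1 one has f_n(0) = 0, f_n(1) = 1, f_n(1/2) = 1/(2n), and for every s ∈ (0,1) with s ≠ 1/2, f_n(s) = s^n (2s − 1) / ( s^n − (1−s)^n ). -/
open MeasureTheory Filter Set

/-- `f_n(s)`: `f_1(s) = s`, `f_{k+1}(s) = s f_k(s) / (1 - s + f_k(s))` for `k ≥ 1`. -/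
noncomputable def fFun : ℕ → ℝ → ℝ
  | 0, s => s
  | 1, s => s
  | k + 2, s => s * fFun (k + 1) s / (1 - s + fFun (k + 1) s)

/-- Explicit formula for `f_n`: `f_n(0) = 0`, `f_n(1) = 1`, `f_n(1/2) = 1/(2n)` and for
`s ∈ (0,1)`, `s ≠ 1/2`, `f_n(s) = s^n (2s-1) / (s^n - (1-s)^n)`. -/
theorem fFun_explicit (n : ℕ) (hn : 1 ≤ n) :
    fFun n 0 = 0 ∧ fFun n 1 = 1 ∧ fFun n (1 / 2) = 1 / (2 * (n : ℝ)) ∧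
    ∀ s ∈ Set.Ioo (0 : ℝ) 1, s ≠ 1 / 2 →
      fFun n s = s ^ n * (2 * s - 1) / (s ^ n - (1 - s) ^ n) := by
  induction n, hn using Nat.le_induction with
  | base =>
    refine ⟨by simp [fFun], by simp [fFun], by simp [fFun], ?_⟩
    intro s hs h
    have h1 : 2 * s - 1 ≠ 0 := fun h' => h (by linarith)
    have h2 : s ^ 1 - (1 - s) ^ 1 = 2 * s - 1 := by ring
    rw [h2, mul_div_assoc, div_self h1]
    simp [fFun]
  | succ n hn ih =>
    obtain ⟨k, rfl⟩ : ∃ k, n = k + 1 := ⟨n - 1, by omega⟩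
    obtain ⟨a, b, c, d⟩ := ih
    refine ⟨by simp [fFun], by simp [fFun, b], ?_, ?_⟩
    · rw [fFun, c]
      have : (0 : ℝ) ≤ k := Nat.cast_nonneg k
      push_cast
      field_simp
      ring
    · intro s hs h
      have key : ∀ m : ℕ, m ≠ 0 → s ^ m - (1 - s) ^ m ≠ 0 := by
        intro m hm h'
        have := (pow_left_inj₀ hs.1.le (by linarith [hs.2] : 0 ≤ 1 - s) hm).1 (sub_eq_zero.1 h')
        exact h (by linarith)
      have h1 := key (k + 1) (by omega)
      have h2 := key (k + 1 + 1) (by omega)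
      rw [fFun, d s hs h]
      have e : 1 - s + s ^ (k + 1) * (2 * s - 1) / (s ^ (k + 1) - (1 - s) ^ (k + 1))
          = (s ^ (k + 1 + 1) - (1 - s) ^ (k + 1 + 1)) / (s ^ (k + 1) - (1 - s) ^ (k + 1)) := by
        rw [eq_div_iff h1, add_mul, div_mul_cancel₀ _ h1]
        ring
      rw [e, mul_div_assoc', div_div_div_cancel_right₀ h1]
      ring
end

section
/- For every integer n ≥ 1 and every s ∈ (1/2, 1) one has f_n(s) ≥ ((n+1)/2) · g_n(s). -/
open MeasureTheory Filter Set

theorem aux_inv (s : ℝ) (h1 : 1 / 2 < s) (h2 : s < 1) (n : ℕ) :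
    0 < gFun (n + 1) s ∧ 0 < fFun (n + 1) s ∧ s * (fFun (n + 1) s)⁻¹ ≤ (n : ℝ) + 1 ∧
      ((n : ℝ) + 2) / 2 * (fFun (n + 1) s)⁻¹ ≤ (gFun (n + 1) s)⁻¹ := by
  have hs : 0 < s := by linarith
  induction n with
  | zero => simp [gFun, fFun, hs, hs.ne']
  | succ n ih =>
    obtain ⟨hg, hf, hb, hc⟩ := ih
    have hn : (0 : ℝ) ≤ n := Nat.cast_nonneg n
    simp only [gFun, fFun]
    generalize gFun (n + 1) s = g at *
    generalize fFun (n + 1) s = f at *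
    have hr : 0 < 1 - s := by linarith
    have e1 : (s * g / (1 - s + ((n : ℝ) + 2) * g))⁻¹ = ((1 - s) * g⁻¹ + (n + 2)) / s := by
      field_simp
    have e2 : (s * f / (1 - s + f))⁻¹ = ((1 - s) * f⁻¹ + 1) / s := by
      field_simp
    refine ⟨by positivity, by positivity, ?_, ?_⟩
    · rw [e2, mul_div_cancel₀ _ hs.ne']
      push_cast
      have : 0 < f⁻¹ := by positivity
      nlinarith
    · rw [e1, e2, ← mul_div_assoc]
      apply div_le_div_of_nonneg_right _ hs.le
      push_cast
      have : 0 < f⁻¹ := by positivity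
      have := mul_le_mul_of_nonneg_left hc hr.le
      nlinarith

/-- For every `n ≥ 1` and `s ∈ (1/2, 1)` one has `f_n(s) ≥ ((n+1)/2) g_n(s)`. -/
theorem fFun_ge_gFun (n : ℕ) (hn : 1 ≤ n) (s : ℝ) (hs : s ∈ Set.Ioo (1 / 2 : ℝ) 1) :
    ((n : ℝ) + 1) / 2 * gFun n s ≤ fFun n s := by
  obtain ⟨m, rfl⟩ : ∃ m, n = m + 1 := ⟨n - 1, by omega⟩
  obtain ⟨hg, hf, -, hc⟩ := aux_inv s hs.1 hs.2 m
  push_cast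
  have h := mul_le_mul_of_nonneg_right hc (mul_pos hg hf).le
  have e1 : ((m : ℝ) + 2) / 2 * (fFun (m + 1) s)⁻¹ * (gFun (m + 1) s * fFun (m + 1) s)
      = ((m : ℝ) + 2) / 2 * gFun (m + 1) s := by field_simp
  have e2 : (gFun (m + 1) s)⁻¹ * (gFun (m + 1) s * fFun (m + 1) s) = fFun (m + 1) s := by
    field_simp
  rw [e1, e2] at h
  linarith
end
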